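/- arXiv:1302.6954 — 4 statements merged into one kernel-verified Lean document; each statement's English description precedes it below -/
import Mathlib

section
/- Let f : 𝕋¹ → 𝕋¹ be an orientation-preserving homeomorphism with irrational rotation number ρ, and suppose f is not topologically conjugate to the rotation R_ρ. Then there is a Cantor set K ⊂ 𝕋¹ (compact, perfect, totally disconnected) which is a minimal set for f, and every connected component J of 𝕋¹ \ K is a wandering open interval, i.e. fⁿ(J) ∩ J = ∅ for all n ≠ 0. -/
open Filter Topology Set Function

noncomputable section

/-- The circle 𝕋¹ = ℝ/ℤ. -/
abbrev T1 : Type := AddCircle (1 : ℝ)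

/-- The canonical projection π : ℝ → 𝕋¹. -/
def projC : ℝ → T1 := fun x => (x : T1)

/-- `F` is a lift of the orientation-preserving circle homeomorphism `f`. -/
def IsCircleLift (f : T1 → T1) (F : ℝ → ℝ) : Prop :=
  StrictMono F ∧ (∀ x : ℝ, F (x + 1) = F x + 1) ∧ ∀ x : ℝ, projC (F x) = f (projC x)

/-- Integer iterates of a homeomorphism. -/
def hIter {X : Type*} [TopologicalSpace X] (f : X ≃ₜ X) : ℤ → X → X
  | Int.ofNat n => (⇑f)^[n]
  | Int.negSucc n => (⇑f.symm)^[n + 1]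

theorem eq_of_locConst {X Y : Type*} [TopologicalSpace X] (g : X → Y) {S : Set X}
    (hS : IsPreconnected S) (hg : ∀ y ∈ S, ∀ᶠ w in 𝓝 y, g w = g y) {a b : X}
    (ha : a ∈ S) (hb : b ∈ S) : g a = g b := by
  refine hS.induction₂ (fun a b => g a = g b) ?_ ?_ ?_ ha hb
  · intro x hx
    exact ((hg x hx).filter_mono nhdsWithin_le_nhds).mono fun y hy => hy.symm
  · intro x y z _ _ _ h1 h2; exact h1.trans h2
  · intro x y _ _ h; exact h.symm

theorem T1_eq_iff (x y : ℝ) : (x : T1) = (y : T1) ↔ ∃ m : ℤ, x = y + m := by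
  rw [← sub_eq_zero, ← AddCircle.coe_sub, AddCircle.coe_eq_zero_iff]
  constructor
  · rintro ⟨n, hn⟩
    refine ⟨n, ?_⟩
    simp at hn
    linarith
  · rintro ⟨n, hn⟩
    refine ⟨n, ?_⟩
    simp
    linarith

theorem T1_mul_ne {ρ : ℝ} (hirr : Irrational ρ) (n : ℤ) (hn : n ≠ 0) : n • (ρ : T1) ≠ 0 := by
  rw [← AddCircle.coe_zsmul]
  intro h
  rw [AddCircle.coe_eq_zero_iff] at h
  obtain ⟨m, hm⟩ := h
  simp at hm
  have := hirr.intCast_mul hn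
  rw [← hm] at this
  exact this ⟨m, by simp⟩

theorem exists_semiconj (F : ℝ ≃ₜ ℝ) (hm : StrictMono F) (h1 : ∀ x : ℝ, F (x + 1) = F x + 1)
    (ρ : ℝ)
    (hρ : ∀ x : ℝ, Tendsto (fun n : ℕ => ((⇑F)^[n] x - x) / (n : ℝ)) atTop (𝓝 ρ))
    (hirr : Irrational ρ) :
    ∃ H : CircleDeg1Lift, Continuous H ∧ ∀ x, H (F x) = H x + ρ := by
  let G : CircleDeg1Lift := ⟨⟨F, hm.monotone⟩, h1⟩
  have hG : G.translationNumber = ρ := by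
    have := G.tendsto_translationNumber 0
    refine tendsto_nhds_unique this ?_
    simp only [CircleDeg1Lift.coe_pow]
    exact hρ 0
  obtain ⟨H, hH⟩ := CircleDeg1Lift.semiconj_of_bijective_of_translationNumber_eq
    (f₁ := G) (f₂ := CircleDeg1Lift.translate (Multiplicative.ofAdd ρ)) F.bijective
    (CircleDeg1Lift.isUnit_iff_bijective.1 (Units.isUnit _))
    (by rw [hG, CircleDeg1Lift.translationNumber_translate])
  have hH' : ∀ x, H (F x) = H x + ρ := by
    intro x
    have := hH x
    rw [CircleDeg1Lift.translate_apply] at this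
    rw [add_comm]; exact this
  refine ⟨H, ?_, hH'⟩
  apply H.monotone.continuous_of_denseRange
  -- range is invariant
  have key : ∀ t ∈ AddSubgroup.closure ({1, ρ} : Set ℝ), H 0 + t ∈ range H := by
    intro t ht
    suffices ∀ y, y ∈ range H ↔ y + t ∈ range H from (this _).1 ⟨0, rfl⟩
    induction ht using AddSubgroup.closure_induction with
    | mem t ht =>
      intro y
      rcases ht with rfl | rfl
      · constructor
        · rintro ⟨x, rfl⟩
          exact ⟨x + 1, by simp⟩
        · rintro ⟨x, hx⟩
          refine ⟨x - 1, ?_⟩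
          have := H.map_add_one (x - 1)
          rw [sub_add_cancel] at this
          linarith
      · constructor
        · rintro ⟨x, rfl⟩
          exact ⟨F x, hH' x⟩
        · rintro ⟨x, hx⟩
          refine ⟨F.symm x, ?_⟩
          have := hH' (F.symm x)
          rw [F.apply_symm_apply] at this
          linarith
    | zero => simp
    | add a b _ _ iha ihb =>
      intro y
      rw [← add_assoc, iha, ihb]
    | neg a ha iha =>
      intro y
      rw [iha (y + -a), neg_add_cancel_right]
  have hd : Dense ((AddSubgroup.closure ({1, ρ} : Set ℝ) : AddSubgroup ℝ) : Set ℝ) :=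
    by
    rw [Set.pair_comm]
    exact dense_addSubgroupClosure_pair_iff.2 (by simpa using hirr)
  have hd2 := ((Homeomorph.addLeft (H 0)).surjective.denseRange.dense_image (Homeomorph.addLeft (H 0)).continuous hd)
  refine hd2.mono ?_
  rintro _ ⟨t, ht, rfl⟩
  exact key t ht

theorem h_hIter (f : T1 ≃ₜ T1) (h : T1 → T1) (r : T1) (hf : ∀ z, h (f z) = h z + r)
    (n : ℤ) (z : T1) : h (hIter f n z) = h z + n • r := by
  have hs : ∀ z, h (f.symm z) = h z - r := by
    intro z
    have := hf (f.symm z)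
    rw [f.apply_symm_apply] at this
    rw [this]; abel
  have h1 : ∀ (k : ℕ) z, h ((⇑f)^[k] z) = h z + k • r := by
    intro k
    induction k with
    | zero => intro z; simp
    | succ k ih => intro z; rw [iterate_succ_apply, ih, hf, succ_nsmul]; abel
  have h2 : ∀ (k : ℕ) z, h ((⇑f.symm)^[k] z) = h z - k • r := by
    intro k
    induction k with
    | zero => intro z; simp
    | succ k ih => intro z; rw [iterate_succ_apply, ih, hs, succ_nsmul]; abel
  cases n with
  | ofNat k => simpa [hIter] using h1 k z
  | negSucc k =>
    have := h2 (k + 1) z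
    rw [negSucc_zsmul, ← sub_eq_add_neg]
    exact this

theorem eventually_T1 (x : ℝ) (p : T1 → Prop) :
    (∀ᶠ z in 𝓝 (x : T1), p z) ↔ ∀ᶠ y : ℝ in 𝓝 x, p (y : T1) := by
  have : 𝓝 (x : T1) = Filter.map (fun y : ℝ => (y : T1)) (𝓝 x) :=
    QuotientAddGroup.nhds_eq _ x
  rw [this, eventually_map]

theorem T1_locallyConnected : LocallyConnectedSpace T1 := by
  have : IsOpenQuotientMap (fun y : ℝ => (y : T1)) := QuotientAddGroup.isOpenQuotientMap_mk
  exact this.isQuotientMap.isCoinducing.locallyConnectedSpace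

theorem T1_isOpenMap : IsOpenMap (fun y : ℝ => (y : T1)) := by
  have : IsOpenQuotientMap (fun y : ℝ => (y : T1)) := QuotientAddGroup.isOpenQuotientMap_mk
  exact this.isOpenMap

theorem T1_surj (z : T1) : ∃ x : ℝ, (x : T1) = z := QuotientAddGroup.mk_surjective z

theorem T1_cont : Continuous (fun y : ℝ => (y : T1)) := AddCircle.continuous_mk' 1

/-- Local constancy may be checked on the lift. -/
theorem locConst_iff (H : CircleDeg1Lift) (hc : Continuous H) (h : T1 → T1)
    (hh : ∀ x : ℝ, h (x : T1) = (H x : T1)) (x : ℝ) :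
    (∀ᶠ w in 𝓝 (x : T1), h w = h (x : T1)) ↔ ∀ᶠ y in 𝓝 x, H y = H x := by
  rw [eventually_T1]
  constructor
  · intro h1
    have h2 : ∀ᶠ y in 𝓝 x, |H y - H x| < 1 := by
      have := (hc.tendsto x).eventually (Metric.ball_mem_nhds (H x) one_pos)
      filter_upwards [this] with y hy
      simpa [Real.dist_eq] using hy
    filter_upwards [h1, h2] with y hy1 hy2
    rw [hh, hh, T1_eq_iff] at hy1
    obtain ⟨m, hm⟩ := hy1
    have h3 : |(m : ℝ)| < 1 := by rw [hm] at hy2; simpa using hy2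
    have h4 : m = 0 := by
      have : |m| < 1 := by exact_mod_cast h3
      exact Int.abs_lt_one_iff.1 this
    rw [hm, h4]; simp
  · intro h1
    filter_upwards [h1] with y hy
    rw [hh, hh, hy]

/-- The complement of the locally constant locus is preperfect. -/
theorem acc_of_not_locConst (H : CircleDeg1Lift) (hc : Continuous H) (h : T1 → T1)
    (hh : ∀ x : ℝ, h (x : T1) = (H x : T1)) (z : T1)
    (hz : ¬ ∀ᶠ w in 𝓝 z, h w = h z) :
    AccPt z (𝓟 {z | ¬ ∀ᶠ w in 𝓝 z, h w = h z}) := by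
  obtain ⟨x, rfl⟩ := T1_surj z
  rw [accPt_iff_frequently]
  intro hcon
  apply hz
  rw [eventually_T1] at hcon
  rw [locConst_iff H hc h hh]
  obtain ⟨ε, hε, hball⟩ := Metric.eventually_nhds_iff.1 hcon
  set δ := min ε 1 with hδ
  have hδ0 : 0 < δ := lt_min hε one_pos
  have key : ∀ y, y ≠ x → |y - x| < δ → ∀ᶠ w in 𝓝 y, H w = H y := by
    intro y hyx hy
    have h1 := hball (y := y) (by rw [Real.dist_eq]; exact hy.trans_le (min_le_left _ _))
    rw [← locConst_iff H hc h hh]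
    by_contra hcc
    refine h1 ⟨?_, hcc⟩
    intro heq
    rw [T1_eq_iff] at heq
    obtain ⟨m, hm⟩ := heq
    have h3 : |(m : ℝ)| < 1 := by
      have := hy.trans_le (min_le_right _ _)
      rw [hm] at this; simpa using this
    have h4 : m = 0 := by
      have : |m| < 1 := by exact_mod_cast h3
      exact Int.abs_lt_one_iff.1 this
    apply hyx; rw [hm, h4]; simp
  rw [Metric.eventually_nhds_iff]
  refine ⟨δ, hδ0, fun {y} hy => ?_⟩
  rw [Real.dist_eq, abs_lt] at hy
  have hcl : IsClosed {w | H w = H y} := isClosed_eq hc continuous_const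
  rcases lt_trichotomy y x with hlt | heq | hgt
  · have hsub : Ioo (x - δ) x ⊆ {w | H w = H y} := by
      intro w hw
      refine eq_of_locConst H isPreconnected_Ioo (S := Ioo (x - δ) x) ?_ hw ⟨by linarith, hlt⟩
      intro u hu
      exact key u hu.2.ne (by rw [abs_lt]; constructor <;> linarith [hu.1, hu.2])
    have := closure_minimal hsub hcl
    rw [closure_Ioo (by linarith)] at this
    exact (this (right_mem_Icc.2 (by linarith))).symm
  · rw [heq]
  · have hsub : Ioo x (x + δ) ⊆ {w | H w = H y} := by
      intro w hw
      refine eq_of_locConst H isPreconnected_Ioo (S := Ioo x (x + δ)) ?_ hw ⟨hgt, by linarith⟩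
      intro u hu
      exact key u hu.1.ne' (by rw [abs_lt]; constructor <;> linarith [hu.1, hu.2])
    have := closure_minimal hsub hcl
    rw [closure_Ioo (by linarith)] at this
    exact (this (left_mem_Icc.2 (by linarith))).symm

/-- A subset of the circle whose complement is dense is totally disconnected. -/
theorem totDisc_of_dense_compl (K : Set T1) (hK : Dense Kᶜ) : IsTotallyDisconnected K := by
  intro S hSK hS a ha b hb
  by_contra hab
  obtain ⟨p, rfl⟩ := T1_surj a
  obtain ⟨q, hq1, rfl⟩ : ∃ q ∈ Ico p (p + 1), (q : T1) = b := by
    have := (AddCircle.coe_image_Ico_eq (1 : ℝ) p).symm ▸ mem_univ b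
    exact this
  have hpq : p < q := lt_of_le_of_ne hq1.1 (fun h => hab (by rw [h]))
  have pick : ∀ s t : ℝ, s < t → ∃ u ∈ Ioo s t, (u : T1) ∉ K := by
    intro s t hst
    obtain ⟨_, hz, u, hu, rfl⟩ := hK.inter_open_nonempty _ (T1_isOpenMap _ (isOpen_Ioo (a := s) (b := t)))
      ((nonempty_Ioo.2 hst).image _) |>.imp fun z hz => And.intro hz.2 hz.1
    exact ⟨u, hu, hz⟩
  obtain ⟨u, hu, huK⟩ := pick p q hpq
  obtain ⟨v, hv, hvK⟩ := pick q (p + 1) hq1.2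
  let A := (fun y : ℝ => (y : T1)) '' Ioo u v
  let B := (fun y : ℝ => (y : T1)) '' Ioo v (u + 1)
  have hA : IsOpen A := T1_isOpenMap _ isOpen_Ioo
  have hB : IsOpen B := T1_isOpenMap _ isOpen_Ioo
  have hcov : S ⊆ A ∪ B := by
    intro z hz
    obtain ⟨w, hw, rfl⟩ : ∃ w ∈ Ico u (u + 1), (w : T1) = z := by
      have := (AddCircle.coe_image_Ico_eq (1 : ℝ) u).symm ▸ mem_univ z
      exact this
    have hwu : u ≠ w := by rintro rfl; exact huK (hSK hz)
    have hwv : w ≠ v := by rintro rfl; exact hvK (hSK hz)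
    rcases lt_or_gt_of_ne hwv with h1 | h1
    · exact Or.inl ⟨w, ⟨lt_of_le_of_ne hw.1 hwu, h1⟩, rfl⟩
    · exact Or.inr ⟨w, ⟨h1, hw.2⟩, rfl⟩
  obtain ⟨z, _, ⟨s, hs, rfl⟩, ⟨t, ht, hst⟩⟩ := hS A B hA hB hcov ⟨_, hb, q, ⟨hu.2, hv.1⟩, rfl⟩
    ⟨_, ha, p + 1, ⟨hv.2, by linarith [hu.1]⟩, by simp⟩
  have hst' : (t : T1) = (s : T1) := hst
  rw [AddCircle.coe_eq_coe_iff_of_mem_Ico (a := u) ⟨by linarith [hu.2, hv.1, ht.1], ht.2⟩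
    ⟨hs.1.le, by linarith [hs.2, hv.2, hu.1]⟩] at hst'
  linarith [hs.2, ht.1]

/-- A nonempty closed set invariant under an irrational rotation is everything. -/
theorem closed_inv_eq_univ {ρ : ℝ} (hirr : Irrational ρ) (L : Set T1) (hL : IsClosed L)
    (hne : L.Nonempty) (hinv : ∀ y, y ∈ L ↔ y + (ρ : T1) ∈ L) : L = univ := by
  obtain ⟨y, hy⟩ := hne
  have h1 : ∀ n : ℤ, y + n • (ρ : T1) ∈ L := by
    intro n
    induction n using Int.induction_on with
    | zero => simpa using hy
    | succ k ih =>
      rw [add_zsmul, one_zsmul, ← add_assoc]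
      exact (hinv _).1 ih
    | pred k ih =>
      rw [hinv, sub_zsmul, one_zsmul]
      convert ih using 1
      abel
  have hd : DenseRange (fun n : ℤ => n • (ρ : T1)) :=
    AddCircle.denseRange_zsmul_coe_iff.2 (by simpa using hirr)
  have hd2 := (Homeomorph.addLeft y).surjective.denseRange.dense_image
    (Homeomorph.addLeft y).continuous hd
  refine eq_univ_of_univ_subset ?_
  rw [← hd2.closure_eq]
  refine closure_minimal ?_ hL
  rintro _ ⟨_, ⟨n, rfl⟩, rfl⟩
  exact h1 n

/-- **Denjoy alternative (exceptional case).**  If `f` is an orientation-preserving circle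
homeomorphism with irrational rotation number `ρ` which is not topologically conjugate to
the rotation `R_ρ`, then there is a Cantor set `K ⊂ 𝕋¹` which is minimal for `f`, and every
connected component of `𝕋¹ \ K` is a wandering open interval. -/
theorem denjoy_cantor_minimal_set
    (f : T1 ≃ₜ T1) (F : ℝ ≃ₜ ℝ) (hF : IsCircleLift ⇑f ⇑F) (ρ : ℝ)
    (hρ : ∀ x : ℝ, Tendsto (fun n : ℕ => ((⇑F)^[n] x - x) / (n : ℝ)) atTop (𝓝 ρ))
    (hirr : Irrational ρ)
    (hnotconj : ¬ ∃ h : T1 ≃ₜ T1, ∀ z : T1, h (f z) = h z + (ρ : T1)) :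
    ∃ K : Set T1,
      IsCompact K ∧ Perfect K ∧ IsTotallyDisconnected K ∧ K.Nonempty ∧
      (⇑f) '' K = K ∧
      (∀ K' : Set T1, K' ⊆ K → K'.Nonempty → IsClosed K' → (⇑f) '' K' = K' → K' = K) ∧
      ∀ z ∈ Kᶜ,
        IsOpen (connectedComponentIn Kᶜ z) ∧
        ∀ n : ℤ, n ≠ 0 →
          hIter f n '' connectedComponentIn Kᶜ z ∩ connectedComponentIn Kᶜ z = ∅ := by
  obtain ⟨hm, h1, hlift⟩ := hF
  obtain ⟨H, hc, hHF⟩ := exists_semiconj F hm h1 ρ hρ hirr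
  have hper : Function.Periodic (fun x : ℝ => (H x : T1)) 1 := by
    intro x
    simp
  let h : T1 → T1 := hper.lift
  have hh : ∀ x : ℝ, h (x : T1) = (H x : T1) := fun x => hper.lift_coe x
  have hhc : Continuous h := by
    have : IsOpenQuotientMap (fun y : ℝ => (y : T1)) := QuotientAddGroup.isOpenQuotientMap_mk
    rw [← this.continuous_comp_iff]
    exact T1_cont.comp hc
  have hsurjH : Surjective H := H.continuous_iff_surjective.1 hc
  have hf : ∀ z, h (f z) = h z + (ρ : T1) := by
    intro z
    obtain ⟨x, rfl⟩ := T1_surj z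
    have := hlift x
    simp only [projC] at this
    rw [← this, hh, hh, hHF, AddCircle.coe_add]
  have hninj : ¬ Injective H := by
    intro hinj
    apply hnotconj
    have hbij : Bijective h := by
      constructor
      · intro a b hab
        obtain ⟨x, rfl⟩ := T1_surj a
        obtain ⟨y, rfl⟩ := T1_surj b
        rw [hh, hh, T1_eq_iff] at hab
        obtain ⟨m, hm⟩ := hab
        rw [← H.map_add_int] at hm
        rw [T1_eq_iff]
        exact ⟨m, hinj hm⟩
      · intro b
        obtain ⟨y, rfl⟩ := T1_surj b
        obtain ⟨x, rfl⟩ := hsurjH y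
        exact ⟨x, hh x⟩
    exact ⟨Continuous.homeoOfEquivCompactToT2 (f := Equiv.ofBijective h hbij) hhc, hf⟩
  set K : Set T1 := {z | ¬ ∀ᶠ w in 𝓝 z, h w = h z} with hKdef
  have hmemK : ∀ z, z ∈ K ↔ ¬ ∀ᶠ w in 𝓝 z, h w = h z := fun z => Iff.rfl
  have hmemKc : ∀ z, z ∈ Kᶜ ↔ ∀ᶠ w in 𝓝 z, h w = h z := fun z => by
    rw [mem_compl_iff, hmemK, not_not]
  have hKcl : IsClosed K := by
    rw [← isOpen_compl_iff, isOpen_iff_mem_nhds]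
    intro z hz
    rw [hmemKc] at hz
    have := eventually_eventually_nhds.2 hz
    filter_upwards [this, hz] with w hw hwz
    rw [hmemKc]
    filter_upwards [hw] with u hu
    rw [hu, hwz]
  have hKf : ∀ z, f z ∈ K ↔ z ∈ K := by
    intro z
    rw [hmemK, hmemK, ← f.map_nhds_eq, eventually_map]
    simp only [hf, add_left_inj]
  have himg : ∀ A : Set T1, (∀ z, f z ∈ A ↔ z ∈ A) → f '' A = A := by
    intro A hA
    ext z
    constructor
    · rintro ⟨w, hw, rfl⟩; exact (hA w).2 hw
    · intro hz
      exact ⟨f.symm z, (hA _).1 (by rwa [f.apply_symm_apply]), f.apply_symm_apply z⟩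
  have hKne : K.Nonempty := by
    by_contra hne
    rw [not_nonempty_iff_eq_empty] at hne
    have hall : ∀ z ∈ (univ : Set T1), ∀ᶠ w in 𝓝 z, h w = h z := by
      intro z _
      rw [← hmemKc, hne]; simp
    have := eq_of_locConst h isPreconnected_univ hall (mem_univ (f 0)) (mem_univ 0)
    rw [hf] at this
    have h0 := T1_mul_ne hirr 1 one_ne_zero
    apply h0
    simpa using this
  have hKcne : Kᶜ.Nonempty := by
    rw [Injective] at hninj
    push Not at hninj
    obtain ⟨a, b, hab, hne⟩ := hninj
    wlog hlt : a < b generalizing a b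
    · exact this b a hab.symm hne.symm (lt_of_le_of_ne (not_lt.1 hlt) hne.symm)
    obtain ⟨c, hac, hcb⟩ := exists_between hlt
    refine ⟨(c : T1), ?_⟩
    rw [hmemKc, locConst_iff H hc h hh]
    have hcst : ∀ y ∈ Ioo a b, H y = H a := fun y hy =>
      le_antisymm ((H.monotone hy.2.le).trans hab.ge) (H.monotone hy.1.le)
    filter_upwards [Ioo_mem_nhds hac hcb] with y hy
    rw [hcst y hy, hcst c ⟨hac, hcb⟩]
  have hmin : ∀ K' : Set T1, K' ⊆ K → K'.Nonempty → IsClosed K' → f '' K' = K' → K' = K := by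
    intro K' hsub hne hcl hinv
    refine Subset.antisymm hsub ?_
    have huniv : h '' K' = univ := by
      refine closed_inv_eq_univ hirr _ (hcl.isCompact.image hhc).isClosed (hne.image h) ?_
      intro y
      constructor
      · rintro ⟨z, hz, rfl⟩
        exact ⟨f z, hinv ▸ mem_image_of_mem f hz, hf z⟩
      · rintro ⟨z, hz, hzy⟩
        rw [← hinv] at hz
        obtain ⟨w, hw, rfl⟩ := hz
        rw [hf, add_left_inj] at hzy
        exact ⟨w, hw, hzy⟩
    intro z hz
    by_contra hzK'
    obtain ⟨x, rfl⟩ := T1_surj z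
    rw [hmemK, locConst_iff H hc h hh] at hz
    have hev : ∀ᶠ y : ℝ in 𝓝 x, (y : T1) ∈ K'ᶜ :=
      (eventually_T1 x (fun z => z ∈ K'ᶜ)).1 (hcl.isOpen_compl.mem_nhds hzK')
    obtain ⟨ε, hε, hball⟩ := Metric.eventually_nhds_iff.1 hev
    apply hz
    rw [Metric.eventually_nhds_iff]
    refine ⟨ε, hε, fun {y} hy => ?_⟩
    by_contra hne
    -- a value strictly between
    have hpt : ∀ c : ℝ, ∃ w : ℝ, (w : T1) ∈ K' ∧ H w = c := by
      intro c
      have : (c : T1) ∈ h '' K' := by rw [huniv]; exact mem_univ _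
      obtain ⟨v, hv, hvc⟩ := this
      obtain ⟨w, rfl⟩ := T1_surj v
      rw [hh, eq_comm, T1_eq_iff] at hvc
      obtain ⟨m, hm⟩ := hvc
      refine ⟨w + m, ?_, by rw [H.map_add_int, hm]⟩
      have : ((w + m : ℝ) : T1) = (w : T1) := (T1_eq_iff _ _).2 ⟨m, rfl⟩
      rwa [this]
    rw [Real.dist_eq, abs_lt] at hy
    rcases lt_or_gt_of_ne hne with hlt | hlt
    · obtain ⟨c, hc1, hc2⟩ := exists_between hlt
      obtain ⟨w, hw, rfl⟩ := hpt c
      have e1 := H.monotone.reflect_lt hc1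
      have e2 := H.monotone.reflect_lt hc2
      exact hball (y := w) (by rw [Real.dist_eq, abs_lt]; constructor <;> linarith) hw
    · obtain ⟨c, hc1, hc2⟩ := exists_between hlt
      obtain ⟨w, hw, rfl⟩ := hpt c
      have e1 := H.monotone.reflect_lt hc1
      have e2 := H.monotone.reflect_lt hc2
      exact hball (y := w) (by rw [Real.dist_eq, abs_lt]; constructor <;> linarith) hw
  have hint : interior K = ∅ := by
    have hfi : f '' interior K = interior K := by
      rw [f.image_interior, himg K hKf]
    have hinv : f '' (K \ interior K) = K \ interior K := by
      rw [image_diff f.injective, hfi, himg K hKf]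
    by_cases hne : (K \ interior K).Nonempty
    · have := hmin _ diff_subset hne (hKcl.sdiff isOpen_interior) hinv
      rw [eq_empty_iff_forall_notMem]
      intro z hz
      have hzK := interior_subset hz
      rw [← this] at hzK
      exact hzK.2 hz
    · rw [not_nonempty_iff_eq_empty, diff_eq_empty] at hne
      have hop : IsOpen K := by
        rw [← Subset.antisymm interior_subset hne]; exact isOpen_interior
      have hu := IsClopen.eq_univ ⟨hKcl, hop⟩ hKne
      rw [hu] at hKcne
      simp at hKcne
  haveI := T1_locallyConnected
  refine ⟨K, hKcl.isCompact, ⟨hKcl, ?_⟩, ?_, hKne, himg K hKf, hmin, ?_⟩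
  · intro z hz
    exact acc_of_not_locConst H hc h hh z hz
  · exact totDisc_of_dense_compl K (interior_eq_empty_iff_dense_compl.1 hint)
  · intro z hz
    refine ⟨hKcl.isOpen_compl.connectedComponentIn, ?_⟩
    intro n hn
    rw [eq_empty_iff_forall_notMem]
    rintro _ ⟨⟨w, hw, rfl⟩, hw2⟩
    have := eq_of_locConst h (isPreconnected_connectedComponentIn (F := Kᶜ) (x := z))
      (fun y hy => (hmemKc y).1 (connectedComponentIn_subset _ _ hy)) hw2 hw
    rw [h_hIter f h _ hf] at this
    exact T1_mul_ne hirr n hn (by simpa using this)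
end
end

section
/- Let f : 𝕋² → 𝕋² be a homeomorphism homotopic to the identity and f̃ : ℝ² → ℝ² a lift of f. Then the rotation set ρ(f̃) = ⋂_{m≥1} cl(⋃_{n≥m} {(f̃ⁿ(x) − x)/n : x ∈ ℝ²}) is a nonempty, compact, convex subset of ℝ². -/
open Filter Topology Set Function

noncomputable section

/-- The torus 𝕋² = ℝ²/ℤ². -/
abbrev T2 : Type := AddCircle (1 : ℝ) × AddCircle (1 : ℝ)

/-- The canonical projection π : ℝ² → 𝕋². -/
def proj : ℝ × ℝ → T2 := fun p => ((p.1 : AddCircle (1 : ℝ)), (p.2 : AddCircle (1 : ℝ)))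

/-- `F` is a lift of `f` (which is then homotopic to the identity): it projects to `f`
and commutes with all integer translations. -/
def IsLift (f : T2 → T2) (F : ℝ × ℝ → ℝ × ℝ) : Prop :=
  (∀ x, proj (F x) = f (proj x)) ∧
    ∀ (x : ℝ × ℝ) (v : ℤ × ℤ),
      F (x + ((v.1 : ℝ), (v.2 : ℝ))) = F x + ((v.1 : ℝ), (v.2 : ℝ))

/-- The Misiurewicz–Ziemian rotation set of a lift `F`. -/
def rotSet (F : ℝ × ℝ → ℝ × ℝ) : Set (ℝ × ℝ) :=
  ⋂ m ∈ Set.Ici (1 : ℕ),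
    closure (⋃ n ∈ Set.Ici m, {y : ℝ × ℝ | ∃ x : ℝ × ℝ, y = ((n : ℝ))⁻¹ • (F^[n] x - x)})

lemma exists_log (h : ℝ × ℝ → ℂ) (hc : Continuous h) (h0 : ∀ x, h x ≠ 0) :
    ∃ L : ℝ × ℝ → ℂ, Continuous L ∧ ∀ x, Complex.exp (L x) = h x := by
  have := (Complex.isCoveringMapOn_exp.existsUnique_continuousMap_lifts (⟨h, hc⟩ : C(ℝ × ℝ, ℂ))
    (a₀ := 0) (e₀ := Complex.log (h 0)) (by simp [Complex.exp_log (h0 0)])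
    (by intro a; simpa using h0 a)).exists
  obtain ⟨L, -, hL⟩ := this
  exact ⟨L, L.continuous, fun x => congrFun hL x⟩

lemma log_edge (h L : ℝ → ℂ) (hL : Continuous L) (he : ∀ t, Complex.exp (L t) = h t)
    (hre : ∀ t, 0 ≤ (h t).re) (a b : ℝ) :
    L b - L a = Complex.log (h b) - Complex.log (h a) := by
  have h0 : ∀ t, h t ≠ 0 := fun t => he t ▸ Complex.exp_ne_zero _
  have hh : h = fun t => Complex.exp (L t) := funext fun t => (he t).symm
  have hc : Continuous h := by rw [hh]; fun_prop
  have hs : ∀ t, h t ∈ Complex.slitPlane := by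
    intro t
    rw [Complex.mem_slitPlane_iff]
    by_contra hcon
    push Not at hcon
    exact h0 t (Complex.ext (le_antisymm hcon.1 (hre t)) hcon.2)
  have hD : Continuous fun t => L t - Complex.log (h t) := hL.sub (hc.clog hs)
  have h1 : ∀ t, ∃ n : ℤ, L t - Complex.log (h t) = n * (2 * Real.pi * Complex.I) := by
    intro t
    rw [← Complex.exp_eq_one_iff, Complex.exp_sub, he, Complex.exp_log (h0 t), div_self (h0 t)]
  choose n hn using h1
  have hpi := Real.pi_pos
  have hnc : Continuous n := by
    rw [Int.isClosedEmbedding_coe_real.isInducing.continuous_iff]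
    have : (fun t => ((n t : ℤ) : ℝ)) = fun t => (L t - Complex.log (h t)).im / (2 * Real.pi) := by
      funext t
      rw [hn t]
      simp
    change Continuous (fun t => ((n t : ℤ) : ℝ))
    rw [this]
    exact (Complex.continuous_im.comp hD).div_const _
  have : n a = n b := isPreconnected_univ.constant hnc.continuousOn (mem_univ _) (mem_univ _)
  have e1 := hn a
  have e2 := hn b
  rw [this, ← e2] at e1
  linear_combination -e1

lemma trim (A : ℝ → ℝ) (hA : Continuous A) (x y a b : ℝ) (hx : A x ≤ a) (hy : b ≤ A y)
    (hab : a ≤ b) : ∃ k : ℝ → ℝ, Continuous k ∧ (∀ t, A (k t) ∈ Icc a b) ∧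
      ∃ s t, A (k s) = a ∧ A (k t) = b := by
  -- reparametrise to go from 0 to 1
  let ℓ : ℝ → ℝ := fun t => x + t * (y - x)
  have hℓ : Continuous ℓ := by fun_prop
  have hB : Continuous (A ∘ ℓ) := hA.comp hℓ
  have hB0 : (A ∘ ℓ) 0 ≤ a := by simpa [ℓ] using hx
  have hB1 : b ≤ (A ∘ ℓ) 1 := by simpa [ℓ] using hy
  generalize hBdef : A ∘ ℓ = B at hB hB0 hB1
  obtain ⟨t0, ht0, ht0'⟩ := (isCompact_Icc.inter_right
    (isClosed_le hB continuous_const) : IsCompact (Icc (0:ℝ) 1 ∩ {t | B t ≤ a})).exists_isGreatest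
      ⟨0, ⟨by simp, hB0⟩⟩
  obtain ⟨t1, ht1, ht1'⟩ := (isCompact_Icc.inter_right
    (isClosed_le continuous_const hB) : IsCompact (Icc t0 1 ∩ {t | b ≤ B t})).exists_isLeast
      ⟨1, ⟨⟨ht0.1.2, le_rfl⟩, hB1⟩⟩
  have h01 : t0 ≤ t1 := ht1.1.1
  have e0 : B t0 = a := by
    refine le_antisymm ht0.2 ?_
    by_contra hlt
    push Not at hlt
    obtain ⟨z, hz, hz2⟩ := intermediate_value_Icc ht0.1.2 hB.continuousOn
      (show a ∈ Icc (B t0) (B 1) from ⟨hlt.le, hab.trans hB1⟩)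
    have := ht0' ⟨⟨ht0.1.1.trans hz.1, hz.2⟩, hz2.le⟩
    have : z = t0 := le_antisymm this hz.1
    subst this; linarith
  have e1 : B t1 = b := by
    refine le_antisymm ?_ ht1.2
    by_contra hlt
    push Not at hlt
    obtain ⟨z, hz, hz2⟩ := intermediate_value_Icc h01 hB.continuousOn
      (show b ∈ Icc (B t0) (B t1) from ⟨e0.le.trans hab, hlt.le⟩)
    have := ht1' ⟨⟨hz.1, hz.2.trans ht1.1.2⟩, hz2.ge⟩
    have : z = t1 := le_antisymm hz.2 this
    subst this; linarith
  refine ⟨fun t => ℓ (projIcc t0 t1 h01 t), by fun_prop, ?_, t0, t1, ?_, ?_⟩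
  · intro t
    have hz := (projIcc t0 t1 h01 t).2
    change A (ℓ (projIcc t0 t1 h01 t)) ∈ Icc a b
    generalize ((projIcc t0 t1 h01 t : Icc t0 t1) : ℝ) = z at hz ⊢
    have : A (ℓ z) = B z := by rw [← hBdef]; rfl
    rw [this]
    constructor
    · by_contra hlt
      push Not at hlt
      have h3 := ht0' ⟨⟨ht0.1.1.trans hz.1, hz.2.trans ht1.1.2⟩, hlt.le⟩
      have : z = t0 := le_antisymm h3 hz.1
      subst this; linarith
    · by_contra hlt
      push Not at hlt
      have h3 := ht1' ⟨⟨hz.1, hz.2.trans ht1.1.2⟩, hlt.le⟩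
      have : z = t1 := le_antisymm hz.2 h3
      subst this; linarith
  · beta_reduce; rw [projIcc_left, ← e0, ← hBdef]; rfl
  · beta_reduce; rw [projIcc_right, ← e1, ← hBdef]; rfl

lemma log_I_mul {r : ℝ} (hr : 0 < r) : (Complex.log (Complex.I * r)).im = Real.pi / 2 := by
  rw [Complex.log_im, mul_comm, Complex.arg_real_mul _ hr, Complex.arg_I]

lemma log_neg_I_mul {r : ℝ} (hr : 0 < r) : (Complex.log (-(Complex.I * r))).im = -(Real.pi / 2) := by
  rw [Complex.log_im, mul_comm, ← mul_neg, Complex.arg_real_mul _ hr, Complex.arg_neg_I]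

lemma chord (p : ℝ → ℂ) (hp : Continuous p) (hre : ∀ t, 0 ≤ (p t).re) (a b r s c : ℝ)
    (ha : p a = -(Complex.I * r)) (hb : p b = Complex.I * s) (hc : 0 < c) (hcr : c < r + s) :
    ∃ x y, p x - p y = Complex.I * c := by
  by_contra hcon
  push Not at hcon
  obtain ⟨L, hLc, hL⟩ := exists_log (fun z => p z.1 - p z.2 - Complex.I * c) (by fun_prop)
    (fun z h => hcon z.1 z.2 (sub_eq_zero.1 h))
  have hpi := Real.pi_pos
  have hneg : ∀ z, Complex.exp (L z + Real.pi * Complex.I) = - (p z.1 - p z.2 - Complex.I * c) := by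
    intro z; rw [Complex.exp_add, Complex.exp_pi_mul_I, hL]; ring
  have E1 := log_edge (fun t => -(p a - p t - Complex.I * c)) (fun t => L (a, t) + Real.pi * Complex.I)
    (by fun_prop) (fun t => hneg (a, t)) (by intro t; simpa [ha] using hre t) a b
  have E2 := log_edge (fun t => (p t - p b - Complex.I * c)) (fun t => L (t, b))
    (by fun_prop) (fun t => hL (t, b)) (by intro t; simpa [hb] using hre t) a b
  have E3 := log_edge (fun t => -(p b - p t - Complex.I * c)) (fun t => L (b, t) + Real.pi * Complex.I)
    (by fun_prop) (fun t => hneg (b, t)) (by intro t; simpa [hb] using hre t) b a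
  have E4 := log_edge (fun t => (p t - p a - Complex.I * c)) (fun t => L (t, a))
    (by fun_prop) (fun t => hL (t, a)) (by intro t; simpa [ha] using hre t) b a
  have i1 : (Complex.log (-(p a - p a - Complex.I * c))).im = Real.pi / 2 := by
    rw [← log_I_mul hc]; congr 2; ring
  have i2 : (Complex.log (-(p a - p b - Complex.I * c))).im = Real.pi / 2 := by
    rw [← log_I_mul (show 0 < r + s + c by linarith), ha, hb]; congr 2; push_cast; ring
  have i3 : (Complex.log (p a - p b - Complex.I * c)).im = -(Real.pi / 2) := by
    rw [← log_neg_I_mul (show 0 < r + s + c by linarith), ha, hb]; congr 2; push_cast; ring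
  have i4 : (Complex.log (p b - p b - Complex.I * c)).im = -(Real.pi / 2) := by
    rw [← log_neg_I_mul hc]; congr 2; ring
  have i5 : (Complex.log (-(p b - p b - Complex.I * c))).im = Real.pi / 2 := by
    rw [← log_I_mul hc]; congr 2; ring
  have i6 : (Complex.log (-(p b - p a - Complex.I * c))).im = -(Real.pi / 2) := by
    rw [← log_neg_I_mul (show 0 < r + s - c by linarith), ha, hb]; congr 2; push_cast; ring
  have i7 : (Complex.log (p b - p a - Complex.I * c)).im = Real.pi / 2 := by
    rw [← log_I_mul (show 0 < r + s - c by linarith), ha, hb]; congr 2; push_cast; ring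
  have i8 : (Complex.log (p a - p a - Complex.I * c)).im = -(Real.pi / 2) := by
    rw [← log_neg_I_mul hc]; congr 2; ring
  have F1 := congrArg Complex.im E1
  have F2 := congrArg Complex.im E2
  have F3 := congrArg Complex.im E3
  have F4 := congrArg Complex.im E4
  simp only [Complex.sub_im, Complex.add_im, i1, i2, i3, i4, i5, i6, i7, i8] at F1 F2 F3 F4
  linarith

lemma arg_le_of {z : ℂ} (h1 : z.re < 0) (h2 : z.im < 0) : z.arg ≤ -(Real.pi / 2) := by
  by_contra h
  push Not at h
  have h3 : z.arg < 0 := Complex.arg_neg_iff.2 h2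
  have hpi := Real.pi_pos
  have : |z.arg| ≤ Real.pi / 2 := abs_le.2 ⟨h.le, by linarith⟩
  rw [Complex.abs_arg_le_pi_div_two_iff] at this
  linarith

lemma le_arg_of {z : ℂ} (h1 : z.re < 0) (h2 : 0 < z.im) : Real.pi / 2 ≤ z.arg := by
  by_contra h
  push Not at h
  have h3 : 0 ≤ z.arg := Complex.arg_nonneg_iff.2 h2.le
  have hpi := Real.pi_pos
  have : |z.arg| ≤ Real.pi / 2 := abs_le.2 ⟨by linarith, by linarith⟩
  rw [Complex.abs_arg_le_pi_div_two_iff] at this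
  linarith

lemma stage3_aux (ε r k1 k2 g1 g2 : ℝ) (hr : 0 < r) (hrε : r ≤ ε / 4)
    (h1 : -(1 / 4) ≤ k1 ∧ k1 ≤ 1 / 4) (h2 : -(1 / 4) ≤ k2 ∧ k2 ≤ 1 / 4)
    (hg1 : g1 = r * (1 + k1)) (hg2 : g2 = r * k2 + ε / 2) (h0 : 0 ≤ g2)
    (hsq : ε ^ 2 ≤ g1 ^ 2 + g2 ^ 2) : False := by
  have t1 : g1 ≤ 5 * ε / 16 := by nlinarith [h1.2]
  have t2 : 0 ≤ g1 := by nlinarith [h1.1]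
  have t3 : g2 ≤ 9 * ε / 16 := by nlinarith [h2.2]
  have q1 : g1 ^ 2 ≤ (5 * ε / 16) ^ 2 := by gcongr
  have q2 : g2 ^ 2 ≤ (9 * ε / 16) ^ 2 := by gcongr
  nlinarith

lemma stage3 (γ : ℝ → ℂ) (hγ : Continuous γ) (him : ∀ t, 0 ≤ (γ t).im) (ε M : ℝ) (hε : 0 < ε)
    (hl : ∀ t, ε ≤ ‖γ t‖) (hu : ∀ t, ‖γ t‖ ≤ M) (s0 s1 r s : ℝ) (hr : 0 < r) (hs : 0 < s)
    (h0 : γ s0 = r) (h1 : γ s1 = -s) (k : ℂ) (hk : ‖k‖ ≤ 1 / 4) (hkM : M * ‖k‖ ≤ ε / 4)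
    (c : ℝ) (hc : 0 < c) (hcε : c < ε / 2) : ∃ x y, γ x - γ y = c * (1 + k) := by
  have k1 := abs_le.1 ((Complex.abs_re_le_norm k).trans hk)
  have k2 := abs_le.1 ((Complex.abs_im_le_norm k).trans hk)
  have hN : 0 < (1 + k.re) ^ 2 + k.im ^ 2 := by nlinarith [k1.1, sq_nonneg k.im]
  have hk0 : Complex.I * (1 + k) ≠ 0 := by
    intro h
    have h2 := congrArg Complex.im h
    simp at h2
    linarith [k1.1]
  set u : ℝ → ℂ := fun t => (γ t - Complex.I * (ε / 2 : ℝ)) / (Complex.I * (1 + k)) with hudef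
  have huc : Continuous u := by fun_prop
  have hmul : ∀ t, γ t = u t * (Complex.I * (1 + k)) + Complex.I * (ε / 2 : ℝ) := by
    intro t; rw [hudef]; beta_reduce; rw [div_mul_cancel₀ _ hk0]; ring
  have g1 : ∀ t, (γ t).re = -(u t).re * k.im - (u t).im * (1 + k.re) := by
    intro t; rw [hmul t]; simp; try ring
  have g2 : ∀ t, (γ t).im = (u t).re * (1 + k.re) - (u t).im * k.im + ε / 2 := by
    intro t; rw [hmul t]; simp; try ring
  have hx : ∀ t, (u t).re * ((1 + k.re) ^ 2 + k.im ^ 2) =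
      -k.im * (γ t).re + (1 + k.re) * ((γ t).im - ε / 2) := by
    intro t; rw [g1, g2]; ring
  have hy : ∀ t, (u t).im * ((1 + k.re) ^ 2 + k.im ^ 2) =
      -(1 + k.re) * (γ t).re - k.im * ((γ t).im - ε / 2) := by
    intro t; rw [g1, g2]; ring
  have hsq : ∀ t, ε ^ 2 ≤ (γ t).re ^ 2 + (γ t).im ^ 2 := by
    intro t
    have := hl t
    have e : ‖γ t‖ ^ 2 = (γ t).re ^ 2 + (γ t).im ^ 2 := by
      rw [Complex.sq_norm, Complex.normSq_apply]; ring
    rw [← e]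
    gcongr
  have hslit : ∀ t, u t ∈ Complex.slitPlane := by
    intro t
    rw [Complex.mem_slitPlane_iff]
    by_contra hcon
    push Not at hcon
    obtain ⟨c1, c2⟩ := hcon
    have e1 := g1 t
    have e2 := g2 t
    rw [c2] at e1 e2
    have e3 := him t
    have e4 := hsq t
    have t1 : -(u t).re ≤ 2 * ε / 3 := by nlinarith
    have t2 : (γ t).im ≤ ε / 2 := by nlinarith
    have t3 : (γ t).re ≤ ε / 6 := by nlinarith
    have t4 : -(ε / 6) ≤ (γ t).re := by nlinarith
    nlinarith
  have hMk : |k.im| * M ≤ ε / 4 := by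
    have hM : 0 ≤ M := (norm_nonneg _).trans (hu 0)
    nlinarith [Complex.abs_im_le_norm k]
  have hrl : ε ≤ r := by simpa [h0, abs_of_pos hr] using hl s0
  have hru : r ≤ M := by simpa [h0, abs_of_pos hr] using hu s0
  have hsl : ε ≤ s := by simpa [h1, abs_of_pos hs] using hl s1
  have hsu : s ≤ M := by simpa [h1, abs_of_pos hs] using hu s1
  have a0 : (u s0).arg ≤ -(Real.pi / 2) := by
    have X := hx s0
    have Y := hy s0
    rw [h0] at X Y
    simp at X Y
    have b : -k.im * r ≤ ε / 4 := by
      calc -k.im * r ≤ |k.im| * M := by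
            gcongr
            exact neg_le_abs _
        _ ≤ _ := hMk
    apply arg_le_of
    · by_contra hcon
      push Not at hcon
      have := mul_nonneg hcon hN.le
      nlinarith
    · by_contra hcon
      push Not at hcon
      have := mul_nonneg hcon hN.le
      nlinarith
  have a1 : Real.pi / 2 ≤ (u s1).arg := by
    have X := hx s1
    have Y := hy s1
    rw [h1] at X Y
    simp at X Y
    have b : k.im * s ≤ ε / 4 := by
      calc k.im * s ≤ |k.im| * M := by
            gcongr
            exact le_abs_self _
        _ ≤ _ := hMk
    apply le_arg_of
    · by_contra hcon
      push Not at hcon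
      have := mul_nonneg hcon hN.le
      nlinarith
    · by_contra hcon
      push Not at hcon
      have := mul_nonneg (neg_nonneg.2 hcon) hN.le
      nlinarith
  have hpi := Real.pi_pos
  obtain ⟨κ, hκ, hκI, a, b, ha, hb⟩ := trim (fun t => (u t).arg)
    (continuous_iff_continuousAt.2 fun t =>
      (Complex.continuousAt_arg (hslit t)).comp huc.continuousAt)
    s0 s1 (-(Real.pi / 2)) (Real.pi / 2) a0 a1 (by linarith)
  have ha' : (u (κ a)).re = 0 ∧ (u (κ a)).im < 0 := by
    rw [← Complex.arg_eq_neg_pi_div_two_iff]; rw [ha]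
  have hb' : (u (κ b)).re = 0 ∧ 0 < (u (κ b)).im := by
    rw [← Complex.arg_eq_pi_div_two_iff]; exact hb
  have la : ε / 4 < -(u (κ a)).im := by
    by_contra hcon
    push Not at hcon
    have e1 := g1 (κ a)
    have e2 := g2 (κ a)
    rw [ha'.1] at e1 e2
    exact stage3_aux ε (-(u (κ a)).im) k.re k.im _ _ (neg_pos.2 ha'.2) hcon k1 k2
      (by rw [e1]; ring) (by rw [e2]; ring) (him (κ a)) (hsq (κ a))
  have lb : ε / 4 < (u (κ b)).im := by
    by_contra hcon
    push Not at hcon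
    have e1 := g1 (κ b)
    have e2 := g2 (κ b)
    rw [hb'.1] at e1 e2
    exact stage3_aux ε (u (κ b)).im k.re (-k.im) (-(γ (κ b)).re) _ hb'.2 hcon k1
      ⟨by linarith [k2.2], by linarith [k2.1]⟩
      (by rw [e1]; ring) (by rw [e2]; ring) (him (κ b)) (by rw [neg_sq]; exact hsq (κ b))
  obtain ⟨x, y, hxy⟩ := chord (fun t => u (κ t)) (huc.comp hκ)
    (fun t => by rw [← Complex.abs_arg_le_pi_div_two_iff, abs_le]; exact hκI t)
    a b (-(u (κ a)).im) (u (κ b)).im c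
    (Complex.ext (by simp [ha'.1]) (by simp)) (Complex.ext (by simp [hb'.1]) (by simp)) hc
    (by linarith)
  refine ⟨κ y, κ x, ?_⟩
  rw [hmul (κ y), hmul (κ x)]
  have hI := Complex.I_sq
  linear_combination (-(Complex.I * (1 + k))) * hxy - (c : ℂ) * (1 + k) * hI

/-- clamp to the unit square -/
def cl (x : ℝ × ℝ) : ℝ × ℝ :=
  (projIcc (0 : ℝ) 1 zero_le_one x.1, projIcc (0 : ℝ) 1 zero_le_one x.2)

lemma cl_cont : Continuous cl := by unfold cl; fun_prop

lemma cl_mem (x : ℝ × ℝ) : cl x ∈ Icc (0 : ℝ) 1 ×ˢ Icc (0 : ℝ) 1 :=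
  ⟨(projIcc (0 : ℝ) 1 zero_le_one x.1).2, (projIcc (0 : ℝ) 1 zero_le_one x.2).2⟩

lemma cl_eq {x : ℝ × ℝ} (hx : x ∈ Icc (0 : ℝ) 1 ×ˢ Icc (0 : ℝ) 1) : cl x = x := by
  unfold cl
  rw [projIcc_of_mem _ hx.1, projIcc_of_mem _ hx.2]

lemma round_approx (z : ℂ) : ∃ p q : ℤ, ‖((p : ℂ) + q * Complex.I) - z‖ ≤ 1 := by
  refine ⟨round z.re, round z.im, ?_⟩
  refine (Complex.norm_le_abs_re_add_abs_im _).trans ?_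
  have h1 := abs_sub_round z.re
  have h2 := abs_sub_round z.im
  rw [abs_sub_comm] at h1 h2
  simp
  linarith

lemma planar (ε M : ℝ) (hε : 0 < ε) (hM : 0 < M) : ∃ B : ℝ, 0 < B ∧ ∀ g : ℝ × ℝ → ℂ, Continuous g →
    (∀ x, g (cl x) = g x) → (∀ x, ε ≤ ‖g x‖) → (∀ x, ‖g x‖ ≤ M) →
    (0 : ℂ) ∈ convexHull ℝ (range g) →
    ∃ p q : ℤ, ¬ (p = 0 ∧ q = 0) ∧ ∀ τ : ℝ, 0 < τ → τ * B < ε / 2 →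
      ∃ x y, g x - g y = τ * ((p : ℂ) + q * Complex.I) := by
  have hB : 0 < 4 * M / ε + 4 := by positivity
  refine ⟨4 * M / ε + 4, hB, ?_⟩
  intro g hg hcl hl hu hconv
  generalize hBd : 4 * M / ε + 4 = B at *
  have hB4 : 4 ≤ B := by
    have : 0 < 4 * M / ε := by positivity
    linarith
  have hBM : M / B ≤ ε / 4 := by
    rw [div_le_iff₀ hB, ← hBd]
    field_simp
    nlinarith
  have hpi := Real.pi_pos
  have hne : ∀ x, g x ≠ 0 := fun x h => by have := hl x; rw [h, norm_zero] at this; linarith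
  obtain ⟨L', hL'c, hL'⟩ := exists_log g hg hne
  set L : ℝ × ℝ → ℂ := fun x => L' (cl x) with hLdef
  have hLc : Continuous L := hL'c.comp cl_cont
  have hL : ∀ x, Complex.exp (L x) = g x := fun x => by rw [hLdef]; beta_reduce; rw [hL', hcl]
  have hK : IsCompact (Icc (0 : ℝ) 1 ×ˢ Icc (0 : ℝ) 1) := isCompact_Icc.prod isCompact_Icc
  have hKne : (Icc (0 : ℝ) 1 ×ˢ Icc (0 : ℝ) 1).Nonempty := ⟨cl 0, cl_mem 0⟩
  obtain ⟨x0, hx0m, hx0⟩ := hK.exists_isMinOn hKne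
    (Complex.continuous_im.comp hL'c).continuousOn
  obtain ⟨x1, hx1m, hx1⟩ := hK.exists_isMaxOn hKne
    (Complex.continuous_im.comp hL'c).continuousOn
  have hmin : ∀ x, (L x0).im ≤ (L x).im := fun x => by
    have := hx0 (cl_mem x)
    simpa [hLdef, cl_eq hx0m] using this
  have hmax : ∀ x, (L x).im ≤ (L x1).im := fun x => by
    have := hx1 (cl_mem x)
    simpa [hLdef, cl_eq hx1m] using this
  have hrot : ∀ x (a : ℝ), g x / Complex.exp (a * Complex.I) = Complex.exp (L x - a * Complex.I) := by
    intro x a; rw [Complex.exp_sub, hL]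
  have hosc : (L x0).im + Real.pi ≤ (L x1).im := by
    by_contra hlt
    push Not at hlt
    set m : ℝ := ((L x0).im + (L x1).im) / 2 with hm
    have hcv : Convex ℝ {z : ℂ | 0 < (z / Complex.exp (m * Complex.I)).re} := by
      apply convex_halfSpace_gt
      constructor
      · intro x y; rw [add_div, Complex.add_re]
      · intro c x; rw [Complex.real_smul, mul_div_assoc, Complex.re_ofReal_mul, smul_eq_mul]
    have hsub : range g ⊆ {z : ℂ | 0 < (z / Complex.exp (m * Complex.I)).re} := by
      rintro _ ⟨x, rfl⟩
      simp only [mem_ofPred_eq]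
      rw [hrot, Complex.exp_re]
      apply mul_pos (Real.exp_pos _)
      have := hmin x
      have := hmax x
      apply Real.cos_pos_of_mem_Ioo
      constructor <;> simp <;> linarith
    have := convexHull_min hsub hcv hconv
    simp at this
  obtain ⟨κ, hκ, hκI, s0, s1, hs0, hs1⟩ := trim (fun t => (L (x0 + t • (x1 - x0))).im)
    (by fun_prop) 0 1 (L x0).im ((L x0).im + Real.pi) (by simp) (by simpa using hosc) (by linarith)
  set a : ℝ := (L x0).im with ha
  set e : ℂ := Complex.exp (a * Complex.I) with he
  have hen : ‖e‖ = 1 := Complex.norm_exp_ofReal_mul_I a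
  have he0 : e ≠ 0 := Complex.exp_ne_zero _
  set σ : ℝ → ℝ × ℝ := fun t => x0 + (κ t) • (x1 - x0) with hσ
  have hσc : Continuous σ := by fun_prop
  have hσI : ∀ t, (L (σ t)).im ∈ Icc a (a + Real.pi) := hκI
  have hσ0 : (L (σ s0)).im = a := hs0
  have hσ1 : (L (σ s1)).im = a + Real.pi := hs1
  obtain ⟨p, q, hpq⟩ := round_approx (B * e)
  set k : ℂ := (((p : ℂ) + q * Complex.I) - B * e) / (B * e) with hk
  have hBC : (B : ℂ) ≠ 0 := by exact_mod_cast hB.ne'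
  have hkn : ‖k‖ ≤ 1 / B := by
    rw [hk, norm_div, norm_mul, hen, mul_one, Complex.norm_real, Real.norm_of_nonneg hB.le]
    gcongr
  have hk1 : (B * e) * (1 + k) = (p : ℂ) + q * Complex.I := by
    rw [hk]; field_simp; ring
  have hk4 : ‖k‖ ≤ 1 / 4 := hkn.trans (one_div_le_one_div_of_le (by norm_num) hB4)
  refine ⟨p, q, ?_, ?_⟩
  · rintro ⟨rfl, rfl⟩
    simp [hBC, he0] at hk1
    have : k = -1 := by linear_combination hk1
    rw [this] at hk4
    norm_num at hk4
  intro τ hτ hτB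
  obtain ⟨x, y, hxy⟩ := stage3 (fun t => g (σ t) / e) (by fun_prop)
    (fun t => by
      beta_reduce
      rw [hrot, Complex.exp_im]
      have := hσI t
      apply mul_nonneg (Real.exp_pos _).le
      apply Real.sin_nonneg_of_nonneg_of_le_pi
      · simp; linarith [this.1]
      · simp; linarith [this.2])
    ε M hε (fun t => by rw [norm_div, hen, div_one]; exact hl _)
    (fun t => by rw [norm_div, hen, div_one]; exact hu _) s0 s1
    (Real.exp (L (σ s0)).re) (Real.exp (L (σ s1)).re) (Real.exp_pos _) (Real.exp_pos _)
    (by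
      beta_reduce
      rw [hrot]
      apply Complex.ext
      · rw [Complex.exp_re]; simp [hσ0, Complex.exp_ofReal_re]
      · rw [Complex.exp_im]; simp [hσ0])
    (by
      beta_reduce
      rw [hrot]
      apply Complex.ext
      · rw [Complex.exp_re]; simp [hσ1, Complex.exp_ofReal_re]
      · rw [Complex.exp_im]; simp [hσ1])
    k hk4 (by
      calc M * ‖k‖ ≤ M * (1 / B) := by gcongr
        _ = M / B := by ring
        _ ≤ _ := hBM) (τ * B) (by positivity) hτB
  refine ⟨σ x, σ y, ?_⟩
  rw [← hk1]
  field_simp at hxy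
  push_cast at hxy
  linear_combination hxy

/-- the finite-time rotation set -/
def KK (F : ℝ × ℝ → ℝ × ℝ) (n : ℕ) : Set (ℝ × ℝ) :=
  {y : ℝ × ℝ | ∃ x : ℝ × ℝ, y = ((n : ℝ))⁻¹ • (F^[n] x - x)}

lemma iter_shift {F : ℝ × ℝ → ℝ × ℝ}
    (hF : ∀ (x : ℝ × ℝ) (v : ℤ × ℤ), F (x + ((v.1 : ℝ), (v.2 : ℝ))) = F x + ((v.1 : ℝ), (v.2 : ℝ)))
    (n : ℕ) (x : ℝ × ℝ) (v : ℤ × ℤ) :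
    F^[n] (x + ((v.1 : ℝ), (v.2 : ℝ))) = F^[n] x + ((v.1 : ℝ), (v.2 : ℝ)) := by
  induction n with
  | zero => rfl
  | succ n ih => rw [iterate_succ_apply', ih, hF, iterate_succ_apply']

lemma exists_frac (x : ℝ × ℝ) : ∃ (x' : ℝ × ℝ) (v : ℤ × ℤ), x' ∈ Icc (0 : ℝ) 1 ×ˢ Icc (0 : ℝ) 1 ∧
    x = x' + ((v.1 : ℝ), (v.2 : ℝ)) := by
  refine ⟨(Int.fract x.1, Int.fract x.2), (⌊x.1⌋, ⌊x.2⌋), ⟨⟨Int.fract_nonneg _, (Int.fract_lt_one _).le⟩,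
    ⟨Int.fract_nonneg _, (Int.fract_lt_one _).le⟩⟩, ?_⟩
  ext <;> simp [Int.fract_add_floor]

lemma exists_bound {F : ℝ × ℝ → ℝ × ℝ} (hc : Continuous F)
    (hF : ∀ (x : ℝ × ℝ) (v : ℤ × ℤ), F (x + ((v.1 : ℝ), (v.2 : ℝ))) = F x + ((v.1 : ℝ), (v.2 : ℝ))) :
    ∃ M : ℝ, 0 < M ∧ ∀ n x, ‖F^[n] x - x‖ ≤ n * M := by
  have hK : IsCompact (Icc (0 : ℝ) 1 ×ˢ Icc (0 : ℝ) 1) := isCompact_Icc.prod isCompact_Icc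
  obtain ⟨C, hC⟩ := hK.exists_bound_of_continuousOn (f := fun x => F x - x) (by fun_prop)
  have h1 : ∀ x, ‖F x - x‖ ≤ |C| + 1 := by
    intro x
    obtain ⟨x', v, hx', rfl⟩ := exists_frac x
    rw [hF, add_sub_add_right_eq_sub]
    linarith [hC x' hx', le_abs_self C]
  refine ⟨|C| + 1, by positivity, ?_⟩
  intro n
  induction n with
  | zero => intro x; simp
  | succ n ih =>
    intro x
    rw [iterate_succ_apply']
    calc ‖F (F^[n] x) - x‖ = ‖(F (F^[n] x) - F^[n] x) + (F^[n] x - x)‖ := by congr 1; abel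
      _ ≤ (|C| + 1) + n * (|C| + 1) := (norm_add_le _ _).trans (add_le_add (h1 _) (ih x))
      _ = _ := by push_cast; ring

lemma iter_mem_hull (F : ℝ × ℝ → ℝ × ℝ) (n : ℕ) (hn : 1 ≤ n) (q : ℕ) (x : ℝ × ℝ) :
    (((q + 1 : ℕ) * n : ℝ))⁻¹ • (F^[(q + 1) * n] x - x) ∈ convexHull ℝ (KK F n) := by
  have hn0 : (n : ℝ) ≠ 0 := by positivity
  induction q generalizing x with
  | zero =>
    apply subset_convexHull
    exact ⟨x, by simp⟩
  | succ q ih =>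
    have h1 := ih x
    have h2 : (n : ℝ)⁻¹ • (F^[n] (F^[(q + 1) * n] x) - F^[(q + 1) * n] x) ∈ convexHull ℝ (KK F n) :=
      subset_convexHull _ _ ⟨_, rfl⟩
    have := (convex_convexHull ℝ (KK F n)) h1 h2 (a := (q + 1 : ℝ) / (q + 2)) (b := 1 / (q + 2 : ℝ))
      (by positivity) (by positivity) (by field_simp; ring)
    convert this using 1
    have e : F^[(q + 1 + 1) * n] x = F^[n] (F^[(q + 1) * n] x) := by
      rw [← iterate_add_apply]; congr 1; congr 1; ring
    rw [e]
    ext <;> simp <;> field_simp <;> ring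

lemma rot_sub_hull {F : ℝ × ℝ → ℝ × ℝ} {M : ℝ} (hM : 0 < M) (hb : ∀ n x, ‖F^[n] x - x‖ ≤ n * M)
    (n : ℕ) (hn : 1 ≤ n) : rotSet F ⊆ closure (convexHull ℝ (KK F n)) := by
  intro a ha
  rw [Metric.mem_closure_iff]
  intro ε hε
  obtain ⟨N, hN⟩ := exists_nat_gt (4 * n * M / ε)
  have hm : 1 ≤ max N n := hn.trans (le_max_right _ _)
  have ha' := mem_iInter₂.1 ha (max N n) hm
  obtain ⟨y, hy, hay⟩ := Metric.mem_closure_iff.1 ha' (ε / 2) (by positivity)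
  simp only [mem_iUnion] at hy
  obtain ⟨j, hj, x, rfl⟩ := hy
  have hjN : N ≤ j := (le_max_left _ _).trans hj
  have hjn : n ≤ j := (le_max_right _ _).trans hj
  obtain ⟨q, hq⟩ : ∃ q, j / n = q + 1 := Nat.exists_eq_add_one.2 (Nat.div_pos hjn hn)
  have hdm := Nat.div_add_mod j n
  rw [hq] at hdm
  have hrn : j % n < n := Nat.mod_lt _ hn
  generalize j % n = r at hdm hrn
  refine ⟨_, iter_mem_hull F n hn q x, ?_⟩
  set m := (q + 1) * n with hmdef
  have hmj : j = r + m := by rw [← hdm, hmdef]; ring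
  have hjpos : (0 : ℝ) < j := by exact_mod_cast (hn.trans hjn)
  have hmpos : (0 : ℝ) < m := by
    have : 0 < m := by positivity
    exact_mod_cast this
  have hmcast : ((q + 1 : ℕ) * n : ℝ) = (m : ℝ) := by rw [hmdef]; push_cast; ring
  rw [hmcast]
  have hjcast : (j : ℝ) = r + m := by rw [hmj]; push_cast; ring
  have hd : dist ((j : ℝ)⁻¹ • (F^[j] x - x)) ((m : ℝ)⁻¹ • (F^[m] x - x)) ≤ 2 * n * M / j := by
    have e1 : F^[j] x = F^[r] (F^[m] x) := by rw [hmj, iterate_add_apply]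
    have e2 : (j : ℝ)⁻¹ • (F^[j] x - x) - (m : ℝ)⁻¹ • (F^[m] x - x) =
        (j : ℝ)⁻¹ • ((F^[r] (F^[m] x) - F^[m] x) - (r / m : ℝ) • (F^[m] x - x)) := by
      rw [e1]
      have : (m : ℝ)⁻¹ = (j : ℝ)⁻¹ * (1 + r / m) := by
        rw [hjcast] at hjpos ⊢
        field_simp
        ring
      rw [this, mul_smul, add_smul, one_smul, ← smul_sub]
      congr 1
      abel
    rw [dist_eq_norm, e2, norm_smul, norm_inv, Real.norm_of_nonneg hjpos.le, inv_mul_eq_div]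
    gcongr
    have b1 := hb r (F^[m] x)
    have b2 := hb m x
    have hrn' : (r : ℝ) ≤ n := by exact_mod_cast hrn.le
    calc _ ≤ ‖F^[r] (F^[m] x) - F^[m] x‖ + ‖(r / m : ℝ) • (F^[m] x - x)‖ := norm_sub_le _ _
      _ ≤ r * M + (r / m : ℝ) * (m * M) := by
        rw [norm_smul, Real.norm_of_nonneg (by positivity)]
        gcongr
      _ = 2 * r * M := by field_simp; ring
      _ ≤ 2 * n * M := by gcongr
  have h2 : 2 * n * M / j < ε / 2 := by
    have : (N : ℝ) ≤ j := by exact_mod_cast hjN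
    rw [div_lt_iff₀ hε] at hN
    rw [div_lt_iff₀ hjpos]
    nlinarith
  calc _ ≤ _ := dist_triangle _ _ _
    _ < ε / 2 + ε / 2 := add_lt_add_of_lt_of_le hay (hd.trans h2.le)
    _ = ε := by ring

lemma norm_toC_ge (z : ℝ × ℝ) : ‖z‖ ≤ ‖Complex.equivRealProdCLM.symm z‖ := by
  rw [Prod.norm_def]
  apply max_le
  · simpa using Complex.abs_re_le_norm (Complex.equivRealProdCLM.symm z)
  · simpa using Complex.abs_im_le_norm (Complex.equivRealProdCLM.symm z)

lemma norm_toC_le (z : ℝ × ℝ) : ‖Complex.equivRealProdCLM.symm z‖ ≤ 2 * ‖z‖ := by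
  have h := Complex.norm_le_abs_re_add_abs_im (Complex.equivRealProdCLM.symm z)
  have h1 := norm_fst_le z
  have h2 := norm_snd_le z
  simp at h h1 h2
  simp
  linarith

lemma norm_square {x : ℝ × ℝ} (hx : x ∈ Icc (0 : ℝ) 1 ×ˢ Icc (0 : ℝ) 1) : ‖x‖ ≤ 1 := by
  rw [Prod.norm_def]
  apply max_le
  · rw [Real.norm_of_nonneg hx.1.1]; exact hx.1.2
  · rw [Real.norm_of_nonneg hx.2.1]; exact hx.2.2

open scoped Pointwise in
lemma hull_sub_rot {F : ℝ × ℝ → ℝ × ℝ} (hc : Continuous F) (hinj : Injective F)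
    (hF : ∀ (x : ℝ × ℝ) (v : ℤ × ℤ), F (x + ((v.1 : ℝ), (v.2 : ℝ))) = F x + ((v.1 : ℝ), (v.2 : ℝ)))
    {M : ℝ} (hM : 0 < M) (hb : ∀ n x, ‖F^[n] x - x‖ ≤ n * M) (c : ℝ × ℝ)
    (h : ∀ n, 1 ≤ n → c ∈ closure (convexHull ℝ (KK F n))) : c ∈ rotSet F := by
  by_contra hcon
  unfold rotSet at hcon
  simp only [mem_iInter, not_forall] at hcon
  obtain ⟨m, hm, hcm⟩ := hcon
  rw [Metric.mem_closure_iff] at hcm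
  push Not at hcm
  obtain ⟨ε, hε, hcε⟩ := hcm
  have hfar : ∀ n, m ≤ n → ∀ x, ε ≤ dist c ((n : ℝ)⁻¹ • (F^[n] x - x)) := by
    intro n hn x
    apply hcε
    simp only [mem_iUnion]
    exact ⟨n, hn, x, rfl⟩
  obtain ⟨B, hB, hpl⟩ := planar (ε / 2) (4 * M + 4) (by positivity) (by positivity)
  obtain ⟨N, hN⟩ := exists_nat_gt (6 / ε + 8 * B / ε)
  set n := max N m with hndef
  have hn1 : 1 ≤ n := (show 1 ≤ m from hm).trans (le_max_right _ _)
  have hn1' : (1 : ℝ) ≤ n := by exact_mod_cast hn1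
  have hn0 : (0 : ℝ) < n := by linarith
  have hNn : (N : ℝ) ≤ n := by exact_mod_cast le_max_left _ _
  have hn6 : 3 / n ≤ ε / 2 := by
    have : 0 < 8 * B / ε := by positivity
    have h6 : 6 / ε < n := by linarith
    rw [div_lt_iff₀ hε] at h6
    rw [div_le_iff₀ hn0]; linarith
  have hnB : 2 / n * B < ε / 2 / 2 := by
    have : 0 < 6 / ε := by positivity
    have h6 : 8 * B / ε < n := by linarith
    rw [div_lt_iff₀ hε] at h6
    rw [div_mul_eq_mul_div, div_lt_iff₀ hn0]; linarith
  have hinv : (n : ℝ)⁻¹ ≤ 1 := inv_le_one_of_one_le₀ hn1'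
  -- the approximating point
  obtain ⟨y, hy, hcy⟩ := Metric.mem_closure_iff.1 (h n hn1) (n : ℝ)⁻¹ (by positivity)
  set E : Set (ℝ × ℝ) := range fun x => (n : ℝ)⁻¹ • F^[n] (cl x) with hE
  have hsub : KK F n ⊆ E + Metric.closedBall (0 : ℝ × ℝ) (n : ℝ)⁻¹ := by
    rintro _ ⟨x, rfl⟩
    obtain ⟨x', v, hx', rfl⟩ := exists_frac x
    refine ⟨(n : ℝ)⁻¹ • F^[n] x', ⟨x', by simp [cl_eq hx']⟩, -((n : ℝ)⁻¹ • x'), ?_, ?_⟩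
    · rw [mem_closedBall_zero_iff, norm_neg, norm_smul, norm_inv, Real.norm_of_nonneg hn0.le]
      exact mul_le_of_le_one_right (by positivity) (norm_square hx')
    · beta_reduce
      rw [iter_shift hF, add_sub_add_right_eq_sub, smul_sub, sub_eq_add_neg]
  have hy2 := convexHull_mono hsub hy
  rw [convexHull_add, (convex_closedBall _ _).convexHull_eq] at hy2
  obtain ⟨y', hy', w, hw, hyw⟩ := hy2
  have hcy' : dist c y' ≤ 2 / n := by
    have : dist y y' ≤ (n : ℝ)⁻¹ := by
      rw [← hyw, dist_eq_norm]
      simpa using hw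
    calc dist c y' ≤ dist c y + dist y y' := dist_triangle _ _ _
      _ ≤ (n : ℝ)⁻¹ + (n : ℝ)⁻¹ := add_le_add hcy.le this
      _ = 2 / n := by ring
  have hEb : ∀ x, ‖(n : ℝ)⁻¹ • F^[n] (cl x)‖ ≤ M + 1 := by
    intro x
    rw [norm_smul, norm_inv, Real.norm_of_nonneg hn0.le, inv_mul_le_iff₀ hn0]
    have h1 := hb n (cl x)
    have h2 := norm_square (cl_mem x)
    have h3 : ‖F^[n] (cl x)‖ ≤ ‖F^[n] (cl x) - cl x‖ + ‖cl x‖ := by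
      simpa using norm_add_le (F^[n] (cl x) - cl x) (cl x)
    nlinarith
  have hy'b : ‖y'‖ ≤ M + 1 := by
    have : convexHull ℝ E ⊆ Metric.closedBall 0 (M + 1) := by
      apply convexHull_min _ (convex_closedBall _ _)
      rintro _ ⟨x, rfl⟩
      simpa using hEb x
    simpa using this hy'
  let T : ℝ × ℝ → ℂ := fun z => Complex.equivRealProdCLM.symm (z - y')
  have hcl2 : ∀ x, cl (cl x) = cl x := fun x => cl_eq (cl_mem x)
  obtain ⟨p, q, hpq, hτ⟩ := hpl (fun x => T ((n : ℝ)⁻¹ • F^[n] (cl x)))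
    (by
      have h1 := cl_cont
      have h2 : Continuous F^[n] := hc.iterate n
      have h3 : Continuous fun x => F^[n] (cl x) := h2.comp h1
      fun_prop)
    (fun x => by simp only [hcl2])
    (fun x => by
      refine le_trans ?_ (norm_toC_ge _)
      have h1 := hfar n (le_max_right _ _) (cl x)
      have h2 : dist c ((n : ℝ)⁻¹ • (F^[n] (cl x) - cl x)) ≤ dist c y' +
          (‖(n : ℝ)⁻¹ • F^[n] (cl x) - y'‖ + (n : ℝ)⁻¹) := by
        refine (dist_triangle _ y' _).trans ?_
        gcongr
        rw [dist_comm, dist_eq_norm]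
        have e : (n : ℝ)⁻¹ • (F^[n] (cl x) - cl x) - y' =
          ((n : ℝ)⁻¹ • F^[n] (cl x) - y') - (n : ℝ)⁻¹ • cl x := by
          rw [smul_sub]; abel
        rw [e]
        refine (norm_sub_le _ _).trans ?_
        gcongr
        rw [norm_smul, norm_inv, Real.norm_of_nonneg hn0.le]
        exact mul_le_of_le_one_right (by positivity) (norm_square (cl_mem x))
      have e3 : (3 : ℝ) / n = 2 / n + (n : ℝ)⁻¹ := by ring
      linarith)
    (fun x => by
      refine (norm_toC_le _).trans ?_
      have := norm_sub_le ((n : ℝ)⁻¹ • F^[n] (cl x)) y'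
      linarith [hEb x])
    (by
      let A : ℝ × ℝ →ᵃ[ℝ] ℂ :=
        (Complex.equivRealProdCLM.symm : (ℝ × ℝ) →ₗ[ℝ] ℂ).toAffineMap.comp
          (AffineMap.id ℝ (ℝ × ℝ) - AffineMap.const ℝ (ℝ × ℝ) y')
      have hA : ∀ z, A z = T z := fun z => rfl
      have h1 : A y' ∈ A '' (convexHull ℝ E) := ⟨y', hy', rfl⟩
      rw [AffineMap.image_convexHull, hE, ← range_comp] at h1
      have h2 : A y' = 0 := by rw [hA]; simp [T]
      rw [h2] at h1
      exact h1)
  obtain ⟨x, x', hxx⟩ := hτ (2 / n) (by positivity) hnB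
  apply hpq
  have hre := congrArg Complex.re hxx
  have him := congrArg Complex.im hxx
  have hnC : (2 / n : ℂ) = ((2 / n : ℝ) : ℂ) := by push_cast; ring
  simp only [T, Complex.sub_re, Complex.sub_im, Complex.re_ofReal_mul, Complex.im_ofReal_mul] at hre him
  simp at hre him
  have hshift : F^[n] (cl x) = F^[n] (cl x' + ((((2 * p, 2 * q) : ℤ × ℤ).1 : ℝ), (((2 * p, 2 * q) : ℤ × ℤ).2 : ℝ))) := by
    rw [iter_shift hF]
    field_simp at hre him
    ext
    · simp; linarith
    · simp; linarith
  have heq := (hinj.iterate n) hshift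
  have hx1 := cl_mem x
  have hx2 := cl_mem x'
  rw [heq] at hx1
  obtain ⟨⟨a1, a2⟩, a3, a4⟩ := hx1
  obtain ⟨⟨b1, b2⟩, b3, b4⟩ := hx2
  simp at a1 a2 a3 a4
  constructor
  · have h1 : (p : ℝ) < 1 := by linarith
    have h2 : (-1 : ℝ) < p := by linarith
    have h1' : p < 1 := by exact_mod_cast h1
    have h2' : -1 < p := by exact_mod_cast h2
    omega
  · have h1 : (q : ℝ) < 1 := by linarith
    have h2 : (-1 : ℝ) < q := by linarith
    have h1' : q < 1 := by exact_mod_cast h1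
    have h2' : -1 < q := by exact_mod_cast h2
    omega

/-- **Misiurewicz–Ziemian.**  The rotation set of a lift of a torus homeomorphism homotopic
to the identity is a nonempty compact convex subset of ℝ². -/
theorem rotation_set_compact_convex
    (f : T2 ≃ₜ T2) (F : (ℝ × ℝ) ≃ₜ (ℝ × ℝ)) (hF : IsLift ⇑f ⇑F) :
    (rotSet ⇑F).Nonempty ∧ IsCompact (rotSet ⇑F) ∧ Convex ℝ (rotSet ⇑F) := by
  have hsh := hF.2
  obtain ⟨M, hM, hb⟩ := exists_bound F.continuous hsh
  have hKb : ∀ (n : ℕ) x, ((n : ℝ))⁻¹ • (F^[n] x - x) ∈ Metric.closedBall (0 : ℝ × ℝ) M := by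
    intro n x
    rw [mem_closedBall_zero_iff, norm_smul, norm_inv, Real.norm_of_nonneg (Nat.cast_nonneg n)]
    rcases Nat.eq_zero_or_pos n with rfl | hn
    · simpa using hM.le
    · have : (0 : ℝ) < n := by exact_mod_cast hn
      rw [inv_mul_le_iff₀ this]
      exact hb n x
  refine ⟨?_, ?_, ?_⟩
  · obtain ⟨a, -, φ, hφ, ha⟩ := (isCompact_closedBall (0 : ℝ × ℝ) M).tendsto_subseq
      (fun n => hKb n 0)
    refine ⟨a, mem_iInter₂.2 fun m _ => mem_closure_of_tendsto ha ?_⟩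
    filter_upwards [eventually_ge_atTop m] with k hk
    simp only [mem_iUnion]
    exact ⟨φ k, hk.trans (hφ.id_le k), 0, rfl⟩
  · apply (isCompact_closedBall (0 : ℝ × ℝ) M).of_isClosed_subset
    · exact isClosed_biInter fun _ _ => isClosed_closure
    · intro a ha
      have := mem_iInter₂.1 ha 1 (mem_Ici.2 le_rfl)
      refine closure_minimal ?_ Metric.isClosed_closedBall this
      intro y hy
      simp only [mem_iUnion] at hy
      obtain ⟨n, _, x, rfl⟩ := hy
      exact hKb n x
  · intro a ha b hb' s t hs ht hst
    apply hull_sub_rot F.continuous F.injective hsh hM hb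
    intro n hn
    exact (convex_convexHull ℝ _).closure (rot_sub_hull hM hb n hn ha)
      (rot_sub_hull hM hb n hn hb') hs ht hst
end
end

section
/- Let f : 𝕋² → 𝕋² be a nonwandering (conservative) homeomorphism homotopic to the identity which is a pseudo-rotation with rotation vector ρ ∈ ℝ² and has the bounded mean motion property. Then ρ is rational (i.e. ρ ∈ ℚ²) if and only if f has a periodic point. -/
open Filter Topology Set Function

noncomputable section

/-- `f` is a pseudo-rotation with rotation vector `ρ`, witnessed by the lift `F`. -/
def IsPseudoRotation (F : ℝ × ℝ → ℝ × ℝ) (ρ : ℝ × ℝ) : Prop :=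
  ∀ x : ℝ × ℝ, Tendsto (fun n : ℕ => ((n : ℝ))⁻¹ • (F^[n] x - x)) atTop (𝓝 ρ)

/-- The bounded mean motion property for the lift `F` with rotation vector `ρ`. -/
def BoundedMeanMotion (F : (ℝ × ℝ) ≃ₜ (ℝ × ℝ)) (ρ : ℝ × ℝ) : Prop :=
  ∃ C : ℝ, ∀ (x : ℝ × ℝ) (n : ℤ), ‖hIter F n x - x - (n : ℝ) • ρ‖ ≤ C

/-- A self-map is nonwandering if every nonempty open set returns to meet itself. -/
def NonwanderingMap {X : Type*} [TopologicalSpace X] (f : X → X) : Prop :=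
  ∀ V : Set X, IsOpen V → V.Nonempty → ∃ n : ℕ, 0 < n ∧ (f^[n] '' V ∩ V).Nonempty


/-! ### Logarithms -/

theorem exists_clog {A : Type*} [TopologicalSpace A] [SimplyConnectedSpace A]
    [LocallyPathConnectedSpace A] (f : A → ℂ) (hf : Continuous f) (h0 : ∀ a, f a ≠ 0) :
    ∃ l : A → ℂ, Continuous l ∧ ∀ a, Complex.exp (l a) = f a := by
  obtain ⟨a₀⟩ : Nonempty A := inferInstance
  obtain ⟨l, ⟨-, hl⟩, -⟩ := Complex.isCoveringMapOn_exp.existsUnique_continuousMap_lifts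
    (⟨f, hf⟩ : C(A, ℂ)) (a₀ := a₀) (e₀ := Complex.log (f a₀))
    (by simpa using Complex.exp_log (h0 a₀)) (fun a => by simpa using h0 a)
  exact ⟨l, l.continuous, fun a => congrFun hl a⟩

theorem clog_const {A : Type*} [TopologicalSpace A] {S : Set A} (hS : IsPreconnected S)
    {h : A → ℂ} (hh : ContinuousOn h S) {c : ℂ} (hc : ∀ x ∈ S, Complex.exp (h x) = c)
    {x y : A} (hx : x ∈ S) (hy : y ∈ S) : h x = h y := by
  have := Complex.isCoveringMap_exp.eqOn_of_comp_eqOn hS hh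
    (continuousOn_const (c := h y)) (fun a ha => by
      simp only [Function.comp]
      apply Subtype.ext
      simp [hc a ha, hc y hy]) hy rfl
  exact this hx

/-- Orientation preservation, in the form of a symmetric logarithm of the difference quotient. -/
def GoodMap (G : ℂ → ℂ) : Prop :=
  ∃ L : ℂ × ℂ → ℂ, ContinuousOn L {x | x.1 ≠ x.2} ∧ (∀ p q, p ≠ q → L (p, q) = L (q, p)) ∧
    ∀ p q, p ≠ q → Complex.exp (L (p, q)) * (p - q) = G p - G q

theorem GoodMap.comp {G H : ℂ → ℂ} (hH : GoodMap H) (hG : GoodMap G) (hi : Injective G)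
    (hc : Continuous G) : GoodMap (H ∘ G) := by
  obtain ⟨L, hL, hLs, hLe⟩ := hH
  obtain ⟨K, hK, hKs, hKe⟩ := hG
  refine ⟨fun x => L (G x.1, G x.2) + K x, ?_, ?_, ?_⟩
  · refine ContinuousOn.add (hL.comp (by fun_prop) ?_) hK
    intro x hx
    exact fun h => hx (hi h)
  · intro p q h
    simp only
    rw [hLs _ _ (fun e => h (hi e)), hKs _ _ h]
  · intro p q h
    simp only [Complex.exp_add, mul_assoc, hKe p q h, Function.comp]
    exact hLe _ _ (fun e => h (hi e))

theorem goodMap_of_near {φ : ℂ → ℂ} (hc : Continuous φ) {κ : ℝ} (hκ : κ < 1)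
    (h : ∀ p q, ‖(φ p - φ q) - (p - q)‖ ≤ κ * ‖p - q‖) : GoodMap φ := by
  have hs : ∀ p q, p ≠ q → (φ p - φ q) / (p - q) ∈ Complex.slitPlane := by
    intro p q hpq
    have h0 : p - q ≠ 0 := sub_ne_zero.2 hpq
    suffices hlt : ‖(φ p - φ q) / (p - q) - 1‖ < 1 by
      simpa using Complex.mem_slitPlane_of_norm_lt_one hlt
    rw [div_sub_one h0, norm_div, div_lt_one (norm_pos_iff.2 h0)]
    have := h p q
    have : 0 < ‖p - q‖ := norm_pos_iff.2 h0
    nlinarith [h p q]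
  refine ⟨fun x => Complex.log ((φ x.1 - φ x.2) / (x.1 - x.2)), ?_, ?_, ?_⟩
  · apply ContinuousOn.clog
    · apply ContinuousOn.div
      · fun_prop
      · fun_prop
      · intro x hx
        exact sub_ne_zero.2 hx
    · intro x hx
      exact hs _ _ hx
  · intro p q _
    simp only
    rw [← neg_sub (φ q), ← neg_sub q p, neg_div_neg_eq]
  · intro p q hpq
    have h0 : p - q ≠ 0 := sub_ne_zero.2 hpq
    simp only
    rw [Complex.exp_log (Complex.slitPlane_ne_zero (hs p q hpq)), div_mul_cancel₀ _ h0]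

theorem goodMap_of_bounded {G : ℂ → ℂ} (hc : Continuous G) (hi : Injective G) {C : ℝ}
    (hb : ∀ z, ‖G z - z‖ ≤ C) : GoodMap G := by
  have hC : 0 ≤ C := (norm_nonneg _).trans (hb 0)
  let Φ : ℂ × ℂ → ℂ := fun x => (G (x.1 + Complex.exp x.2) - G x.1) / Complex.exp x.2
  have hΦc : Continuous Φ := by
    refine Continuous.div (by fun_prop) (by fun_prop) (fun x => Complex.exp_ne_zero _)
  have hΦ0 : ∀ x, Φ x ≠ 0 := by
    intro x
    refine div_ne_zero (sub_ne_zero.2 fun h => ?_) (Complex.exp_ne_zero _)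
    have := hi h
    simp at this
  obtain ⟨M, hMc, hM⟩ := exists_clog Φ hΦc hΦ0
  let R : ℝ := Real.log (2 * C + 1)
  have hfar : ∀ x : ℂ × ℂ, R ≤ x.2.re → Φ x ∈ Complex.slitPlane := by
    intro x hx
    have he := Complex.exp_ne_zero x.2
    suffices hlt : ‖Φ x - 1‖ < 1 by
      simpa using Complex.mem_slitPlane_of_norm_lt_one hlt
    have : Φ x - 1 = ((G (x.1 + Complex.exp x.2) - (x.1 + Complex.exp x.2)) - (G x.1 - x.1))
        / Complex.exp x.2 := by
      simp only [Φ]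
      field_simp
      ring
    rw [this, norm_div, div_lt_one (norm_pos_iff.2 he), Complex.norm_exp]
    calc _ ≤ C + C := (norm_sub_le _ _).trans (add_le_add (hb _) (hb _))
      _ < 2 * C + 1 := by linarith
      _ = Real.exp R := (Real.exp_log (by linarith)).symm
      _ ≤ _ := Real.exp_le_exp.2 hx
  have hSc : IsPreconnected {x : ℂ × ℂ | R ≤ x.2.re} := by
    apply Convex.isPreconnected
    intro x hx y hy a b ha hb hab
    simp only [Set.mem_ofPred_eq, Prod.snd_add, Prod.smul_snd, Complex.add_re, Complex.smul_re,
      smul_eq_mul] at *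
    have h1 := mul_le_mul_of_nonneg_left hx ha
    have h2 := mul_le_mul_of_nonneg_left hy hb
    have h3 : R = a * R + b * R := by rw [← add_mul, hab, one_mul]
    linarith
  have hMlog : ∀ x y : ℂ × ℂ, R ≤ x.2.re → R ≤ y.2.re →
      M x - Complex.log (Φ x) = M y - Complex.log (Φ y) := by
    intro x y hx hy
    refine clog_const (h := fun x => M x - Complex.log (Φ x)) (c := 1) hSc ?_ ?_ hx hy
    · exact hMc.continuousOn.sub (hΦc.continuousOn.clog fun x hx => hfar x hx)
    · intro x _
      rw [Complex.exp_sub, hM, Complex.exp_log (hΦ0 x), div_self (hΦ0 x)]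
  have hinv : ∀ T : ℂ × ℂ → ℂ × ℂ, Continuous T → (∀ x, Φ (T x) = Φ x) →
      (T (0, (R : ℂ))).2.re = R → ∀ x, M (T x) = M x := by
    intro T hT hΦT hR x
    have h1 : M (T x) - M x = M (T (0, (R : ℂ))) - M (0, (R : ℂ)) := by
      refine clog_const (h := fun x => M (T x) - M x) (c := 1) isPreconnected_univ
        (by fun_prop) ?_ (mem_univ _) (mem_univ _)
      intro x _
      rw [Complex.exp_sub, hM, hM, hΦT, div_self (hΦ0 x)]
    have h2 := hMlog (T (0, (R : ℂ))) (0, (R : ℂ)) hR.ge (by simp)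
    rw [hΦT] at h2
    linear_combination h1 + h2
  have hper : ∀ p w w', Complex.exp w = Complex.exp w' → M (p, w) = M (p, w') := by
    intro p w w' h
    obtain ⟨n, hn⟩ := Complex.exp_eq_exp_iff_exists_int.1 h
    rw [hn]
    refine hinv (fun x => (x.1, x.2 + n * (2 * Real.pi * Complex.I))) (by fun_prop) ?_ (by simp)
      (p, w')
    intro x
    have : Complex.exp (x.2 + n * (2 * Real.pi * Complex.I)) = Complex.exp x.2 :=
      Complex.exp_eq_exp_iff_exists_int.2 ⟨n, rfl⟩
    simp only [Φ, this]
  have hswap : ∀ p w, M (p + Complex.exp w, w + Real.pi * Complex.I) = M (p, w) := by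
    intro p w
    refine hinv (fun x => (x.1 + Complex.exp x.2, x.2 + Real.pi * Complex.I)) (by fun_prop) ?_
      (by simp) (p, w)
    intro x
    have : Complex.exp (x.2 + Real.pi * Complex.I) = - Complex.exp x.2 := by
      rw [Complex.exp_add, Complex.exp_pi_mul_I]; ring
    simp only [Φ, this]
    rw [add_neg_cancel_right, ← neg_sub, neg_div_neg_eq]
  refine ⟨fun x => M (x.1, Complex.log (x.2 - x.1)), ?_, ?_, ?_⟩
  · rintro ⟨p₀, q₀⟩ h0
    have hx : q₀ - p₀ ≠ 0 := sub_ne_zero.2 (Ne.symm h0)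
    have hA : ContinuousAt (fun x : ℂ × ℂ =>
        M (x.1, Complex.log ((x.2 - x.1) / (q₀ - p₀)) + Complex.log (q₀ - p₀))) (p₀, q₀) := by
      apply hMc.continuousAt.comp
      refine ContinuousAt.prodMk continuousAt_fst (ContinuousAt.add ?_ continuousAt_const)
      refine ContinuousAt.clog (by fun_prop) ?_
      simp [hx]
    refine hA.continuousWithinAt.congr ?_ ?_
    · rintro ⟨p, q⟩ h
      have h1 : q - p ≠ 0 := sub_ne_zero.2 (Ne.symm h)
      apply hper
      simp only
      rw [Complex.exp_add, Complex.exp_log h1, Complex.exp_log hx,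
        Complex.exp_log (div_ne_zero h1 hx), div_mul_cancel₀ _ hx]
    · simp [hx]
  · intro p q h
    have h1 : q - p ≠ 0 := sub_ne_zero.2 (Ne.symm h)
    have h2 : p - q ≠ 0 := sub_ne_zero.2 h
    simp only
    rw [← hswap p, Complex.exp_log h1, add_sub_cancel]
    apply hper
    rw [Complex.exp_add, Complex.exp_log h1, Complex.exp_log h2, Complex.exp_pi_mul_I]
    ring
  · intro p q h
    have h1 : q - p ≠ 0 := sub_ne_zero.2 (Ne.symm h)
    simp only [hM, Φ]
    rw [Complex.exp_log h1, add_sub_cancel]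
    field_simp
    ring

/-! ### The index argument -/

theorem no_min_collision {H : ℂ → ℂ} (hc : Continuous H) (hg : GoodMap H)
    (hfix : ∀ z, H z ≠ z) {γ : ℝ → ℂ} (hγ : Continuous γ)
    (hshift : ∀ s, 0 ≤ s → γ (s + 1) = H (γ s)) {a T : ℝ} (ha : 0 ≤ a) (hT : 1 < T)
    (hcol : γ (a + T) = γ a)
    (hno : ∀ s u, 0 ≤ s → 0 < u → u < T → γ (s + u) ≠ γ s) : False := by
  obtain ⟨L, hL, hLs, hLe⟩ := hg
  set m : ℝ := min 1 (T - 1) with hm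
  set M : ℝ := max 1 (T - 1) with hM
  have hm0 : 0 < m := lt_min one_pos (by linarith)
  have hMT : M < T := max_lt hT (by linarith)
  have hm1 : m ≤ 1 := min_le_left _ _
  have hm2 : m ≤ T - 1 := min_le_right _ _
  have hM1 : 1 ≤ M := le_max_left _ _
  have hM2 : T - 1 ≤ M := le_max_right _ _
  have hmM : m + M = T := by rw [hm, hM, min_add_max]; ring
  let cl : ℝ → ℝ := fun s => max a (min s (a + T))
  let cu : ℝ → ℝ := fun u => max m (min u M)
  obtain ⟨Λ, hΛc, hΛ'⟩ := exists_clog (A := ℝ × ℝ)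
    (fun x => γ (cl x.1 + cu x.2) - γ (cl x.1)) (by fun_prop) (fun x => by
      refine sub_ne_zero.2 (hno _ _ (ha.trans (le_max_left _ _)) (hm0.trans_le (le_max_left _ _)) ?_)
      exact max_lt (by linarith) ((min_le_right _ _).trans_lt hMT))
  have hΛ : ∀ s u, a ≤ s → s ≤ a + T → m ≤ u → u ≤ M →
      Complex.exp (Λ (s, u)) = γ (s + u) - γ s := by
    intro s u h1 h2 h3 h4
    rw [hΛ']
    simp only [cl, cu, min_eq_left h2, max_eq_right h1, min_eq_left h4, max_eq_right h3]
  have hne : ∀ s u, a ≤ s → m ≤ u → u ≤ M → γ (s + u) - γ s ≠ 0 := fun s u h1 h2 h3 =>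
    sub_ne_zero.2 (hno _ _ (ha.trans h1) (hm0.trans_le h2) (h3.trans_lt hMT))
  -- displacement
  obtain ⟨l, hlc, hl⟩ := exists_clog (A := ℂ) (fun z => H z - z) (by fun_prop)
    (fun z => sub_ne_zero.2 (hfix z))
  have e1 : Λ (a + T, 1) = Λ (a, 1) := by
    have := clog_const (S := Icc a (a + T)) (h := fun s => Λ (s, 1) - l (γ s)) (c := 1)
      isPreconnected_Icc (by fun_prop) (fun s hs => by
        rw [Complex.exp_sub, hΛ s 1 hs.1 hs.2 hm1 hM1, hl, hshift s (ha.trans hs.1), div_self]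
        exact sub_ne_zero.2 (hfix _))
      (x := a + T) (y := a) ⟨by linarith, le_rfl⟩ ⟨le_rfl, by linarith⟩
    simp only [hcol] at this
    linear_combination this
  -- antipodal
  have hE : ∀ v ∈ Icc m M, Complex.exp (Λ (a, T - v) - Λ (a + T - v, v)) = -1 := by
    intro v hv
    have hv1 := hv.1
    have hv2 := hv.2
    rw [Complex.exp_sub, hΛ _ _ le_rfl (by linarith) (by linarith) (by linarith),
      hΛ _ _ (by linarith) (by linarith) hv1 hv2]
    have := hne (a + T - v) v (by linarith) hv1 hv2
    have h4 : a + T - v + v = a + T := by ring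
    have h5 : a + (T - v) = a + T - v := by ring
    rw [h4, hcol] at this ⊢
    rw [h5]
    field_simp
    ring
  have e2 : Λ (a, T - 1) - Λ (a + T - 1, 1) = Λ (a, T - (T - 1)) - Λ (a + T - (T - 1), T - 1) :=
    clog_const (S := Icc m M) (h := fun v => Λ (a, T - v) - Λ (a + T - v, v)) (c := -1)
      isPreconnected_Icc (by fun_prop) hE ⟨hm1, hM1⟩ ⟨hm2, hM2⟩
  have e3 : Λ (a + 1, T - 1) - Λ (a, T - 1) - L (γ a, γ (a + (T - 1))) =
      Λ (a + T - 1 + 1, 1) - Λ (a + T - 1, 1) - L (γ (a + T - 1), γ (a + T - 1 + 1)) := by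
    have hS : IsPreconnected (Icc a (a + T - 1) ×ˢ Icc m M) :=
      isPreconnected_Icc.prod isPreconnected_Icc
    refine clog_const (h := fun x : ℝ × ℝ =>
      Λ (x.1 + 1, x.2) - Λ (x.1, x.2) - L (γ x.1, γ (x.1 + x.2))) (c := 1) hS ?_ ?_
      (x := (a, T - 1)) (y := (a + T - 1, 1)) ?_ ?_
    · refine ContinuousOn.sub (by fun_prop) (hL.comp (by fun_prop) ?_)
      rintro ⟨s, u⟩ ⟨hs, hu⟩
      exact fun h => hne s u hs.1 hu.1 hu.2 (sub_eq_zero.2 h.symm)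
    · rintro ⟨s, u⟩ ⟨⟨hs1, hs2⟩, ⟨hu1, hu2⟩⟩
      simp only at hs1 hs2 hu1 hu2
      have h0 := hne s u hs1 hu1 hu2
      have h1 := hne (s + 1) u (by linarith) hu1 hu2
      have h2 : γ s ≠ γ (s + u) := fun h => h0 (sub_eq_zero.2 h.symm)
      have h3 := hLe _ _ h2
      have h4 : γ (s + 1 + u) - γ (s + 1) = H (γ (s + u)) - H (γ s) := by
        rw [hshift s (ha.trans hs1), ← hshift (s + u) (by linarith)]
        congr 2
        ring
      rw [Complex.exp_sub, Complex.exp_sub, hΛ _ _ (by linarith) (by linarith) hu1 hu2,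
        hΛ _ _ hs1 (by linarith) hu1 hu2, h4, div_div, div_eq_one_iff_eq]
      · linear_combination h3
      · exact mul_ne_zero h0 (Complex.exp_ne_zero _)
    · exact ⟨⟨le_rfl, by simp only; linarith⟩, ⟨hm2, hM2⟩⟩
    · exact ⟨⟨by simp only; linarith, le_rfl⟩, ⟨hm1, hM1⟩⟩
  have h6 : a + T - 1 + 1 = a + T := by ring
  have h7 : a + (T - 1) = a + T - 1 := by ring
  have h8 : T - (T - 1) = 1 := by ring
  have h9 : a + T - (T - 1) = a + 1 := by ring
  have h10 : γ a ≠ γ (a + T - 1) := by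
    have := hne a (T - 1) le_rfl hm2 hM2
    rw [h7] at this
    exact fun h => this (sub_eq_zero.2 h.symm)
  rw [h6, h7, hcol, hLs _ _ h10, e1] at e3
  rw [h8, h9] at e2
  have hz : Λ (a, T - 1) - Λ (a + T - 1, 1) = 0 := by linear_combination (e2 - e3) / 2
  have := hE 1 ⟨hm1, hM1⟩
  rw [hz, Complex.exp_zero] at this
  norm_num at this

theorem no_collision {H : ℂ → ℂ} (hc : Continuous H) (hi : Injective H) (hg : GoodMap H)
    (hfix : ∀ z, H z ≠ z) {γ : ℝ → ℂ} (hγ : Continuous γ)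
    (hshift : ∀ s, 0 ≤ s → γ (s + 1) = H (γ s))
    (hinj : ∀ s t, 0 ≤ s → s ≤ 1 → 0 ≤ t → t ≤ 1 → γ s = γ t → s = t)
    (htr : ∀ s t, 0 ≤ s → s ≤ 1 → 0 ≤ t → t ≤ 1 → H (γ t) = γ s → (t = 0 ∧ s = 1) ∨ (t = 1 ∧ s = 0))
    {s₀ u₀ : ℝ} (hs₀ : 0 ≤ s₀) (hu₀ : 0 < u₀) (hcol : γ (s₀ + u₀) = γ s₀) : False := by
  -- reduction to `s ∈ [0,1)`
  have hred : ∀ s u, 0 ≤ s → 0 < u → γ (s + u) = γ s →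
      ∃ s', 0 ≤ s' ∧ s' < 1 ∧ γ (s' + u) = γ s' := by
    have key : ∀ n : ℕ, ∀ s u : ℝ, 0 ≤ s → s < n + 1 → 0 < u → γ (s + u) = γ s →
      ∃ s', 0 ≤ s' ∧ s' < 1 ∧ γ (s' + u) = γ s' := by
      intro n
      induction n with
      | zero => intro s u h0 h1 _ h; exact ⟨s, h0, by simpa using h1, h⟩
      | succ n ih =>
        intro s u h0 h1 hu h
        by_cases h2 : s < 1
        · exact ⟨s, h0, h2, h⟩
        · push Not at h2
          refine ih (s - 1) u (by linarith) (by push_cast at h1; linarith) hu (hi ?_)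
          rw [← hshift _ (by linarith), ← hshift _ (by linarith)]
          convert h using 2 <;> ring
    intro s u h0 hu h
    obtain ⟨n, hn⟩ := exists_nat_gt s
    exact key n s u h0 (by linarith) hu h
  have hgap : ∀ s u, 0 ≤ s → 0 < u → γ (s + u) = γ s → 1 < u := by
    intro s u hs hu h
    obtain ⟨s, hs0, hs1, h⟩ := hred s u hs hu h
    by_contra hu1
    push Not at hu1
    by_cases h1 : s + u ≤ 1
    · have := hinj _ _ (by linarith) h1 hs0 hs1.le h
      linarith
    · push Not at h1
      have h2 : γ (s + u) = H (γ (s + u - 1)) := by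
        rw [← hshift _ (by linarith)]; congr 1; ring
      rw [h2] at h
      rcases htr _ _ hs0 hs1.le (by linarith) (by linarith) h with ⟨_, h4⟩ | ⟨h3, h4⟩ <;> linarith
  let K : Set (ℝ × ℝ) := (Icc 0 1 ×ˢ Icc 1 u₀) ∩ {x | γ (x.1 + x.2) = γ x.1}
  have hK : IsCompact K :=
    (isCompact_Icc.prod isCompact_Icc).inter_right (isClosed_eq (by fun_prop) (by fun_prop))
  have hKn : K.Nonempty := by
    obtain ⟨s, h0, h1, h⟩ := hred s₀ u₀ hs₀ hu₀ hcol
    exact ⟨(s, u₀), ⟨⟨h0, h1.le⟩, (hgap _ _ h0 hu₀ h).le, le_rfl⟩, h⟩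
  obtain ⟨⟨a, T⟩, ⟨⟨⟨ha0, ha1⟩, ⟨hT1, hT2⟩⟩, haT⟩, hmin⟩ :=
    hK.exists_isMinOn hKn (continuous_snd.continuousOn (s := K))
  simp only at ha0 ha1 hT1 hT2
  have haT' : γ (a + T) = γ a := haT
  refine no_min_collision hc hg hfix hγ hshift ha0 (hgap a T ha0 (by linarith) haT') haT' ?_
  intro s u hs hu huT h
  have hu1 := hgap s u hs hu h
  obtain ⟨s', h0, h1, h'⟩ := hred s u hs hu h
  have := hmin (a := (s', u)) ⟨⟨⟨h0, h1.le⟩, hu1.le, by simp only; linarith⟩, h'⟩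
  simp only [Set.mem_ofPred_eq] at this
  linarith

/-- The curve obtained by iterating an arc. -/
theorem exists_curve {H : ℂ → ℂ} (hc : Continuous H) {α : ℝ → ℂ} (hα : Continuous α)
    (h1 : α 1 = H (α 0)) : ∃ γ : ℝ → ℂ, Continuous γ ∧ (∀ s, 0 ≤ s → γ (s + 1) = H (γ s)) ∧
      ∀ s, 0 ≤ s → s ≤ 1 → γ s = α s := by
  let γ : ℝ → ℂ := fun s => H^[⌊s⌋₊] (α (max s 0 - ⌊s⌋₊))
  have hγn : ∀ (n : ℕ) (s : ℝ), n ≤ s → s ≤ n + 1 → γ s = H^[n] (α (s - n)) := by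
    intro n s hs1 hs2
    have hs0 : 0 ≤ s := n.cast_nonneg.trans hs1
    rcases hs2.lt_or_eq with h | h
    · have : ⌊s⌋₊ = n := (Nat.floor_eq_iff hs0).2 ⟨hs1, h⟩
      simp only [γ, this, max_eq_left hs0]
    · have : ⌊s⌋₊ = n + 1 := by rw [h]; exact_mod_cast Nat.floor_natCast (n + 1)
      simp only [γ, this, max_eq_left hs0]
      rw [h]
      push_cast
      rw [sub_self, Function.iterate_succ_apply, ← h1]
      simp
  refine ⟨γ, ?_, ?_, ?_⟩
  · have hon : ∀ n : ℕ, ContinuousOn γ (Iic (n : ℝ)) := by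
      intro n
      induction n with
      | zero =>
        refine (continuousOn_const (c := α 0)).congr ?_
        intro s hs
        have hs' : s ≤ 0 := by simpa using hs
        simp [γ, Nat.floor_of_nonpos hs', max_eq_right hs']
      | succ n ih =>
        have : Iic ((n + 1 : ℕ) : ℝ) = Iic (n : ℝ) ∪ Icc (n : ℝ) (n + 1) := by
          rw [Iic_union_Icc_eq_Iic (by linarith)]; push_cast; rfl
        rw [this]
        refine ih.union_of_isClosed ?_ isClosed_Iic isClosed_Icc
        refine ContinuousOn.congr (f := fun s => H^[n] (α (s - n))) ?_ ?_
        · exact ((hc.iterate n).comp (by fun_prop)).continuousOn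
        · intro s hs
          exact hγn n s hs.1 hs.2
    rw [continuous_iff_continuousAt]
    intro s
    obtain ⟨n, hn⟩ := exists_nat_gt s
    exact (hon n).continuousAt (Iic_mem_nhds hn)
  · intro s hs
    have hf1 := Nat.floor_le hs
    have hf2 := (Nat.lt_floor_add_one s).le
    rw [hγn (⌊s⌋₊ + 1) (s + 1) (by push_cast; linarith) (by push_cast; linarith),
      hγn ⌊s⌋₊ s hf1 hf2, Function.iterate_succ_apply']
    push_cast
    congr 3
    ring
  · intro s h0 h1
    simpa using hγn 0 s (by simpa using h0) (by simpa using h1)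

/-! ### Pushing points inside a ball -/

theorem exists_push_local {x y : ℂ} {ρ : ℝ} {B : Set ℂ} (hB : Metric.ball x ρ ⊆ B)
    (hxy : ‖y - x‖ < ρ) :
    ∃ φ : ℂ → ℂ, Continuous φ ∧ Injective φ ∧ GoodMap φ ∧ (∀ z, z ∉ B → φ z = z) ∧ φ x = y := by
  have hρ : 0 < ρ := (norm_nonneg _).trans_lt hxy
  let β : ℂ → ℝ := fun w => max 0 (1 - ‖w - x‖ / ρ)
  let φ : ℂ → ℂ := fun w => w + (β w : ℂ) * (y - x)
  have hβc : Continuous β := by fun_prop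
  have hφc : Continuous φ := by fun_prop
  have hβ : ∀ p q, |β p - β q| ≤ ‖p - q‖ / ρ := by
    intro p q
    have hmx : |β p - β q| ≤ |(1 - ‖p - x‖ / ρ) - (1 - ‖q - x‖ / ρ)| := by
      have := abs_max_sub_max_le_abs (1 - ‖p - x‖ / ρ) (1 - ‖q - x‖ / ρ) 0
      simpa only [β, max_comm] using this
    refine hmx.trans ?_
    rw [sub_sub_sub_cancel_left, ← sub_div, abs_div, abs_of_pos hρ]
    refine div_le_div_of_nonneg_right ?_ hρ.le
    refine (abs_norm_sub_norm_le _ _).trans (le_of_eq ?_)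
    rw [← norm_neg]
    congr 1
    ring
  have hnear : ∀ p q, ‖(φ p - φ q) - (p - q)‖ ≤ (‖y - x‖ / ρ) * ‖p - q‖ := by
    intro p q
    have : (φ p - φ q) - (p - q) = ((β p - β q : ℝ) : ℂ) * (y - x) := by
      simp only [φ]; push_cast; ring
    rw [this, norm_mul, Complex.norm_real, Real.norm_eq_abs]
    calc _ ≤ ‖p - q‖ / ρ * ‖y - x‖ := mul_le_mul_of_nonneg_right (hβ p q) (norm_nonneg _)
      _ = _ := by ring
  have hκ : ‖y - x‖ / ρ < 1 := (div_lt_one hρ).2 hxy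
  refine ⟨φ, hφc, ?_, goodMap_of_near hφc hκ hnear, ?_, ?_⟩
  · intro p q h
    by_contra hpq
    have h0 : 0 < ‖p - q‖ := norm_pos_iff.2 (sub_ne_zero.2 hpq)
    have := hnear p q
    rw [h, sub_self, zero_sub, norm_neg] at this
    nlinarith
  · intro z hz
    have : ρ ≤ ‖z - x‖ := by
      by_contra h
      push Not at h
      exact hz (hB (by simpa [dist_eq_norm] using h))
    have : β z = 0 := max_eq_left (by
      have := (one_le_div hρ).2 this
      linarith)
    simp [φ, this]
  · simp [φ, β]

theorem exists_push {m : ℂ} {r : ℝ} {x y : ℂ} (hx : x ∈ Metric.ball m r)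
    (hy : y ∈ Metric.ball m r) :
    ∃ φ : ℂ → ℂ, Continuous φ ∧ Injective φ ∧ GoodMap φ ∧
      (∀ z, z ∉ Metric.ball m r → φ z = z) ∧ φ x = y := by
  refine IsPreconnected.induction₂' (s := Metric.ball m r) (convex_ball m r).isPreconnected
    (fun x y => ∃ φ : ℂ → ℂ, Continuous φ ∧ Injective φ ∧ GoodMap φ ∧
      (∀ z, z ∉ Metric.ball m r → φ z = z) ∧ φ x = y) ?_ ?_ hx hy
  · intro x hx
    obtain ⟨ρ, hρ, hB⟩ := Metric.isOpen_iff.1 Metric.isOpen_ball x hx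
    filter_upwards [mem_nhdsWithin_of_mem_nhds (Metric.ball_mem_nhds x (half_pos hρ))] with y hy
    rw [Metric.mem_ball, dist_eq_norm] at hy
    refine ⟨exists_push_local hB (by linarith), exists_push_local (ρ := ρ / 2) ?_ ?_⟩
    · refine Subset.trans (fun w hw => ?_) hB
      rw [Metric.mem_ball] at hw ⊢
      have : dist y x < ρ / 2 := by rwa [dist_eq_norm]
      linarith [dist_triangle w y x]
    · rwa [norm_sub_rev]
  · rintro x y z - - - ⟨φ, h1, h2, h3, h4, h5⟩ ⟨ψ, k1, k2, k3, k4, k5⟩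
    refine ⟨ψ ∘ φ, k1.comp h1, k2.comp h2, k3.comp h3 h2 h1, ?_, by simp [h5, k5]⟩
    intro w hw
    simp [h4 w hw, k4 w hw]

/-! ### Fixed points of planar maps with recurrence -/

theorem core_fixed_point {G : ℂ → ℂ} (hc : Continuous G) (hi : Injective G) {C : ℝ}
    (hb : ∀ z, ‖G z - z‖ ≤ C) (hmin : ∃ z, ∀ w, ‖G z - z‖ ≤ ‖G w - w‖)
    (hnw : ∀ V : Set ℂ, IsOpen V → V.Nonempty → ∃ k : ℕ, 1 ≤ k ∧ ∃ y ∈ V, G^[k] y ∈ V) :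
    ∃ z, G z = z := by
  by_contra hfix
  push Not at hfix
  obtain ⟨z, hz⟩ := hmin
  set d : ℂ := G z - z with hd
  set δ : ℝ := ‖d‖ with hδ
  have hδ0 : 0 < δ := norm_pos_iff.2 (sub_ne_zero.2 (hfix z))
  set m : ℂ := z + d / 2 with hm
  set B := Metric.ball m (δ / 8) with hB
  obtain ⟨k₀, hk₀, y, hyB, hyk₀⟩ := hnw B Metric.isOpen_ball ⟨m, Metric.mem_ball_self (by linarith)⟩
  have hex : ∃ k : ℕ, 1 ≤ k ∧ G^[k] y ∈ B := ⟨k₀, hk₀, hyk₀⟩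
  classical
  let k := Nat.find hex
  obtain ⟨hk1, hkB⟩ : 1 ≤ k ∧ G^[k] y ∈ B := Nat.find_spec hex
  have hkmin : ∀ i, 1 ≤ i → i < k → G^[i] y ∉ B := fun i h1 h2 h3 =>
    Nat.find_min hex h2 ⟨h1, h3⟩
  obtain ⟨φ, hφc, hφi, hφg, hφB, hφy⟩ := exists_push hkB hyB
  have hφin : ∀ w, w ∈ B → φ w ∈ B := by
    intro w hw
    by_contra h
    exact h (by rwa [hφi (hφB _ h)])
  have hBm : ∀ w, w ∈ B → ‖w - m‖ < δ / 8 := by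
    intro w hw
    rwa [hB, Metric.mem_ball, dist_eq_norm] at hw
  let H : ℂ → ℂ := φ ∘ G
  have hHc : Continuous H := hφc.comp hc
  have hHi : Injective H := hφi.comp hi
  have hHg : GoodMap H := hφg.comp (goodMap_of_bounded hc hi hb) hi hc
  have hHfix : ∀ p, H p ≠ p := by
    intro p hp
    by_cases h : G p ∈ B
    · have h1 : p ∈ B := by rw [← hp]; exact hφin _ h
      have h2 := hBm _ h
      have h3 := hBm _ h1
      have h4 := norm_sub_le (G p - m) (p - m)
      rw [sub_sub_sub_cancel_right] at h4
      linarith [hz p]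
    · exact hfix p ((hφB _ h).symm.trans hp)
  have hHk : H^[k] y = y := by
    have : ∀ i, i < k → H^[i] y = G^[i] y := by
      intro i
      induction i with
      | zero => intro _; rfl
      | succ i ih =>
        intro h
        rw [Function.iterate_succ_apply', ih (by omega), Function.iterate_succ_apply']
        apply hφB
        rw [← Function.iterate_succ_apply' G]
        exact hkmin _ (by omega) h
    obtain ⟨j, hj⟩ : ∃ j, k = j + 1 := ⟨k - 1, by omega⟩
    rw [hj, Function.iterate_succ_apply', this j (by omega)]
    change φ (G (G^[j] y)) = y
    rw [← Function.iterate_succ_apply' G]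
    rw [hj] at hφy
    exact hφy
  -- the arc
  set w : ℂ := y - m with hw
  have hwδ : ‖w‖ < δ / 8 := hBm _ hyB
  let α : ℝ → ℂ := fun t => z + (t : ℂ) * d + ((4 * t * (1 - t) : ℝ) : ℂ) * w
  have hαc : Continuous α := by fun_prop
  have hα0 : α 0 = z := by simp [α]
  have hα1 : α 1 = G z := by simp [α, hd]
  have hαh : α (1 / 2) = y := by
    simp only [α, hw, hm]
    push_cast
    ring
  have hαd : ∀ s t, α t - α s = ((t - s : ℝ) : ℂ) * (d + ((4 * (1 - t - s) : ℝ) : ℂ) * w) := by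
    intro s t
    simp only [α]
    push_cast
    ring
  have hαinj : ∀ s t, 0 ≤ s → s ≤ 1 → 0 ≤ t → t ≤ 1 → α s = α t → s = t := by
    intro s t hs0 hs1 ht0 ht1 h
    have h1 := hαd s t
    rw [h, sub_self] at h1
    rcases mul_eq_zero.1 h1.symm with h2 | h2
    · have : t - s = 0 := by exact_mod_cast h2
      linarith
    · exfalso
      have h3 : d = -(((4 * (1 - t - s) : ℝ) : ℂ) * w) := eq_neg_of_add_eq_zero_left h2
      have h4 : δ = |4 * (1 - t - s)| * ‖w‖ := by
        rw [hδ, h3, norm_neg, norm_mul, Complex.norm_real, Real.norm_eq_abs]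
      have h5 : |4 * (1 - t - s)| ≤ 4 := abs_le.2 ⟨by linarith, by linarith⟩
      nlinarith [norm_nonneg w]
  have hfar1 : ∀ s t, 0 ≤ s → s ≤ t → t ≤ 1 → δ ≤ ‖α t - α s‖ → t = 1 ∧ s = 0 := by
    intro s t hs hst ht h
    rw [hαd, norm_mul, Complex.norm_real, Real.norm_eq_abs, abs_of_nonneg (by linarith)] at h
    have h1 : ‖d + ((4 * (1 - t - s) : ℝ) : ℂ) * w‖ ≤ δ + (1 - (t - s)) * (δ / 2) := by
      refine (norm_add_le _ _).trans (add_le_add le_rfl ?_)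
      rw [norm_mul, Complex.norm_real, Real.norm_eq_abs]
      have h5 : |4 * (1 - t - s)| ≤ 4 * (1 - (t - s)) := abs_le.2 ⟨by linarith, by linarith⟩
      calc _ ≤ (4 * (1 - (t - s))) * (δ / 8) :=
            mul_le_mul h5 hwδ.le (norm_nonneg _) (by linarith)
        _ = _ := by ring
    have h2 : δ ≤ (t - s) * (δ + (1 - (t - s)) * (δ / 2)) :=
      h.trans (mul_le_mul_of_nonneg_left h1 (by linarith))
    have h3 : ¬ (t - s < 1) := by
      intro h4
      have h5 : 0 < (1 - (t - s)) * (2 - (t - s)) := mul_pos (by linarith) (by linarith)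
      nlinarith [mul_pos h5 hδ0]
    constructor <;> linarith
  have hfar : ∀ s t, 0 ≤ s → s ≤ 1 → 0 ≤ t → t ≤ 1 → δ ≤ ‖α s - α t‖ →
      (t = 0 ∧ s = 1) ∨ (t = 1 ∧ s = 0) := by
    intro s t hs0 hs1 ht0 ht1 h
    rcases le_total s t with h1 | h1
    · rw [norm_sub_rev] at h
      exact Or.inr (hfar1 s t hs0 h1 ht1 h)
    · exact Or.inl (hfar1 t s ht0 h1 hs1 h).symm
  have hαtr : ∀ s t, 0 ≤ s → s ≤ 1 → 0 ≤ t → t ≤ 1 → H (α t) = α s →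
      (t = 0 ∧ s = 1) ∨ (t = 1 ∧ s = 0) := by
    intro s t hs0 hs1 ht0 ht1 h
    have hdis := hz (α t)
    by_cases hin : G (α t) ∈ B
    · exfalso
      have h1 := hBm _ hin
      have h2 : α t - m = ((t - 1 / 2 : ℝ) : ℂ) * d + ((4 * t * (1 - t) : ℝ) : ℂ) * w := by
        simp only [α, hm]; push_cast; ring
      have h3 : ‖α t - m‖ ≤ 1 / 2 * δ + 1 * (δ / 8) := by
        rw [h2]
        refine (norm_add_le _ _).trans (add_le_add ?_ ?_)
        · rw [norm_mul, Complex.norm_real, Real.norm_eq_abs]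
          exact mul_le_mul_of_nonneg_right (abs_le.2 ⟨by linarith, by linarith⟩) hδ0.le
        · rw [norm_mul, Complex.norm_real, Real.norm_eq_abs]
          refine mul_le_mul (abs_le.2 ⟨?_, ?_⟩) hwδ.le (norm_nonneg _) zero_le_one
          · nlinarith
          · nlinarith [sq_nonneg (2 * t - 1)]
      have h4 := norm_sub_le (G (α t) - m) (α t - m)
      rw [sub_sub_sub_cancel_right] at h4
      linarith
    · have h1 : G (α t) = α s := (hφB _ hin).symm.trans h
      rw [h1] at hdis
      exact hfar s t hs0 hs1 ht0 ht1 hdis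
  have hα01 : α 1 = H (α 0) := by
    rw [hα0, hα1]
    refine (hφB _ fun h => ?_).symm
    have h1 := hBm _ h
    have h2 : G z - m = d / 2 := by rw [hm, hd]; ring
    rw [h2, norm_div, ← hδ] at h1
    norm_num at h1
    linarith
  obtain ⟨γ, hγc, hγs, hγα⟩ := exists_curve hHc hαc hα01
  have hγk : ∀ n : ℕ, γ (1 / 2 + n) = H^[n] y := by
    intro n
    induction n with
    | zero => rw [Nat.cast_zero, add_zero, hγα _ (by norm_num) (by norm_num), hαh]; rfl
    | succ n ih =>
      rw [Function.iterate_succ_apply', ← ih, ← hγs _ (by positivity)]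
      push_cast
      congr 1
      ring
  refine no_collision hHc hHi hHg hHfix hγc hγs ?_ ?_ (s₀ := 1 / 2) (u₀ := k) (by norm_num)
    (by exact_mod_cast hk1) ?_
  · intro s t hs0 hs1 ht0 ht1 h
    rw [hγα s hs0 hs1, hγα t ht0 ht1] at h
    exact hαinj s t hs0 hs1 ht0 ht1 h
  · intro s t hs0 hs1 ht0 ht1 h
    rw [hγα s hs0 hs1, hγα t ht0 ht1] at h
    exact hαtr s t hs0 hs1 ht0 ht1 h
  · have := hγk 0
    rw [Nat.cast_zero, add_zero] at this
    rw [hγk, hHk, this]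
    rfl

/-! ### Lifts -/

/-- Integer vectors in the plane. -/
def ivec (v : ℤ × ℤ) : ℝ × ℝ := ((v.1 : ℝ), (v.2 : ℝ))

theorem ivec_zero : ivec 0 = 0 := by
  ext <;> simp [ivec]

theorem ivec_add (v w : ℤ × ℤ) : ivec (v + w) = ivec v + ivec w := by
  simp [ivec]

theorem ivec_smul (n : ℕ) (v : ℤ × ℤ) : ivec (n • v) = (n : ℝ) • ivec v := by
  simp [ivec]

theorem proj_eq_iff (x y : ℝ × ℝ) : proj x = proj y ↔ ∃ v, x = y + ivec v := by
  have h1 : ∀ a b : ℝ, (a : AddCircle (1 : ℝ)) = b ↔ ∃ n : ℤ, a = b + n := by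
    intro a b
    rw [← sub_eq_zero, ← AddCircle.coe_sub, AddCircle.coe_eq_zero_iff]
    constructor
    · rintro ⟨n, hn⟩
      exact ⟨n, by simp at hn; linarith⟩
    · rintro ⟨n, hn⟩
      exact ⟨n, by simp; linarith⟩
  simp only [proj, Prod.mk.injEq, h1, ivec, Prod.ext_iff, Prod.fst_add, Prod.snd_add]
  constructor
  · rintro ⟨⟨n, hn⟩, ⟨k, hk⟩⟩
    exact ⟨(n, k), hn, hk⟩
  · rintro ⟨⟨n, k⟩, hn, hk⟩
    exact ⟨⟨n, hn⟩, ⟨k, hk⟩⟩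

theorem proj_isOpenMap : IsOpenMap proj :=
  IsOpenMap.prodMap (f := fun x : ℝ => (x : AddCircle (1 : ℝ)))
    (g := fun x : ℝ => (x : AddCircle (1 : ℝ)))
    QuotientAddGroup.isOpenMap_coe QuotientAddGroup.isOpenMap_coe

theorem proj_surjective : Surjective proj := by
  rintro ⟨a, b⟩
  obtain ⟨x, rfl⟩ := QuotientAddGroup.mk_surjective a
  obtain ⟨y, rfl⟩ := QuotientAddGroup.mk_surjective b
  exact ⟨(x, y), rfl⟩

theorem lift_iter {f : T2 → T2} {F : ℝ × ℝ → ℝ × ℝ} (hF : IsLift f F) (n : ℕ) :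
    (∀ x, proj (F^[n] x) = f^[n] (proj x)) ∧ ∀ x v, F^[n] (x + ivec v) = F^[n] x + ivec v := by
  induction n with
  | zero => exact ⟨fun _ => rfl, fun _ _ => rfl⟩
  | succ n ih =>
    refine ⟨fun x => ?_, fun x v => ?_⟩
    · rw [Function.iterate_succ_apply', Function.iterate_succ_apply', hF.1, ih.1]
    · rw [Function.iterate_succ_apply', Function.iterate_succ_apply', ih.2]
      exact hF.2 _ _

theorem lift_iter_sub {f : T2 → T2} {F : ℝ × ℝ → ℝ × ℝ} (hF : IsLift f F) (n : ℕ) (x : ℝ × ℝ)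
    (v : ℤ × ℤ) : F^[n] (x - ivec v) = F^[n] x - ivec v := by
  have := (lift_iter hF n).2 (x - ivec v) v
  rw [sub_add_cancel] at this
  rw [this, add_sub_cancel_right]

theorem return_lift {f : T2 → T2} {F : ℝ × ℝ → ℝ × ℝ} (hF : IsLift f F)
    (hnw : NonwanderingMap f) (V : Set (ℝ × ℝ)) (hV : IsOpen V) (hne : V.Nonempty) :
    ∃ n : ℕ, 0 < n ∧ ∃ w : ℤ × ℤ, (V ∩ {x | F^[n] x - ivec w ∈ V}).Nonempty := by
  obtain ⟨n, hn, _, ⟨_, ⟨a, ha, rfl⟩, h⟩, ⟨b, hb, rfl⟩⟩ :=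
    hnw (proj '' V) (proj_isOpenMap V hV) (hne.image _)
  rw [← (lift_iter hF n).1 a] at h
  obtain ⟨w, hw⟩ := (proj_eq_iff _ _).1 h
  refine ⟨n, hn, w, a, ha, ?_⟩
  simpa [hw] using hb

theorem chain_return {f : T2 → T2} {F : ℝ × ℝ → ℝ × ℝ} (hFc : Continuous F) (hF : IsLift f F)
    (hnw : NonwanderingMap f) {ρ : ℝ × ℝ} {C : ℝ}
    (hb : ∀ x (n : ℕ), ‖F^[n] x - x - (n : ℝ) • ρ‖ ≤ C) {q : ℕ} (hq : 0 < q) {P : ℤ × ℤ}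
    (hP : (q : ℝ) • ρ = ivec P) (V : Set (ℝ × ℝ)) (hV : IsOpen V) (hne : V.Nonempty) :
    ∃ k : ℕ, 1 ≤ k ∧ ∃ y ∈ V, F^[q * k] y - ivec (k • P) ∈ V := by
  obtain ⟨c, hc⟩ := hne
  obtain ⟨r, hr, hrV⟩ := Metric.isOpen_iff.1 hV c hc
  let X := {V : Set (ℝ × ℝ) // IsOpen V ∧ V.Nonempty}
  have hstep : ∀ V : X, ∃ n : ℕ, 0 < n ∧ ∃ w : ℤ × ℤ,
      ((V : Set (ℝ × ℝ)) ∩ {x | F^[n] x - ivec w ∈ (V : Set (ℝ × ℝ))}).Nonempty :=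
    fun V => return_lift hF hnw V V.2.1 V.2.2
  choose N hN W hW using hstep
  let nxt : X → X := fun V => ⟨(V : Set (ℝ × ℝ)) ∩ {x | F^[N V] x - ivec (W V) ∈ (V : Set (ℝ × ℝ))},
    V.2.1.inter (V.2.1.preimage ((hFc.iterate _).sub continuous_const)), hW V⟩
  let V₀ : X := ⟨Metric.ball c r, Metric.isOpen_ball, ⟨c, Metric.mem_ball_self hr⟩⟩
  let Vs : ℕ → X := fun j => nxt^[j] V₀
  have hVs : ∀ j, Vs (j + 1) = nxt (Vs j) := fun j => Function.iterate_succ_apply' _ _ _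
  let tN : ℕ → ℕ := fun j => ∑ i ∈ Finset.range j, N (Vs i)
  let tW : ℕ → ℤ × ℤ := fun j => ∑ i ∈ Finset.range j, W (Vs i)
  have key : ∀ i d : ℕ, ∃ (n : ℕ) (w : ℤ × ℤ), tN (i + d) = tN i + n ∧ tW (i + d) = tW i + w ∧
      d ≤ n ∧ (∀ x ∈ (Vs (i + d) : Set (ℝ × ℝ)), F^[n] x - ivec w ∈ (Vs i : Set (ℝ × ℝ))) ∧
      (Vs (i + d) : Set (ℝ × ℝ)) ⊆ Vs i := by
    intro i d
    induction d with
    | zero => exact ⟨0, 0, rfl, by simp, le_rfl, fun x hx => by simpa [ivec_zero] using hx, Subset.rfl⟩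
    | succ d ih =>
      obtain ⟨n, w, h1, h2, h3, h4, h5⟩ := ih
      refine ⟨n + N (Vs (i + d)), w + W (Vs (i + d)), ?_, ?_, ?_, ?_, ?_⟩
      · rw [← add_assoc, ← add_assoc, ← h1]
        exact Finset.sum_range_succ _ _
      · rw [← add_assoc, ← add_assoc, ← h2]
        exact Finset.sum_range_succ _ _
      · have := hN (Vs (i + d))
        omega
      · intro x hx
        rw [← add_assoc, hVs] at hx
        have := h4 _ hx.2
        rw [lift_iter_sub hF, ← Function.iterate_add_apply, sub_sub, add_comm (ivec _),
          ← ivec_add] at this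
        exact this
      · rw [← add_assoc, hVs]
        exact Set.inter_subset_left.trans h5
  let B : ℤ := ⌈q * (C + 2 * r)⌉
  have hfin : ((Iio q) ×ˢ (Icc ((-B, -B) : ℤ × ℤ) (B, B)) : Set (ℕ × ℤ × ℤ)).Finite :=
    (Set.finite_Iio q).prod (Set.finite_Icc _ _)
  obtain ⟨i, j, hij, heq⟩ := hfin.exists_lt_map_eq_of_forall_mem
    (f := fun j : ℕ => (tN j % q, q • tW j - tN j • P)) (by
      intro j
      refine ⟨Nat.mod_lt _ hq, ?_⟩
      obtain ⟨n, w, h1, h2, -, h4, h5⟩ := key 0 j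
      rw [zero_add] at h1 h2 h4 h5
      have e1 : tN j = n := by rw [h1]; simp [tN]
      have e2 : tW j = w := by rw [h2]; simp [tW]
      obtain ⟨x, hx⟩ := (Vs j).2.2
      have hx1 : ‖F^[n] x - ivec w - c‖ < r := by
        have : F^[n] x - ivec w ∈ Metric.ball c r := h4 x hx
        rwa [Metric.mem_ball, dist_eq_norm] at this
      have hx2 : ‖x - c‖ < r := by
        have : x ∈ Metric.ball c r := h5 hx
        rwa [Metric.mem_ball, dist_eq_norm] at this
      have hx3 := hb x n
      have e3 : ivec w - (n : ℝ) • ρ =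
          (F^[n] x - x - (n : ℝ) • ρ) - (F^[n] x - ivec w - c) + (x - c) := by abel
      have hx4 : ‖ivec w - (n : ℝ) • ρ‖ ≤ C + 2 * r := by
        rw [e3]
        have := norm_add_le ((F^[n] x - x - (n : ℝ) • ρ) - (F^[n] x - ivec w - c)) (x - c)
        have := norm_sub_le (F^[n] x - x - (n : ℝ) • ρ) (F^[n] x - ivec w - c)
        linarith
      have e4 : ivec (q • w - n • P) = (q : ℝ) • (ivec w - (n : ℝ) • ρ) := by
        rw [smul_sub, smul_comm, hP, ← ivec_smul, ← ivec_smul, eq_sub_iff_add_eq, ← ivec_add,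
          sub_add_cancel]
      have hx5 : ‖ivec (q • w - n • P)‖ ≤ q * (C + 2 * r) := by
        rw [e4, norm_smul, Real.norm_natCast]
        exact mul_le_mul_of_nonneg_left hx4 (Nat.cast_nonneg _)
      have hB : ∀ a : ℤ, |(a : ℝ)| ≤ q * (C + 2 * r) → -B ≤ a ∧ a ≤ B := by
        intro a ha
        have : |(a : ℝ)| ≤ B := ha.trans (Int.le_ceil _)
        have h' : |a| ≤ B := by exact_mod_cast this
        exact abs_le.1 h'
      rw [e1, e2]
      have b1 := hB _ ((norm_fst_le (ivec (q • w - n • P))).trans hx5)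
      have b2 := hB _ ((norm_snd_le (ivec (q • w - n • P))).trans hx5)
      exact ⟨⟨b1.1, b2.1⟩, ⟨b1.2, b2.2⟩⟩)
  obtain ⟨d, rfl⟩ := Nat.exists_eq_add_of_lt hij
  obtain ⟨n, w, h1, h2, h3, h4, h5⟩ := key i (d + 1)
  rw [← add_assoc] at h1 h2 h4 h5
  simp only [Prod.mk.injEq] at heq
  obtain ⟨q1, q2⟩ := heq
  rw [h1] at q1
  rw [h1, h2] at q2
  have hdvd : q ∣ n := by
    have : tN i + 0 ≡ tN i + n [MOD q] := q1
    have := Nat.ModEq.add_left_cancel' _ this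
    exact (Nat.modEq_zero_iff_dvd).1 this.symm
  obtain ⟨k, rfl⟩ := hdvd
  have hk : 1 ≤ k := by
    rcases Nat.eq_zero_or_pos k with h | h
    · subst h; simp at h3
    · exact h
  have hw : w = k • P := by
    have h6 : q • w = q • (k • P) := by
      rw [smul_add, add_smul, mul_smul] at q2
      have : q • tW i + q • w - (tN i • P + q • k • P) =
        (q • tW i - tN i • P) + (q • w - q • k • P) := by abel
      rw [this] at q2
      exact sub_eq_zero.1 (left_eq_add.1 q2)
    have hq' : (q : ℤ) ≠ 0 := by exact_mod_cast hq.ne'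
    have a1 := congrArg Prod.fst h6
    have a2 := congrArg Prod.snd h6
    simp only [Prod.smul_fst, Prod.smul_snd, nsmul_eq_mul] at a1 a2
    ext
    · simpa using mul_left_cancel₀ hq' a1
    · simpa using mul_left_cancel₀ hq' a2
  obtain ⟨y, hy⟩ := (Vs (i + d + 1)).2.2
  obtain ⟨-, -, -, -, -, -, h0⟩ := key 0 i
  rw [zero_add] at h0
  refine ⟨k, hk, y, hrV (h0 (h5 hy)), hrV (h0 ?_)⟩
  rw [← hw]
  exact h4 y hy

theorem periodic_of_rational {f : T2 → T2} {F : ℝ × ℝ → ℝ × ℝ} (hFc : Continuous F)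
    (hFi : Injective F) (hF : IsLift f F) (hnw : NonwanderingMap f) {ρ : ℝ × ℝ} {C : ℝ}
    (hb : ∀ x (n : ℕ), ‖F^[n] x - x - (n : ℝ) • ρ‖ ≤ C) {q : ℕ} (hq : 0 < q) {P : ℤ × ℤ}
    (hP : (q : ℝ) • ρ = ivec P) : ∃ z : T2, f^[q] z = z := by
  let E : (ℝ × ℝ) → (ℝ × ℝ) := fun x => F^[q] x - ivec P
  have hEc : Continuous E := (hFc.iterate q).sub continuous_const
  have hEi : Injective E := fun x y h => hFi.iterate q (sub_left_injective h)
  have hEb : ∀ x, ‖E x - x‖ ≤ C := by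
    intro x
    have := hb x q
    rw [hP] at this
    have e : E x - x = F^[q] x - x - ivec P := by simp only [E]; abel
    rwa [e]
  have hEv : ∀ x v, E (x + ivec v) = E x + ivec v := by
    intro x v
    simp only [E]
    rw [(lift_iter hF q).2]
    abel
  have hEk : ∀ (k : ℕ) x, E^[k] x = F^[q * k] x - ivec (k • P) := by
    intro k x
    induction k with
    | zero => simp [ivec_zero]
    | succ k ih =>
      rw [Function.iterate_succ_apply', ih]
      simp only [E]
      rw [lift_iter_sub hF, ← Function.iterate_add_apply, sub_sub, ← ivec_add, succ_nsmul,
        Nat.mul_succ, add_comm q]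
  let e := Complex.equivRealProdCLM
  let G : ℂ → ℂ := fun z => e.symm (E (e z))
  have hGk : ∀ (k : ℕ) z, G^[k] z = e.symm (E^[k] (e z)) := by
    intro k z
    induction k with
    | zero => simp
    | succ k ih => rw [Function.iterate_succ_apply', ih, Function.iterate_succ_apply']; simp [G]
  have hGd : ∀ z, G z - z = e.symm (E (e z) - e z) := by
    intro z
    simp [G]
  have hfix : ∃ z, G z = z := by
    refine core_fixed_point (C := ‖(e.symm : ℝ × ℝ →L[ℝ] ℂ)‖ * C) ?_ ?_ ?_ ?_ ?_
    · exact e.symm.continuous.comp (hEc.comp e.continuous)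
    · exact e.symm.injective.comp (hEi.comp e.injective)
    · intro z
      rw [hGd]
      exact ((e.symm : ℝ × ℝ →L[ℝ] ℂ).le_opNorm _).trans
        (mul_le_mul_of_nonneg_left (hEb _) (norm_nonneg _))
    · have hcont : Continuous fun x : ℝ × ℝ => ‖e.symm (E x - x)‖ :=
        (e.symm.continuous.comp (hEc.sub continuous_id)).norm
      obtain ⟨x, -, hx⟩ := (isCompact_Icc (a := ((0, 0) : ℝ × ℝ)) (b := (1, 1))).exists_isMinOn
        ⟨(0, 0), by simp⟩ hcont.continuousOn
      refine ⟨e.symm x, fun w => ?_⟩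
      rw [hGd, hGd, e.apply_symm_apply]
      have h1 := hx (a := (Int.fract (e w).1, Int.fract (e w).2))
        ⟨⟨Int.fract_nonneg _, Int.fract_nonneg _⟩, (Int.fract_lt_one _).le, (Int.fract_lt_one _).le⟩
      have h2 : e w = (Int.fract (e w).1, Int.fract (e w).2) + ivec (⌊(e w).1⌋, ⌊(e w).2⌋) := by
        ext <;> simp [ivec]
      simp only [Set.mem_ofPred_eq] at h1
      rw [h2, hEv, add_sub_add_right_eq_sub]
      exact h1
    · intro V hV hne
      obtain ⟨k, hk, y, hy, hyk⟩ := chain_return hFc hF hnw hb hq hP (e.symm ⁻¹' V)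
        (hV.preimage e.symm.continuous) (by
          obtain ⟨v, hv⟩ := hne
          exact ⟨e v, by simpa using hv⟩)
      refine ⟨k, hk, e.symm y, hy, ?_⟩
      rw [hGk, e.apply_symm_apply, hEk]
      exact hyk
  obtain ⟨z, hz⟩ := hfix
  have h1 : E (e z) = e z := by
    have := congrArg e hz
    simpa [G] using this
  refine ⟨proj (e z), ?_⟩
  rw [← (lift_iter hF q).1, proj_eq_iff]
  exact ⟨P, sub_eq_iff_eq_add.1 h1⟩

/-- **Jäger / Franks.**  For a conservative (nonwandering) pseudo-rotation of 𝕋² with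
bounded mean motion and rotation vector `ρ`: `ρ` is rational if and only if `f` has a
periodic point. -/
theorem conservative_pseudo_rotation_rational_iff_periodic_point
    (f : T2 ≃ₜ T2) (F : (ℝ × ℝ) ≃ₜ (ℝ × ℝ)) (hF : IsLift ⇑f ⇑F)
    (ρ : ℝ × ℝ) (hρ : IsPseudoRotation ⇑F ρ)
    (hbmm : BoundedMeanMotion F ρ)
    (hnw : NonwanderingMap ⇑f) :
    ((∃ r : ℚ, (r : ℝ) = ρ.1) ∧ (∃ r : ℚ, (r : ℝ) = ρ.2)) ↔
      ∃ z : T2, ∃ q : ℕ, 1 ≤ q ∧ (⇑f)^[q] z = z := by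
  obtain ⟨C, hC⟩ := hbmm
  have hb : ∀ x (n : ℕ), ‖(⇑F)^[n] x - x - (n : ℝ) • ρ‖ ≤ C := by
    intro x n
    have := hC x (n : ℤ)
    simpa [hIter] using this
  constructor
  · rintro ⟨⟨r, hr⟩, ⟨s, hs⟩⟩
    have hq : 0 < r.den * s.den := Nat.mul_pos r.den_pos s.den_pos
    have hP : ((r.den * s.den : ℕ) : ℝ) • ρ = ivec (r.num * s.den, s.num * r.den) := by
      have h1 : (r : ℝ) * r.den = r.num := by exact_mod_cast Rat.mul_den_eq_num r
      have h2 : (s : ℝ) * s.den = s.num := by exact_mod_cast Rat.mul_den_eq_num s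
      ext
      · simp only [ivec, Prod.smul_fst, smul_eq_mul, ← hr]
        push_cast
        rw [← h1]
        ring
      · simp only [ivec, Prod.smul_snd, smul_eq_mul, ← hs]
        push_cast
        rw [← h2]
        ring
    obtain ⟨z, hz⟩ := periodic_of_rational F.continuous F.injective hF hnw hb hq hP
    exact ⟨z, _, hq, hz⟩
  · rintro ⟨z, q, hq, hz⟩
    obtain ⟨x, rfl⟩ := proj_surjective z
    rw [← (lift_iter hF q).1, proj_eq_iff] at hz
    obtain ⟨v, hv⟩ := hz
    have hq0 : (q : ℝ) ≠ 0 := by exact_mod_cast (by omega : q ≠ 0)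
    have hk : ∀ k : ℕ, (⇑F)^[q * k] x = x + ivec (k • v) := by
      intro k
      induction k with
      | zero => simp [ivec]
      | succ k ih =>
        rw [Nat.mul_succ, add_comm, Function.iterate_add_apply, ih, (lift_iter hF q).2, hv,
          add_assoc, ← ivec_add, succ_nsmul, add_comm v]
    have hbd : ∀ k : ℕ, (k : ℝ) * ‖ivec v - (q : ℝ) • ρ‖ ≤ C := by
      intro k
      have := hb x (q * k)
      rw [hk, add_sub_cancel_left, ivec_smul] at this
      have e : (k : ℝ) • ivec v - ((q * k : ℕ) : ℝ) • ρ = (k : ℝ) • (ivec v - (q : ℝ) • ρ) := by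
        rw [smul_sub, smul_smul]
        push_cast
        rw [mul_comm (q : ℝ)]
      rwa [e, norm_smul, Real.norm_natCast] at this
    have h0 : ivec v = (q : ℝ) • ρ := by
      by_contra hne
      have hpos : 0 < ‖ivec v - (q : ℝ) • ρ‖ := norm_pos_iff.2 (sub_ne_zero.2 hne)
      obtain ⟨k, hk⟩ := exists_nat_gt (C / ‖ivec v - (q : ℝ) • ρ‖)
      rw [div_lt_iff₀ hpos] at hk
      linarith [hbd k]
    have h1 := congrArg Prod.fst h0
    have h2 := congrArg Prod.snd h0
    simp only [ivec, Prod.smul_fst, Prod.smul_snd, smul_eq_mul] at h1 h2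
    refine ⟨⟨(v.1 : ℚ) / q, ?_⟩, ⟨(v.2 : ℚ) / q, ?_⟩⟩
    · push_cast
      rw [h1, mul_div_cancel_left₀ _ hq0]
    · push_cast
      rw [h2, mul_div_cancel_left₀ _ hq0]
end
end

section
/- For every totally irrational vector ρ ∈ ℝ² there exists a homeomorphism f : 𝕋² → 𝕋² homotopic to the identity which is a pseudo-rotation with rotation vector ρ and has the bounded mean motion property, but which is NOT semiconjugate to the rigid rotation R_ρ: no continuous surjection h : 𝕋² → 𝕋² satisfies h ∘ f = R_ρ ∘ h. -/
open Filter Topology Set Function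

noncomputable section

/-- `ρ = (ρ₁, ρ₂)` is totally irrational: `1, ρ₁, ρ₂` are linearly independent over ℚ. -/
def TotallyIrrational (ρ : ℝ × ℝ) : Prop :=
  ∀ q₀ q₁ q₂ : ℚ, (q₀ : ℝ) + (q₁ : ℝ) * ρ.1 + (q₂ : ℝ) * ρ.2 = 0 → q₀ = 0 ∧ q₁ = 0 ∧ q₂ = 0

/-- The rigid rotation `R_ρ` of the torus. -/
def Rrot (ρ : ℝ × ℝ) : T2 → T2 :=
  fun z => (z.1 + (ρ.1 : AddCircle (1 : ℝ)), z.2 + (ρ.2 : AddCircle (1 : ℝ)))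


theorem hs_congr {f g : ℤ → ℝ} {a : ℝ} (h : HasSum f a) (e : ∀ n, g n = f n) : HasSum g a := by
  have : g = f := funext e
  rwa [this]

structure DD (α : ℝ) (l : ℤ → ℝ) : Prop where
  irr : Irrational α
  pos : ∀ n, 0 < l n
  sum : HasSum l 1
  up : ∀ n, l (n + 1) ≤ 2 * l n
  dn : ∀ n, l n ≤ 2 * l (n + 1)

theorem exists_DD (α : ℝ) (h : Irrational α) : ∃ l, DD α l := by
  set w : ℤ → ℝ := fun n => (1 / 2 : ℝ) ^ n.natAbs with hw
  have hs : Summable w := by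
    apply Summable.of_nat_of_neg
    · simpa [hw] using summable_geometric_two
    · simpa [hw] using summable_geometric_two
  have hp : ∀ n, 0 < w n := fun n => by positivity
  have hW : 0 < ∑' n, w n := hs.tsum_pos (fun n => (hp n).le) 0 (hp 0)
  have key : ∀ n m : ℤ, n.natAbs ≤ m.natAbs + 1 → w m ≤ 2 * w n := by
    intro n m hnm
    have : (1 / 2 : ℝ) ^ (m.natAbs + 1) ≤ (1 / 2 : ℝ) ^ n.natAbs :=
      pow_le_pow_of_le_one (by norm_num) (by norm_num) hnm
    simp only [hw]
    rw [pow_succ] at this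
    linarith
  refine ⟨fun n => w n / ∑' n, w n, h, fun n => div_pos (hp n) hW, ?_, ?_, ?_⟩
  · have := hs.hasSum.div_const (∑' n, w n)
    rwa [div_self hW.ne'] at this
  · intro n
    rw [← mul_div_assoc]
    gcongr
    apply key
    omega
  · intro n
    rw [← mul_div_assoc]
    gcongr
    apply key
    omega

def Jf (α : ℝ) (l : ℤ → ℝ) (t : ℝ) : ℝ :=
  ∑' n : ℤ, l n * ((⌊t - n * α⌋ : ℝ) - (⌊-(n * α)⌋ : ℝ))

def Fl (e u : ℝ) : ℝ := ⌊u⌋ + max 0 (1 - (1 - Int.fract u) / e)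

def phi (α : ℝ) (l : ℤ → ℝ) (n : ℤ) (x : ℝ) : ℝ := Fl (l n) (x - Jf α l (n * α))

def Df (α : ℝ) (l : ℤ → ℝ) (x : ℝ) : ℝ :=
  x + Jf α l α + ∑' n : ℤ, (l (n + 1) - l n) * (phi α l n x - phi α l n 0)

namespace DD
variable {α : ℝ} {l : ℤ → ℝ}

theorem summ (h : DD α l) {a : ℤ → ℝ} {C : ℝ} (ha : ∀ n, |a n| ≤ C) :
    Summable (fun n => l n * a n) := by
  refine Summable.of_norm_bounded (h.sum.summable.mul_right C) fun n => ?_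
  rw [norm_mul, Real.norm_of_nonneg (h.pos n).le]
  exact mul_le_mul_of_nonneg_left (ha n) (h.pos n).le

theorem le_one (h : DD α l) (n : ℤ) : l n ≤ 1 := by
  exact le_hasSum h.sum n (fun m _ => (h.pos m).le)

theorem floor_bd (s t : ℝ) : |(⌊t⌋ : ℝ) - (⌊s⌋ : ℝ)| ≤ |t - s| + 1 := by
  have h1 := Int.floor_le t
  have h2 := Int.lt_floor_add_one t
  have h3 := Int.floor_le s
  have h4 := Int.lt_floor_add_one s
  have := le_abs_self (t - s)
  have := neg_abs_le (t - s)
  rw [abs_le]; constructor <;> linarith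

theorem summJ (h : DD α l) (t : ℝ) :
    Summable (fun n : ℤ => l n * ((⌊t - n * α⌋ : ℝ) - (⌊-(n * α)⌋ : ℝ))) := by
  refine h.summ (C := |t| + 1) fun n => ?_
  have := floor_bd (-(n * α)) (t - n * α)
  simpa using this

theorem J_zero : Jf α l 0 = 0 := by simp [Jf]

theorem J_sub (h : DD α l) (s t : ℝ) :
    HasSum (fun n : ℤ => l n * ((⌊t - n * α⌋ : ℝ) - (⌊s - n * α⌋ : ℝ))) (Jf α l t - Jf α l s) := by
  have := (h.summJ t).hasSum.sub (h.summJ s).hasSum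
  refine hs_congr this fun n => ?_
  ring

theorem J_add_int (h : DD α l) (t : ℝ) (m : ℤ) : Jf α l (t + m) = Jf α l t + m := by
  have h1 := h.J_sub t (t + m)
  have h2 : HasSum (fun n : ℤ => l n * ((⌊t + m - n * α⌋ : ℝ) - (⌊t - n * α⌋ : ℝ))) (1 * m) := by
    have := h.sum.mul_right (m : ℝ)
    refine hs_congr this fun n => ?_
    have : t + m - n * α = t - n * α + m := by ring
    rw [this, Int.floor_add_intCast]; push_cast; ring
  have := h1.unique h2
  linarith

theorem J_mono (h : DD α l) : Monotone (Jf α l) := by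
  intro s t hst
  have := (h.J_sub s t).nonneg fun (n : ℤ) => by
    have : ⌊s - n * α⌋ ≤ ⌊t - n * α⌋ := Int.floor_mono (by linarith)
    have h2 : (⌊s - n * α⌋ : ℝ) ≤ ⌊t - n * α⌋ := by exact_mod_cast this
    exact mul_nonneg (h.pos n).le (by linarith)
  linarith

theorem J_jump (h : DD α l) {s : ℝ} {k m : ℤ} (hs : s < k * α + m) :
    Jf α l s ≤ Jf α l (k * α) + m - l k := by
  rw [← h.J_add_int]
  have := le_hasSum (h.J_sub s (k * α + m)) k fun n _ => by
    have : ⌊s - n * α⌋ ≤ ⌊k * α + m - n * α⌋ := Int.floor_mono (by linarith)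
    have h2 : (⌊s - n * α⌋ : ℝ) ≤ ⌊k * α + m - n * α⌋ := by exact_mod_cast this
    exact mul_nonneg (h.pos n).le (by linarith)
  have h1 : ⌊(k * α + m - k * α : ℝ)⌋ = m := by
    rw [add_sub_cancel_left]; simp
  have h3 : ⌊s - k * α⌋ < m := by rw [Int.floor_lt]; linarith
  have h4 : (⌊s - k * α⌋ : ℝ) + 1 ≤ m := by exact_mod_cast h3
  rw [h1] at this
  nlinarith [h.pos k]

theorem J_bd (h : DD α l) (t : ℝ) : |Jf α l t - t| ≤ 1 := by
  have a1 := Int.floor_le t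
  have a2 := Int.lt_floor_add_one t
  have b1 := h.J_mono a1
  have b2 := h.J_mono a2.le
  have c1 := h.J_add_int 0 ⌊t⌋
  have c2 := h.J_add_int 0 (⌊t⌋ + 1)
  push_cast at c2
  rw [zero_add, J_zero] at c1 c2
  rw [abs_le]; constructor <;> linarith

theorem Fl_bd {e u : ℝ} (he : 0 < e) : |Fl e u - u| ≤ 1 := by
  have h1 := Int.fract_nonneg u
  have h2 := Int.fract_lt_one u
  have h3 := Int.floor_add_fract u
  have h4 : 0 ≤ (1 - Int.fract u) / e := div_nonneg (by linarith) he.le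
  have : max 0 (1 - (1 - Int.fract u) / e) ≤ 1 := max_le (by norm_num) (by linarith)
  have : 0 ≤ max 0 (1 - (1 - Int.fract u) / e) := le_max_left _ _
  rw [abs_le, Fl]; constructor <;> linarith

theorem Fl_add_int (e u : ℝ) (m : ℤ) : Fl e (u + m) = Fl e u + m := by
  simp [Fl]; ring

theorem Fl_cont {e : ℝ} (he : 0 < e) (he1 : e ≤ 1) : Continuous (Fl e) := by
  have h1 : Continuous ((fun v : ℝ => max 0 (1 - (1 - v) / e) - v) ∘ Int.fract) := by
    apply ContinuousOn.comp_fract''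
    · fun_prop
    · have : 1 ≤ 1 / e := by rw [le_div_iff₀ he]; linarith
      simp at this ⊢
      exact this
  have : Fl e = fun u => u + ((fun v : ℝ => max 0 (1 - (1 - v) / e) - v) ∘ Int.fract) u := by
    funext u
    have h3 := Int.floor_add_fract u
    simp only [Fl, comp]; linarith
  rw [this]
  fun_prop

theorem phi_add_int (n : ℤ) (x : ℝ) (m : ℤ) : phi α l n (x + m) = phi α l n x + m := by
  rw [phi, phi, ← Fl_add_int]; ring_nf

theorem phi_cont (h : DD α l) (n : ℤ) : Continuous (phi α l n) :=
  (Fl_cont (h.pos n) (h.le_one n)).comp (by fun_prop)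

theorem phi_bd (h : DD α l) (n : ℤ) (x y : ℝ) : |phi α l n x - phi α l n y| ≤ |x - y| + 2 := by
  have h1 := abs_le.1 (Fl_bd (u := x - Jf α l (n * α)) (h.pos n))
  have h2 := abs_le.1 (Fl_bd (u := y - Jf α l (n * α)) (h.pos n))
  have := le_abs_self (x - y)
  have := neg_abs_le (x - y)
  rw [abs_le, phi, phi]; constructor <;> linarith

theorem phi_eq (h : DD α l) {n m : ℤ} {x : ℝ} (h1 : Jf α l (n * α) + m ≤ x)
    (h2 : x ≤ Jf α l (n * α) + m + 1 - l n) : phi α l n x = m := by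
  have hp := h.pos n
  have hf : ⌊x - Jf α l (n * α)⌋ = m := by rw [Int.floor_eq_iff]; constructor <;> linarith
  have : 1 ≤ (1 - Int.fract (x - Jf α l (n * α))) / l n := by
    rw [le_div_iff₀ hp, Int.fract, hf]; linarith
  rw [phi, Fl, max_eq_left (by linarith), hf, add_zero]

theorem phi_gap (h : DD α l) (n : ℤ) {s : ℝ} (h0 : 0 ≤ s) (h1 : s ≤ 1) :
    phi α l n (Jf α l (n * α) - s * l n) = -s := by
  have hp := h.pos n
  have hl := h.le_one n
  rcases h0.eq_or_lt with rfl | h0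
  · have := h.phi_eq (n := n) (m := 0) (x := Jf α l (n * α) - 0 * l n) (by simp) (by push_cast; linarith)
    simpa using this
  · have hu : Jf α l (n * α) - s * l n - Jf α l (n * α) = - (s * l n) := by ring
    have hf : ⌊-(s * l n)⌋ = -1 := by
      rw [Int.floor_eq_iff]; push_cast; constructor <;> nlinarith
    have : (1 - Int.fract (-(s * l n))) / l n = s := by
      rw [Int.fract, hf]; push_cast; field_simp; ring
    rw [phi, hu, Fl, this, max_eq_right (by linarith), hf]
    push_cast; ring

theorem phi_J (h : DD α l) (n : ℤ) (t : ℝ) : phi α l n (Jf α l t) = ⌊t - n * α⌋ := by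
  have a1 := Int.floor_le (t - n * α)
  have a2 := Int.lt_floor_add_one (t - n * α)
  apply h.phi_eq
  · rw [← h.J_add_int]; apply h.J_mono; linarith
  · have := h.J_jump (s := t) (k := n) (m := ⌊t - n * α⌋ + 1) (by push_cast; linarith)
    push_cast at this
    linarith

theorem orb_ne (h : DD α l) {n k : ℤ} (hnk : n ≠ k) (m m' : ℤ) : (n * α + m : ℝ) ≠ k * α + m' := by
  intro he
  apply h.irr
  have : ((n - k : ℤ) : ℝ) ≠ 0 := by exact_mod_cast sub_ne_zero.2 hnk
  refine ⟨((m' - m : ℤ) : ℚ) / ((n - k : ℤ) : ℚ), ?_⟩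
  push_cast at this ⊢
  rw [div_eq_iff this]; linarith

theorem phi_gap_ne (h : DD α l) {n k : ℤ} (hnk : n ≠ k) {s : ℝ} (h0 : 0 ≤ s) (h1 : s ≤ 1) :
    phi α l n (Jf α l (k * α) - s * l k) = ⌊k * α - n * α⌋ := by
  have a1 := Int.floor_le (k * α - n * α)
  have a2 := Int.lt_floor_add_one (k * α - n * α)
  have hp := h.pos k
  set m := ⌊k * α - n * α⌋ with hm
  have hne := h.orb_ne hnk m 0
  push_cast at hne
  have hlt : (n * α + m : ℝ) < k * α := lt_of_le_of_ne (by linarith) (by simpa using hne)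
  apply h.phi_eq
  · rw [← h.J_add_int]
    have := h.J_jump (s := n * α + m) (k := k) (m := 0) (by simpa using hlt)
    push_cast at this
    nlinarith
  · have := h.J_jump (s := k * α) (k := n) (m := m + 1) (by push_cast; linarith)
    push_cast at this
    nlinarith

/-- At most one gap contains a given point. -/
theorem gap_unique (h : DD α l) {n k : ℤ} {x : ℝ} (h1 : 1 - l n ≤ Int.fract (x - Jf α l (n * α)))
    (h2 : 1 - l k ≤ Int.fract (x - Jf α l (k * α))) : n = k := by
  by_contra hnk
  have key : ∀ n k : ℤ, 1 - l n ≤ Int.fract (x - Jf α l (n * α)) →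
      1 - l k ≤ Int.fract (x - Jf α l (k * α)) →
      (n * α + (⌊x - Jf α l (n * α)⌋ + 1 : ℤ) : ℝ) < k * α + (⌊x - Jf α l (k * α)⌋ + 1 : ℤ) → False := by
    intro n k h1 h2 hlt
    have := h.J_jump hlt
    rw [h.J_add_int] at this
    have e1 := Int.floor_add_fract (x - Jf α l (n * α))
    have e2 := Int.floor_add_fract (x - Jf α l (k * α))
    have e3 := Int.fract_lt_one (x - Jf α l (n * α))
    push_cast at this
    linarith
  rcases lt_or_gt_of_ne (h.orb_ne hnk (⌊x - Jf α l (n * α)⌋ + 1) (⌊x - Jf α l (k * α)⌋ + 1)) with hh | hh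
  · exact key _ _ h1 h2 hh
  · exact key _ _ h2 h1 hh

theorem Fl_deriv {e : ℝ} (he : 0 < e) (u : ℝ) :
    HasDerivWithinAt (fun v => e * Fl e v) (if 1 - e ≤ Int.fract u then 1 else 0) (Ici u) u := by
  have h3 := Int.floor_add_fract u
  have hfl : ∀ᶠ v in 𝓝[≥] u, ⌊v⌋ = ⌊u⌋ := by
    have : Iio ((⌊u⌋ : ℝ) + 1) ∈ 𝓝 u := Iio_mem_nhds (Int.lt_floor_add_one u)
    filter_upwards [mem_nhdsWithin_of_mem_nhds this, self_mem_nhdsWithin] with v hv hu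
    rw [Int.floor_eq_iff]
    exact ⟨(Int.floor_le u).trans hu, hv⟩
  split_ifs with hc
  · have hd : HasDerivWithinAt (fun v : ℝ => v + (e * ⌊u⌋ + e - 1 - ⌊u⌋)) 1 (Ici u) u :=
      (hasDerivWithinAt_id u _).add_const _
    have : (fun v => e * Fl e v) =ᶠ[𝓝[≥] u] (fun v : ℝ => v + (e * ⌊u⌋ + e - 1 - ⌊u⌋)) := by
      filter_upwards [hfl, self_mem_nhdsWithin] with v hv hu
      have hu : u ≤ v := hu
      have : (1 - Int.fract v) / e ≤ 1 := by
        rw [div_le_one he, Int.fract, hv]; linarith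
      simp only [Fl]
      rw [max_eq_right (by linarith), Int.fract, hv]
      field_simp
      ring
    exact hd.congr_of_eventuallyEq this (this.eq_of_nhdsWithin (mem_Ici.2 le_rfl))
  · have hd : HasDerivWithinAt (fun v : ℝ => (e * ⌊u⌋ : ℝ)) 0 (Ici u) u :=
      hasDerivWithinAt_const _ _ _
    have h5 : Iio ((⌊u⌋ : ℝ) + 1 - e) ∈ 𝓝 u := Iio_mem_nhds (by linarith)
    have : (fun v => e * Fl e v) =ᶠ[𝓝[≥] u] (fun v : ℝ => (e * ⌊u⌋ : ℝ)) := by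
      filter_upwards [hfl, mem_nhdsWithin_of_mem_nhds h5] with v hv hu
      have hu : v < ((⌊u⌋ : ℝ) + 1 - e) := hu
      have : 1 ≤ (1 - Int.fract v) / e := by
        rw [one_le_div he, Int.fract, hv]; linarith
      simp only [Fl]
      rw [max_eq_left (by linarith), hv]
      ring
    exact hd.congr_of_eventuallyEq this (this.eq_of_nhdsWithin (mem_Ici.2 le_rfl))

theorem phi_deriv (h : DD α l) (n : ℤ) (x : ℝ) :
    HasDerivWithinAt (fun v => l n * phi α l n v)
      (if 1 - l n ≤ Int.fract (x - Jf α l (n * α)) then 1 else 0) (Ici x) x := by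
  have h1 := Fl_deriv (h.pos n) (x - Jf α l (n * α))
  have h2 : HasDerivWithinAt (fun v => v - Jf α l (n * α)) 1 (Ici x) x :=
    (hasDerivWithinAt_id x _).sub_const _
  have := HasDerivWithinAt.comp x h1 h2 (fun v hv => by
    simp only [mem_Ici] at hv ⊢; linarith)
  simpa [phi, comp_def] using this

theorem phi_mono (h : DD α l) (n : ℤ) : Monotone (phi α l n) := by
  intro x y hxy
  have := image_le_of_deriv_right_le_deriv_boundary (f := fun _ => l n * phi α l n x) (a := x) (b := y)
    (f' := fun _ => 0)
    (B := fun v => l n * phi α l n v)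
    (B' := fun x => (if 1 - l n ≤ Int.fract (x - Jf α l (n * α)) then 1 else 0))
    continuousOn_const (fun _ _ => hasDerivWithinAt_const _ _ _) le_rfl
    ((continuous_const.mul (h.phi_cont n)).continuousOn)
    (fun z _ => h.phi_deriv n z) (fun z _ => by split_ifs <;> norm_num) (right_mem_Icc.2 hxy)
  exact le_of_mul_le_mul_left this (h.pos n)

theorem sum_phi_le (h : DD α l) (S : Finset ℤ) {x y : ℝ} (hxy : x ≤ y) :
    ∑ n ∈ S, l n * (phi α l n y - phi α l n x) ≤ y - x := by
  have := image_le_of_deriv_right_le_deriv_boundary (a := x) (b := y)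
    (f := fun v => ∑ n ∈ S, l n * phi α l n v)
    (f' := fun x => ∑ n ∈ S, (if 1 - l n ≤ Int.fract (x - Jf α l (n * α)) then 1 else 0))
    (B := fun v => (∑ n ∈ S, l n * phi α l n x) + (v - x))
    (B' := fun _ => 1)
    (Continuous.continuousOn (continuous_finsetSum _ fun n _ => continuous_const.mul (h.phi_cont n)))
    (fun z _ => HasDerivWithinAt.fun_sum fun n _ => h.phi_deriv n z) (by simp)
    (by fun_prop)
    (fun z _ => ((hasDerivWithinAt_id z _).sub_const _).const_add _) (fun z _ => by
      rw [← Finset.sum_filter, Finset.sum_const, nsmul_eq_mul, mul_one]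
      have : (S.filter fun n => 1 - l n ≤ Int.fract (z - Jf α l (n * α))).card ≤ 1 := by
        rw [Finset.card_le_one]
        intro a ha b hb
        exact h.gap_unique (Finset.mem_filter.1 ha).2 (Finset.mem_filter.1 hb).2
      exact_mod_cast this) (right_mem_Icc.2 hxy)
  simp only [mul_sub, Finset.sum_sub_distrib] at this ⊢
  linarith

theorem summ_phi (h : DD α l) (x y : ℝ) :
    Summable (fun n : ℤ => l n * (phi α l n y - phi α l n x)) :=
  h.summ (C := |y - x| + 2) fun n => h.phi_bd n y x

theorem summ_phi' (h : DD α l) (x y : ℝ) :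
    Summable (fun n : ℤ => l (n + 1) * (phi α l n y - phi α l n x)) := by
  refine Summable.of_norm_bounded ((h.sum.summable.mul_left 2).mul_right (|y - x| + 2)) fun n => ?_
  rw [norm_mul, Real.norm_of_nonneg (h.pos _).le]
  exact mul_le_mul (h.up n) (h.phi_bd n y x) (abs_nonneg _) (by have := h.pos n; positivity)

theorem D_sub (h : DD α l) (x y : ℝ) :
    HasSum (fun n : ℤ => (l (n + 1) - l n) * (phi α l n y - phi α l n x))
      (Df α l y - Df α l x - (y - x)) := by
  have hs : ∀ z, Summable (fun n : ℤ => (l (n + 1) - l n) * (phi α l n z - phi α l n 0)) := by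
    intro z
    refine ((h.summ_phi' 0 z).sub (h.summ_phi 0 z)).congr fun n => by ring
  have := (hs y).hasSum.sub (hs x).hasSum
  have e : Df α l y - Df α l x - (y - x) =
    ∑' n : ℤ, (l (n + 1) - l n) * (phi α l n y - phi α l n 0) -
    ∑' n : ℤ, (l (n + 1) - l n) * (phi α l n x - phi α l n 0) := by
    simp only [Df]; ring
  rw [e]
  refine hs_congr this fun n => ?_
  ring

theorem D_bounds (h : DD α l) {x y : ℝ} (hxy : x ≤ y) :
    (y - x) / 2 ≤ Df α l y - Df α l x ∧ Df α l y - Df α l x ≤ 2 * (y - x) := by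
  have h1 := (h.summ_phi x y).hasSum
  have h2 : ∑' n : ℤ, l n * (phi α l n y - phi α l n x) ≤ y - x :=
    (h.summ_phi x y).tsum_le_of_sum_le fun S => h.sum_phi_le S hxy
  have h3 := h.D_sub x y
  have hm : ∀ n, 0 ≤ phi α l n y - phi α l n x := fun n => sub_nonneg.2 (h.phi_mono n hxy)
  have h4 := hasSum_le (fun n => by
    have := h.up n
    exact mul_le_mul_of_nonneg_right (by linarith : l (n + 1) - l n ≤ l n) (hm n)) h3 h1
  have h5 := hasSum_le (fun n => by
    have := h.dn n
    have := mul_le_mul_of_nonneg_right (by linarith : - (1 / 2) * l n ≤ l (n + 1) - l n) (hm n)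
    rwa [mul_assoc] at this) (h1.mul_left (-(1 / 2))) h3
  constructor <;> linarith

theorem D_strictMono (h : DD α l) : StrictMono (Df α l) := by
  intro x y hxy
  have := (h.D_bounds hxy.le).1
  linarith

theorem D_cont (h : DD α l) : Continuous (Df α l) := by
  have : LipschitzWith 2 (Df α l) := by
    apply LipschitzWith.of_le_add_mul
    intro x y
    rcases le_total x y with hxy | hxy
    · have := (h.D_bounds hxy).1
      have : 0 ≤ ((2 : NNReal) : ℝ) * dist x y := by positivity
      linarith
    · have := (h.D_bounds hxy).2
      rw [Real.dist_eq, abs_of_nonneg (by linarith)]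
      push_cast; linarith
  exact this.continuous

theorem D_add_int (h : DD α l) (x : ℝ) (m : ℤ) : Df α l (x + m) = Df α l x + m := by
  have h1 := h.D_sub x (x + m)
  have h2 : HasSum (fun n : ℤ => (l (n + 1) - l n) * (phi α l n (x + m) - phi α l n x)) ((1 - 1) * m) := by
    have hs : HasSum (fun n => l (n + 1)) 1 := (Equiv.hasSum_iff (Equiv.addRight (1 : ℤ))).2 h.sum
    have := (hs.sub h.sum).mul_right (m : ℝ)
    refine hs_congr this fun n => ?_
    rw [phi_add_int]; ring
  have := h1.unique h2
  linarith

theorem D_surj (h : DD α l) : Function.Surjective (Df α l) := by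
  apply h.D_cont.surjective
  · refine tendsto_atTop_mono' _ ?_ (tendsto_atTop_add_const_right atTop (Df α l 0)
      (tendsto_id.atTop_div_const (by norm_num : (0 : ℝ) < 2)))
    filter_upwards [eventually_ge_atTop (0 : ℝ)] with x hx
    have := (h.D_bounds hx).1
    simp only [id]; linarith
  · refine tendsto_atBot_mono' _ ?_ (tendsto_atBot_add_const_right atBot (Df α l 0)
      (tendsto_id.atBot_div_const (by norm_num : (0 : ℝ) < 2)))
    filter_upwards [eventually_le_atBot (0 : ℝ)] with x hx
    have := (h.D_bounds hx).1
    simp only [id]; linarith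

theorem D_J (h : DD α l) (t : ℝ) : Df α l (Jf α l t) = Jf α l (t + α) := by
  have h1 := h.D_sub (Jf α l 0) (Jf α l t)
  have h2 : HasSum (fun n : ℤ => l (n + 1) * ((⌊t - n * α⌋ : ℝ) - (⌊0 - n * α⌋ : ℝ)))
      (Jf α l (t + α) - Jf α l α) := by
    have := (Equiv.hasSum_iff (Equiv.addRight (1 : ℤ))).2 (h.J_sub α (t + α))
    refine hs_congr this fun n => ?_
    simp only [comp, Equiv.coe_addRight]
    push_cast
    ring_nf
  have h3 := h2.sub (h.J_sub 0 t)
  have h4 : Df α l 0 = Jf α l α := by simp [Df]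
  have := h1.unique (by
    refine hs_congr h3 fun n => ?_
    rw [h.phi_J, h.phi_J]; ring)
  rw [J_zero, h4] at this
  linarith

/-- The `k`-th gap, parametrised by `s ∈ [0,1]`. -/
theorem D_gap (h : DD α l) (k : ℤ) {s : ℝ} (h0 : 0 ≤ s) (h1 : s ≤ 1) :
    Df α l (Jf α l (k * α) - s * l k) = Jf α l ((k + 1 : ℤ) * α) - s * l (k + 1) := by
  have e := h.D_sub (Jf α l (k * α)) (Jf α l (k * α) - s * l k)
  have e2 := hasSum_single (f := fun n : ℤ => (l (n + 1) - l n) *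
    (phi α l n (Jf α l (k * α) - s * l k) - phi α l n (Jf α l (k * α)))) k (fun n hn => by
      rw [h.phi_gap_ne hn h0 h1, h.phi_J]; ring)
  have := e.unique e2
  rw [h.phi_gap k h0 h1, h.phi_J, h.D_J] at this
  have e3 : ((k + 1 : ℤ) * α : ℝ) = k * α + α := by push_cast; ring
  rw [e3]
  simp at this
  linarith

end DD

def tau (α : ℝ) (l : ℤ → ℝ) (x : ℝ) : ℝ := Real.sin (Real.pi * phi α l 0 x) ^ 2

/-- Point with parameter `s` in the `k`-th gap. -/
def gp (α : ℝ) (l : ℤ → ℝ) (k : ℤ) (s : ℝ) : ℝ := Jf α l (k * α) - s * l k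

theorem sin_pi_int (m : ℤ) : Real.sin (Real.pi * m) = 0 := by
  rw [mul_comm]; exact Real.sin_int_mul_pi m

namespace DD
variable {α : ℝ} {l : ℤ → ℝ}

theorem tau_nonneg (x : ℝ) : 0 ≤ tau α l x := sq_nonneg _

theorem tau_le_one (x : ℝ) : tau α l x ≤ 1 := Real.sin_sq_le_one _

theorem tau_cont (h : DD α l) : Continuous (tau α l) := by
  have := h.phi_cont 0
  unfold tau
  fun_prop

theorem tau_add_int (x : ℝ) (m : ℤ) : tau α l (x + m) = tau α l x := by
  rw [tau, tau, phi_add_int, mul_add, Real.sin_add, sin_pi_int, mul_zero, add_zero, mul_pow,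
    mul_comm Real.pi (m : ℝ), Real.cos_sq', Real.sin_int_mul_pi]
  simp

theorem tau_J (h : DD α l) (t : ℝ) : tau α l (Jf α l t) = 0 := by
  rw [tau, h.phi_J, sin_pi_int]; norm_num

theorem tau_gp_ne (h : DD α l) {k : ℤ} (hk : k ≠ 0) {s : ℝ} (h0 : 0 ≤ s) (h1 : s ≤ 1) :
    tau α l (gp α l k s) = 0 := by
  rw [tau, gp, h.phi_gap_ne hk.symm h0 h1, sin_pi_int]; norm_num

theorem tau_gp_zero (h : DD α l) {s : ℝ} (h0 : 0 ≤ s) (h1 : s ≤ 1) :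
    tau α l (gp α l 0 s) = Real.sin (Real.pi * s) ^ 2 := by
  rw [tau, gp, h.phi_gap 0 h0 h1, mul_neg, Real.sin_neg]; ring

theorem tau_ne (h : DD α l) {x : ℝ} (hx : tau α l x ≠ 0) :
    ∃ (s : ℝ) (m : ℤ), 0 ≤ s ∧ s ≤ 1 ∧ x = gp α l 0 s + m := by
  have hp := h.pos 0
  have a1 := Int.floor_le x
  have a2 := Int.lt_floor_add_one x
  have e : Jf α l ((0 : ℤ) * α) = 0 := by rw [Int.cast_zero, zero_mul, J_zero]
  refine ⟨(⌊x⌋ + 1 - x) / l 0, ⌊x⌋ + 1, div_nonneg (by linarith) hp.le, ?_, ?_⟩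
  · by_contra hc
    push Not at hc
    rw [lt_div_iff₀ hp] at hc
    apply hx
    rw [tau, h.phi_eq (m := ⌊x⌋) (by rw [e]; linarith) (by rw [e]; linarith), sin_pi_int]
    norm_num
  · rw [gp, e]; field_simp; push_cast; ring

def Dh (h : DD α l) : ℝ ≃ₜ ℝ :=
  (h.D_strictMono.orderIsoOfSurjective _ h.D_surj).toHomeomorph

theorem Dh_apply (h : DD α l) (x : ℝ) : h.Dh x = Df α l x := rfl

theorem Dh_gp (h : DD α l) (k : ℤ) {s : ℝ} (h0 : 0 ≤ s) (h1 : s ≤ 1) (m : ℤ) :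
    h.Dh (gp α l k s + m) = gp α l (k + 1) s + m := by
  rw [Dh_apply, h.D_add_int, gp, h.D_gap k h0 h1, gp]

theorem Dh_gp_iter (h : DD α l) (k : ℤ) {s : ℝ} (h0 : 0 ≤ s) (h1 : s ≤ 1) (m : ℤ) (j : ℕ) :
    h.Dh^[j] (gp α l k s + m) = gp α l (k + j) s + m := by
  induction j with
  | zero => simp
  | succ j ih => rw [iterate_succ_apply', ih, h.Dh_gp _ h0 h1]; push_cast; ring_nf

theorem tau_once (h : DD α l) {x : ℝ} (hx : tau α l x ≠ 0) {j : ℕ} (hj : j ≠ 0) :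
    tau α l (h.Dh^[j] x) = 0 := by
  obtain ⟨s, m, h0, h1, rfl⟩ := h.tau_ne hx
  rw [h.Dh_gp_iter 0 h0 h1, tau_add_int]
  exact h.tau_gp_ne (by simpa using hj) h0 h1

theorem tau_back (h : DD α l) (x : ℝ) :
    ∃ j0 : ℕ, ∀ j, j ≠ j0 → tau α l (h.Dh.symm^[j] x) = 0 := by
  by_cases hc : ∃ j0, tau α l (h.Dh.symm^[j0] x) ≠ 0
  · have key : ∀ i j : ℕ, i < j → tau α l (h.Dh.symm^[i] x) ≠ 0 →
        tau α l (h.Dh.symm^[j] x) ≠ 0 → False := by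
      intro i j hij hi hj
      apply hi
      have := h.tau_once hj (j := j - i) (by omega)
      rw [← this]
      congr 1
      obtain ⟨d, rfl⟩ := Nat.exists_eq_add_of_lt hij
      have e : i + d + 1 - i = d + 1 := by omega
      have e2 : i + d + 1 = (d + 1) + i := by omega
      rw [e, e2, iterate_add_apply (⇑h.Dh.symm) (d + 1) i x]
      exact ((LeftInverse.iterate h.Dh.apply_symm_apply (d + 1)) _).symm
    obtain ⟨j0, hj0⟩ := hc
    refine ⟨j0, fun j hj => ?_⟩
    by_contra hne
    rcases lt_or_gt_of_ne hj with hh | hh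
    · exact key _ _ hh hne hj0
    · exact key _ _ hh hj0 hne
  · push Not at hc
    exact ⟨0, fun j _ => hc j⟩

def uf (h : DD α l) (x : ℝ) : ℝ := ∑' j : ℕ, tau α l (h.Dh.symm^[j + 1] x)

theorem tau_summable (h : DD α l) (x : ℝ) : Summable fun j : ℕ => tau α l (h.Dh.symm^[j] x) := by
  obtain ⟨j0, hj⟩ := h.tau_back x
  exact (hasSum_single j0 hj).summable

theorem tau_tsum_le (h : DD α l) (x : ℝ) : ∑' j : ℕ, tau α l (h.Dh.symm^[j] x) ≤ 1 := by
  obtain ⟨j0, hj⟩ := h.tau_back x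
  rw [tsum_eq_single j0 hj]
  exact tau_le_one _

theorem tau_tsum (h : DD α l) (x : ℝ) :
    ∑' j : ℕ, tau α l (h.Dh.symm^[j] x) = tau α l x + h.uf x := by
  rw [(h.tau_summable x).tsum_eq_zero_add]; rfl

theorem uf_D (h : DD α l) (x : ℝ) : h.uf (h.Dh x) = tau α l x + h.uf x := by
  rw [← h.tau_tsum, uf]
  simp [iterate_succ_apply]

theorem uf_bd (h : DD α l) (x : ℝ) : |h.uf x| ≤ 1 := by
  have h1 := h.tau_tsum_le x
  rw [h.tau_tsum] at h1
  have h2 : 0 ≤ h.uf x := tsum_nonneg fun j => tau_nonneg _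
  have h3 : 0 ≤ tau α l x := tau_nonneg x
  rw [abs_le]; constructor <;> linarith

theorem V_lub (h : DD α l) (x : ℝ) : IsLUB {t | Jf α l t ≤ x} (sSup {t | Jf α l t ≤ x}) := by
  apply isLUB_csSup
  · refine ⟨x - 1, ?_⟩
    have := abs_le.1 (h.J_bd (x - 1))
    simp only [mem_ofPred_eq]; linarith
  · refine ⟨x + 1, fun t ht => ?_⟩
    have := abs_le.1 (h.J_bd t)
    simp only [mem_ofPred_eq] at ht; linarith

theorem V_bd (h : DD α l) (x : ℝ) : |sSup {t | Jf α l t ≤ x} - x| ≤ 1 := by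
  have hl := h.V_lub x
  have h1 : x - 1 ≤ sSup {t | Jf α l t ≤ x} := hl.1 (by
    have := abs_le.1 (h.J_bd (x - 1))
    simp only [mem_ofPred_eq]; linarith)
  have h2 : sSup {t | Jf α l t ≤ x} ≤ x + 1 := hl.2 fun t ht => by
    have := abs_le.1 (h.J_bd t)
    simp only [mem_ofPred_eq] at ht; linarith
  rw [abs_le]; constructor <;> linarith

theorem V_D (h : DD α l) (x : ℝ) :
    sSup {t | Jf α l t ≤ h.Dh x} = sSup {t | Jf α l t ≤ x} + α := by
  have key : ∀ t, Jf α l t ≤ h.Dh x ↔ Jf α l (t - α) ≤ x := by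
    intro t
    have := h.D_J (t - α)
    rw [sub_add_cancel] at this
    rw [← this, Dh_apply, h.D_strictMono.le_iff_le]
  have hl := h.V_lub x
  refine (h.V_lub (h.Dh x)).unique ⟨fun t ht => ?_, fun b hb => ?_⟩
  · have : t - α ≤ _ := hl.1 ((key t).1 ht)
    linarith
  · have : sSup {t | Jf α l t ≤ x} ≤ b - α := hl.2 fun t ht => by
      have : t + α ≤ b := hb ((key (t + α)).2 (by simpa using ht))
      linarith
    linarith

/-- The lifted torus homeomorphism. -/
def Fh (h : DD α l) (β : ℝ) : (ℝ × ℝ) ≃ₜ (ℝ × ℝ) where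
  toFun p := (h.Dh p.1, p.2 + β + tau α l p.1)
  invFun p := (h.Dh.symm p.1, p.2 - β - tau α l (h.Dh.symm p.1))
  left_inv p := by
    ext
    · simp
    · simp only [Homeomorph.symm_apply_apply]; ring
  right_inv p := by
    ext
    · simp
    · simp only [Homeomorph.symm_apply_apply]; ring
  continuous_toFun := by
    have := h.tau_cont
    have := h.Dh.continuous
    fun_prop
  continuous_invFun := by
    have := h.tau_cont
    have := h.Dh.symm.continuous
    fun_prop

def Vf (h : DD α l) (p : ℝ × ℝ) : ℝ × ℝ := (sSup {t | Jf α l t ≤ p.1}, p.2 - h.uf p.1)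

theorem Vf_F (h : DD α l) (β : ℝ) (p : ℝ × ℝ) : h.Vf (h.Fh β p) = h.Vf p + (α, β) := by
  have e1 : (h.Fh β p).1 = h.Dh p.1 := rfl
  have e2 : (h.Fh β p).2 = p.2 + β + tau α l p.1 := rfl
  ext
  · simp only [Vf, e1, h.V_D, Prod.fst_add]
  · simp only [Vf, e1, e2, h.uf_D, Prod.snd_add]; ring

theorem Vf_bd (h : DD α l) (p : ℝ × ℝ) : ‖h.Vf p - p‖ ≤ 1 := by
  rw [Prod.norm_def, max_le_iff]
  refine ⟨h.V_bd p.1, ?_⟩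
  have : (h.Vf p - p).2 = - h.uf p.1 := by simp [Vf]
  rw [this, norm_neg]
  exact h.uf_bd p.1

theorem bmm (h : DD α l) (β : ℝ) (p : ℝ × ℝ) (n : ℤ) :
    ‖hIter (h.Fh β) n p - p - (n : ℝ) • ((α, β) : ℝ × ℝ)‖ ≤ 2 := by
  have hV : h.Vf (hIter (h.Fh β) n p) = h.Vf p + (n : ℝ) • ((α, β) : ℝ × ℝ) := by
    have hinv : ∀ p, h.Vf ((h.Fh β).symm p) = h.Vf p - (α, β) := fun p => by
      have := h.Vf_F β ((h.Fh β).symm p)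
      rw [Homeomorph.apply_symm_apply] at this
      rw [this]; abel
    cases n with
    | ofNat n =>
      simp only [hIter, Int.ofNat_eq_natCast, Int.cast_natCast]
      induction n with
      | zero => simp
      | succ n ih => rw [iterate_succ_apply', h.Vf_F, ih]; push_cast; rw [add_smul, one_smul, add_assoc]
    | negSucc n =>
      simp only [hIter, Int.cast_negSucc]
      induction n with
      | zero => simp [hinv, sub_eq_add_neg]
      | succ n ih =>
        rw [iterate_succ_apply', hinv, ih]; push_cast; module
  have e : hIter (h.Fh β) n p - p - (n : ℝ) • ((α, β) : ℝ × ℝ) =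
      (h.Vf p - p) - (h.Vf (hIter (h.Fh β) n p) - hIter (h.Fh β) n p) := by
    rw [hV]; abel
  rw [e]
  refine (norm_sub_le _ _).trans ?_
  have := h.Vf_bd p
  have := h.Vf_bd (hIter (h.Fh β) n p)
  linarith

theorem pseudo (h : DD α l) (β : ℝ) : IsPseudoRotation (h.Fh β) (α, β) := by
  intro p
  rw [tendsto_iff_norm_sub_tendsto_zero]
  have ht : Tendsto (fun n : ℕ => ((n : ℝ))⁻¹ * 2) atTop (𝓝 0) := by
    simpa using (tendsto_inv_atTop_nhds_zero_nat (𝕜 := ℝ)).mul_const 2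
  refine squeeze_zero' (Eventually.of_forall fun _ => norm_nonneg _) ?_ ht
  filter_upwards [eventually_gt_atTop 0] with n hn
  have hn' : (n : ℝ) ≠ 0 := by positivity
  have := h.bmm β p (n : ℤ)
  have e : ((n : ℝ))⁻¹ • ((h.Fh β)^[n] p - p) - ((α, β) : ℝ × ℝ) =
      ((n : ℝ))⁻¹ • ((h.Fh β)^[n] p - p - (n : ℝ) • ((α, β) : ℝ × ℝ)) := by
    rw [smul_sub _ _ ((n : ℝ) • ((α, β) : ℝ × ℝ)), smul_smul, inv_mul_cancel₀ hn', one_smul]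
  rw [e, norm_smul, Real.norm_of_nonneg (by positivity)]
  gcongr
  simpa [hIter] using this

end DD

theorem exists_lift {X : Type*} [TopologicalSpace X] (g : ℝ → X) (hg : Continuous g)
    (hp : ∀ (x : ℝ) (m : ℤ), g (x + m) = g x) :
    ∃ G : AddCircle (1 : ℝ) → X, Continuous G ∧ ∀ x : ℝ, G x = g x := by
  have hper : Function.Periodic g 1 := fun x => by simpa using hp x 1
  exact ⟨hper.lift, continuous_coinduced_dom.2 hg, fun x => hper.lift_coe x⟩

namespace DD
variable {α : ℝ} {l : ℤ → ℝ}

theorem coe_add_int (x : ℝ) (m : ℤ) : ((x + m : ℝ) : AddCircle (1 : ℝ)) = x := by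
  rw [AddCircle.coe_add]
  have : ((m : ℝ) : AddCircle (1 : ℝ)) = 0 := by
    rw [AddCircle.coe_eq_zero_iff]; exact ⟨m, by simp⟩
  rw [this, add_zero]

theorem exists_f (h : DD α l) (β : ℝ) : ∃ f : T2 ≃ₜ T2, IsLift f (h.Fh β) := by
  have hDi : ∀ (x : ℝ) (m : ℤ), h.Dh.symm (x + m) = h.Dh.symm x + m := by
    intro x m
    rw [Homeomorph.symm_apply_eq, Dh_apply, h.D_add_int, ← Dh_apply h, Homeomorph.apply_symm_apply]
  obtain ⟨d, hd, hd'⟩ := exists_lift (X := AddCircle (1 : ℝ)) (fun x => ((h.Dh x : ℝ) : AddCircle (1 : ℝ)))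
    ((AddCircle.continuous_mk' 1).comp h.Dh.continuous)
    (fun x m => by rw [Dh_apply, h.D_add_int, coe_add_int]; rfl)
  obtain ⟨e, he, he'⟩ := exists_lift (X := AddCircle (1 : ℝ)) (fun x => ((h.Dh.symm x : ℝ) : AddCircle (1 : ℝ)))
    ((AddCircle.continuous_mk' 1).comp h.Dh.symm.continuous)
    (fun x m => by rw [hDi, coe_add_int])
  obtain ⟨t, ht, ht'⟩ := exists_lift (X := AddCircle (1 : ℝ)) (fun x => ((tau α l x : ℝ) : AddCircle (1 : ℝ)))
    ((AddCircle.continuous_mk' 1).comp h.tau_cont)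
    (fun x m => by rw [tau_add_int])
  have hed : ∀ z, e (d z) = z := by
    intro z
    obtain ⟨x, rfl⟩ := QuotientAddGroup.mk_surjective z
    change e (d (x : AddCircle (1 : ℝ))) = (x : AddCircle (1 : ℝ))
    rw [hd', he', Homeomorph.symm_apply_apply]
  have hde : ∀ z, d (e z) = z := by
    intro z
    obtain ⟨x, rfl⟩ := QuotientAddGroup.mk_surjective z
    change d (e (x : AddCircle (1 : ℝ))) = (x : AddCircle (1 : ℝ))
    rw [he', hd', Homeomorph.apply_symm_apply]
  refine ⟨{ toFun := fun z => (d z.1, z.2 + (β : AddCircle (1 : ℝ)) + t z.1)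
            invFun := fun z => (e z.1, z.2 - (β : AddCircle (1 : ℝ)) - t (e z.1))
            left_inv := fun z => by
              ext
              · simp [hed]
              · simp only [hed]; abel
            right_inv := fun z => by
              ext
              · simp [hde]
              · simp only [hde]; abel
            continuous_toFun := by fun_prop
            continuous_invFun := by fun_prop }, ?_, ?_⟩
  · intro x
    simp [proj, Fh, hd', ht']
  · intro x v
    ext
    · change h.Dh (x.1 + v.1) = h.Dh x.1 + v.1
      rw [Dh_apply, h.D_add_int]; rfl
    · change x.2 + v.2 + β + tau α l (x.1 + v.1) = x.2 + β + tau α l x.1 + v.2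
      rw [tau_add_int]; ring

end DD

open MeasureTheory AddCircle in
theorem no_eigen {α β : ℝ} (hne : ∀ n m : ℤ, β ≠ n * α + m)
    (G : ℝ → AddCircle (1 : ℝ)) (hG : Measurable G) (hper : ∀ t, G (t + 1) = G t)
    (hα : ∀ t, G (t + α) = G t + (β : AddCircle (1 : ℝ))) : False := by
  have hp : Function.Periodic (fun t => ((toCircle (G t) : Circle) : ℂ)) 1 := fun t => by
    simp only [hper t]
  set g : AddCircle (1 : ℝ) → ℂ := hp.lift with hg
  have hgc : ∀ t : ℝ, g t = toCircle (G t) := fun t => hp.lift_coe t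
  have hgm : Measurable g := by
    refine measurable_from_quotient.2 ?_
    have : Continuous fun z : AddCircle (1 : ℝ) => ((toCircle z : Circle) : ℂ) :=
      continuous_subtype_val.comp continuous_toCircle
    exact this.measurable.comp hG
  have hn : ∀ z, ‖g z‖ = 1 := by
    intro z
    obtain ⟨x, rfl⟩ := QuotientAddGroup.mk_surjective z
    exact (congrArg norm (hgc x)).trans (Circle.norm_coe _)
  have hrot : ∀ z, g (z + (α : AddCircle (1 : ℝ))) = (toCircle (β : AddCircle (1 : ℝ)) : ℂ) * g z := by
    intro z
    obtain ⟨x, rfl⟩ := QuotientAddGroup.mk_surjective z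
    rw [← AddCircle.coe_add, hgc, hgc, hα, toCircle_add]
    push_cast; ring
  have hmem : MemLp g 2 (haarAddCircle (T := 1)) :=
    MemLp.of_bound hgm.aestronglyMeasurable 1 (Eventually.of_forall fun z => (hn z).le)
  have hcoef : ∀ n, fourierCoeff g n = 0 := by
    intro n
    have e1 : fourierCoeff g n =
        ∫ t, fourier (-n) (t + (α : AddCircle (1 : ℝ))) • g (t + (α : AddCircle (1 : ℝ))) ∂haarAddCircle :=
      (integral_add_right_eq_self (μ := haarAddCircle)
        (fun t : AddCircle (1 : ℝ) => fourier (-n) t • g t) (α : AddCircle (1 : ℝ))).symm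
    have e2 : ∀ t, fourier (-n) (t + (α : AddCircle (1 : ℝ))) • g (t + (α : AddCircle (1 : ℝ))) =
        (toCircle ((β - n * α : ℝ) : AddCircle (1 : ℝ)) : ℂ) * (fourier (-n) t • g t) := by
      intro t
      have e3 : ((β - n * α : ℝ) : AddCircle (1 : ℝ)) =
          (-n) • (α : AddCircle (1 : ℝ)) + (β : AddCircle (1 : ℝ)) := by
        rw [← AddCircle.coe_zsmul, ← AddCircle.coe_add]
        congr 1
        simp; ring
      rw [hrot, e3, fourier_apply, fourier_apply, zsmul_add, toCircle_add, toCircle_add]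
      simp only [smul_eq_mul]
      push_cast; ring
    simp_rw [e2] at e1
    rw [integral_const_mul] at e1
    have e4 : fourierCoeff g n =
      (toCircle ((β - n * α : ℝ) : AddCircle (1 : ℝ)) : ℂ) * fourierCoeff g n := e1
    by_contra hc
    have e5 : (toCircle ((β - n * α : ℝ) : AddCircle (1 : ℝ)) : ℂ) = 1 := by
      have := mul_right_cancel₀ hc ((one_mul _).trans e4)
      exact this.symm
    have e6 : toCircle ((β - n * α : ℝ) : AddCircle (1 : ℝ)) = toCircle (0 : AddCircle (1 : ℝ)) := by
      rw [toCircle_zero]; exact Subtype.ext e5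
    have e7 := injective_toCircle one_ne_zero e6
    rw [AddCircle.coe_eq_zero_iff] at e7
    obtain ⟨m, hm⟩ := e7
    apply hne n m
    simp at hm
    linarith
  have hs := tsum_sq_fourierCoeff hmem.toLp
  rw [fourierCoeff_congr_ae hmem.coeFn_toLp] at hs
  have hi : ∫ t : AddCircle (1 : ℝ), ‖hmem.toLp g t‖ ^ 2 ∂haarAddCircle = 1 := by
    have : ∀ᵐ t : AddCircle (1 : ℝ) ∂haarAddCircle, ‖hmem.toLp g t‖ ^ 2 = (1 : ℝ) := by
      filter_upwards [hmem.coeFn_toLp] with t ht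
      rw [ht, hn]; norm_num
    rw [integral_congr_ae this]; simp
  rw [hi] at hs
  simp [hcoef] at hs

namespace DD
variable {α : ℝ} {l : ℤ → ℝ}

theorem J_right (h : DD α l) (t : ℝ) : Tendsto (Jf α l) (𝓝[≥] t) (𝓝 (Jf α l t)) := by
  refine tendsto_tsum_of_dominated_convergence (bound := fun n => l n * (|t| + 2))
    (h.sum.summable.mul_right _) ?_ ?_
  · intro n
    apply Tendsto.congr' _ tendsto_const_nhds
    have : Iio ((⌊t - n * α⌋ : ℝ) + 1 + n * α) ∈ 𝓝 t :=
      Iio_mem_nhds (by have := Int.lt_floor_add_one (t - n * α); linarith)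
    filter_upwards [mem_nhdsWithin_of_mem_nhds this, self_mem_nhdsWithin] with v hv hu
    have hu : t ≤ v := hu
    have hv : v < _ := hv
    have : ⌊v - n * α⌋ = ⌊t - n * α⌋ := by
      rw [Int.floor_eq_iff]
      have := Int.floor_le (t - n * α)
      constructor <;> linarith
    rw [this]
  · have : Iio (t + 1) ∈ 𝓝 t := Iio_mem_nhds (by linarith)
    filter_upwards [mem_nhdsWithin_of_mem_nhds this, self_mem_nhdsWithin] with v hv hu n
    have hu : t ≤ v := hu
    have hv : v < _ := hv
    rw [norm_mul, Real.norm_of_nonneg (h.pos n).le]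
    refine mul_le_mul_of_nonneg_left ?_ (h.pos n).le
    have := floor_bd (-(n * α)) (v - n * α)
    rw [sub_neg_eq_add, sub_add_cancel] at this
    refine this.trans ?_
    have : |v| ≤ |t| + 1 := by
      have := abs_add_le t (v - t)
      rw [abs_of_nonneg (by linarith : 0 ≤ v - t)] at this
      rw [add_sub_cancel] at this
      linarith
    linarith

theorem asym {K : ℝ × ℝ → AddCircle (1 : ℝ)} (hK : UniformContinuous K) (p q : ℕ → ℝ × ℝ)
    (hpq : Tendsto (fun k => dist (p k) (q k)) atTop (𝓝 0)) (a b : AddCircle (1 : ℝ))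
    (c : ℕ → AddCircle (1 : ℝ)) (hp : ∀ k, K (p k) = a + c k) (hq : ∀ k, K (q k) = b + c k) :
    a = b := by
  have h1 : Tendsto (fun k => (p k, q k)) atTop (uniformity (ℝ × ℝ)) :=
    tendsto_uniformity_iff_dist_tendsto_zero.2 hpq
  have h2 := tendsto_uniformity_iff_dist_tendsto_zero.1 (Tendsto.comp hK h1)
  have h3 : ∀ k, dist (K (p k)) (K (q k)) = dist a b := fun k => by
    rw [hp, hq, dist_add_right]
  have h4 : Tendsto (fun _ : ℕ => dist a b) atTop (𝓝 0) := by
    refine h2.congr fun k => ?_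
    simp [h3]
  exact dist_eq_zero.1 (tendsto_const_nhds_iff.1 h4)

theorem no_K (h : DD α l) {β : ℝ} (hne : ∀ n m : ℤ, β ≠ n * α + m)
    (K : ℝ × ℝ → AddCircle (1 : ℝ)) (hK : UniformContinuous K)
    (hper : ∀ (x y : ℝ) (m n : ℤ), K (x + m, y + n) = K (x, y))
    (hF : ∀ p, K (h.Fh β p) = K p + (β : AddCircle (1 : ℝ))) : False := by
  have hstep : ∀ x y : ℝ, K (h.Dh x, y + β + tau α l x) = K (x, y) + (β : AddCircle (1 : ℝ)) :=
    fun x y => hF (x, y)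
  have hgp : ∀ (k : ℤ) {s : ℝ} (h0 : 0 ≤ s) (h1 : s ≤ 1), h.Dh (gp α l k s) = gp α l (k + 1) s := by
    intro k s h0 h1
    simpa using h.Dh_gp k h0 h1 0
  have hgp0 : ∀ k, tau α l (gp α l k 0) = 0 := by
    intro k; simp only [gp, zero_mul, sub_zero]; exact h.tau_J _
  -- backward orbits
  have hback : ∀ (s : ℝ), 0 ≤ s → s ≤ 1 → ∀ (y : ℝ) (k : ℕ),
      K (gp α l (-k) s, y - k * β) = K (gp α l 0 s, y) + ((-(k * β) : ℝ) : AddCircle (1 : ℝ)) := by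
    intro s h0 h1 y k
    induction k with
    | zero => simp
    | succ k ih =>
      have e := hstep (gp α l (-(k + 1 : ℕ)) s) (y - (k + 1 : ℕ) * β)
      rw [hgp _ h0 h1, h.tau_gp_ne (by push_cast; omega) h0 h1] at e
      have e1 : (-((k + 1 : ℕ) : ℤ) + 1) = -(k : ℤ) := by push_cast; ring
      have e2 : y - (k + 1 : ℕ) * β + β + 0 = y - k * β := by push_cast; ring
      rw [e1, e2, ih] at e
      have e3 := eq_sub_of_add_eq e.symm
      rw [e3, add_sub_assoc (K _), ← AddCircle.coe_sub]
      congr 2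
      push_cast; ring
  -- forward orbits
  have hforw : ∀ (s : ℝ), 0 ≤ s → s ≤ 1 → ∀ (y : ℝ) (k : ℕ),
      K (gp α l (k + 1) s, y + (k + 1) * β + tau α l (gp α l 0 s)) =
        K (gp α l 0 s, y) + (((k + 1) * β : ℝ) : AddCircle (1 : ℝ)) := by
    intro s h0 h1 y k
    induction k with
    | zero =>
      have e := hstep (gp α l 0 s) y
      rw [hgp _ h0 h1] at e
      simpa using e
    | succ k ih =>
      have e := hstep (gp α l (k + 1) s) (y + (k + 1) * β + tau α l (gp α l 0 s))
      rw [hgp _ h0 h1, h.tau_gp_ne (k := (k:ℤ)+1) (by omega) h0 h1, ih, add_assoc (K _), ← AddCircle.coe_add] at e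
      have e1 : y + ((k + 1 : ℕ) + 1) * β + tau α l (gp α l 0 s) =
          y + (k + 1) * β + tau α l (gp α l 0 s) + β + 0 := by push_cast; ring
      have e2 : (((k + 1 : ℕ) : ℝ) + 1) * β = (k + 1) * β + β := by push_cast; ring
      have e3 : (((k + 1 : ℕ) : ℤ) + 1) = (k : ℤ) + 1 + 1 := by push_cast; ring
      rw [e1, e2, e3]
      exact e
  have hl0 : ∀ (g : ℕ → ℤ) (s : ℝ), Injective g → Tendsto (fun k => |s * l (g k)|) atTop (𝓝 0) := by
    intro g s hg
    have h1 := h.sum.summable.tendsto_cofinite_zero.comp (hg.tendsto_cofinite)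
    rw [Nat.cofinite_eq_atTop] at h1
    have := (h1.const_mul s).abs
    simpa using this
  have hdist : ∀ (k : ℤ) (s y : ℝ), dist (gp α l k s, y) (gp α l k 0, y) = |s * l k| := by
    intro k s y
    rw [Prod.dist_eq, dist_self, Real.dist_eq]
    have : gp α l k s - gp α l k 0 = -(s * l k) := by simp only [gp]; ring
    rw [this, abs_neg]
    exact max_eq_left (abs_nonneg _)
  have hA : ∀ (s : ℝ), 0 ≤ s → s ≤ 1 → ∀ y, K (gp α l 0 s, y) = K (gp α l 0 0, y) := by
    intro s h0 h1 y
    refine asym hK (fun k => (gp α l (-k) s, y - k * β)) (fun k => (gp α l (-k) 0, y - k * β)) ?_ _ _ _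
      (hback s h0 h1 y) (hback 0 le_rfl zero_le_one y)
    simp_rw [hdist]
    exact hl0 (fun k => -(k : ℤ)) s (fun a b hab => by simpa using hab)
  have hB : ∀ (s : ℝ), 0 ≤ s → s ≤ 1 → ∀ y,
      K (gp α l 0 s, y) = K (gp α l 0 0, y + tau α l (gp α l 0 s)) := by
    intro s h0 h1 y
    refine asym hK (fun k => (gp α l (k + 1) s, y + (k + 1) * β + tau α l (gp α l 0 s)))
      (fun k => (gp α l (k + 1) 0, y + (k + 1) * β + tau α l (gp α l 0 s))) ?_ _ _ _
      (hforw s h0 h1 y) (fun k => ?_)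
    · simp_rw [hdist]
      exact hl0 (fun k => (k : ℤ) + 1) s (fun a b hab => by simpa using hab)
    · have := hforw 0 le_rfl zero_le_one (y + tau α l (gp α l 0 s)) k
      rw [hgp0, add_zero] at this
      rw [← this]
      congr 2; ring
  have hC : ∀ y, K (0, y) = K (0, 0) := by
    intro y
    have hz : gp α l 0 0 = 0 := by simp [gp, J_zero]
    have hiv : Int.fract y ∈ (fun s : ℝ => Real.sin (Real.pi * s) ^ 2) '' Icc 0 (1 / 2) := by
      apply intermediate_value_Icc (by norm_num) (by fun_prop)
      have : Real.pi * (1 / 2) = Real.pi / 2 := by ring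
      simp only [mul_zero, Real.sin_zero, this, Real.sin_pi_div_two]
      exact ⟨by simpa using Int.fract_nonneg y, by simpa using (Int.fract_lt_one y).le⟩
    obtain ⟨s, ⟨h0, h1⟩, hs⟩ := hiv
    simp only at hs
    have h1 : s ≤ 1 := by linarith
    have e := (hA s h0 h1 0).symm.trans (hB s h0 h1 0)
    rw [h.tau_gp_zero h0 h1, hs, hz, zero_add] at e
    rw [e]
    have := hper 0 (Int.fract y) 0 ⌊y⌋
    rw [Int.fract_add_floor] at this
    simpa using this
  have hJ : ∀ t y, K (Jf α l (t + α), y + β) = K (Jf α l t, y) + (β : AddCircle (1 : ℝ)) := by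
    intro t y
    have := hstep (Jf α l t) y
    rwa [h.Dh_apply, h.D_J, h.tau_J, add_zero] at this
  have hind : ∀ t : ℝ, (∀ y, K (Jf α l t, y) = K (Jf α l t, 0)) ↔
      (∀ y, K (Jf α l (t + α), y) = K (Jf α l (t + α), 0)) := by
    intro t
    constructor
    · intro ht y
      have e1 := hJ t (y - β)
      have e2 := hJ t (0 - β)
      rw [sub_add_cancel] at e1 e2
      rw [e1, e2, ht, ht (0 - β)]
    · intro ht y
      have e1 := hJ t y
      have e2 := hJ t 0
      rw [ht] at e1 e2
      exact add_right_cancel (e1.symm.trans e2)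
  have horb0 : ∀ n : ℤ, ∀ y, K (Jf α l (n * α), y) = K (Jf α l (n * α), 0) := by
    intro n
    induction n using Int.induction_on with
    | zero => simpa [J_zero] using hC
    | succ n ih =>
      have := (hind _).1 ih
      have e : (n : ℤ) * α + α = ((n + 1 : ℤ) : ℝ) * α := by push_cast; ring
      rwa [e] at this
    | pred n ih =>
      apply (hind _).2
      have e : ((-n - 1 : ℤ) : ℝ) * α + α = ((-n : ℤ) : ℝ) * α := by push_cast; ring
      rwa [e]
  have horb : ∀ n m : ℤ, ∀ y, K (Jf α l (n * α + m), y) = K (Jf α l (n * α + m), 0) := by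
    intro n m y
    rw [h.J_add_int]
    have e1 := hper (Jf α l (n * α)) y m 0
    have e2 := hper (Jf α l (n * α)) 0 m 0
    simp only [Int.cast_zero, add_zero] at e1 e2
    rw [e1, e2, horb0]
  have hdense : Dense (AddSubgroup.closure {α, (1 : ℝ)} : Set ℝ) :=
    dense_addSubgroupClosure_pair_iff.2 (by simpa using h.irr)
  have hall : ∀ t y, K (Jf α l t, y) = K (Jf α l t, 0) := by
    intro t y
    by_contra hc
    have hcont : ∀ y, Tendsto (fun s => K (Jf α l s, y)) (𝓝[≥] t) (𝓝 (K (Jf α l t, y))) := fun y =>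
      (hK.continuous.tendsto _).comp ((h.J_right t).prodMk_nhds tendsto_const_nhds)
    have hev := ((hcont y).prodMk_nhds (hcont 0)).eventually
      ((isOpen_ne_fun continuous_fst continuous_snd).mem_nhds hc)
    obtain ⟨v, hv, hv'⟩ := (mem_nhdsGE_iff_exists_Ico_subset).1 hev
    obtain ⟨s, hs, hs1, hs2⟩ := hdense.exists_between hv
    have hs' := hv' ⟨hs1.le, hs2⟩
    obtain ⟨n, m, hnm⟩ := AddSubgroup.mem_closure_pair.1 hs
    apply hs'
    have : s = n * α + m := by rw [← hnm]; simp
    rw [this]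
    exact horb n m y
  refine no_eigen hne (fun t => K (Jf α l t, 0)) ?_ ?_ ?_
  · exact hK.continuous.measurable.comp (h.J_mono.measurable.prodMk measurable_const)
  · intro t
    have e := hper (Jf α l t) 0 1 0
    have e2 := h.J_add_int t 1
    simp only [Int.cast_one, Int.cast_zero, add_zero] at e e2
    rw [e2, e]
  · intro t
    have := hJ t 0
    rwa [hall] at this

end DD

/-- **Jäger.**  For every totally irrational `ρ ∈ ℝ²` there is a pseudo-rotation of 𝕋²
with rotation vector `ρ` and bounded mean motion which is not semiconjugate to `R_ρ`. -/
theorem exists_pseudo_rotation_not_semiconjugate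
    (ρ : ℝ × ℝ) (hirr : TotallyIrrational ρ) :
    ∃ (f : T2 ≃ₜ T2) (F : (ℝ × ℝ) ≃ₜ (ℝ × ℝ)),
      IsLift ⇑f ⇑F ∧ IsPseudoRotation ⇑F ρ ∧ BoundedMeanMotion F ρ ∧
      ¬ ∃ h : T2 → T2, Continuous h ∧ Function.Surjective h ∧
          ∀ z : T2, h (f z) = Rrot ρ (h z) := by

  obtain ⟨α, β⟩ := ρ
  have hirrα : Irrational α := by
    rintro ⟨q, hq⟩
    have := hirr q (-1) 0 (by push_cast; rw [hq]; ring)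
    norm_num at this
  have hne : ∀ n m : ℤ, β ≠ n * α + m := by
    intro n m he
    have := hirr m n (-1) (by push_cast; rw [he]; ring)
    norm_num at this
  obtain ⟨l, h⟩ := exists_DD α hirrα
  obtain ⟨f, hf⟩ := h.exists_f β
  refine ⟨f, h.Fh β, hf, h.pseudo β, ⟨2, h.bmm β⟩, ?_⟩
  rintro ⟨g, hg, -, hsc⟩
  have hproj : UniformContinuous proj := by
    have h1 : UniformContinuous (fun x : ℝ => (x : AddCircle (1 : ℝ))) :=
      uniformContinuous_addMonoidHom_of_continuous
        (f := QuotientAddGroup.mk' (AddSubgroup.zmultiples (1 : ℝ))) (AddCircle.continuous_mk' 1)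
    exact (h1.comp uniformContinuous_fst).prodMk (h1.comp uniformContinuous_snd)
  have hgu : UniformContinuous g := CompactSpace.uniformContinuous_of_continuous hg
  refine h.no_K hne (fun p => (g (proj p)).2) (uniformContinuous_snd.comp (hgu.comp hproj)) ?_ ?_
  · intro x y m n
    simp only [proj, DD.coe_add_int]
  · intro p
    simp only [hf.1 p, hsc, Rrot]
end
end
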